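/- There exist constants c₁ > 0 and c₂ > 0 such that the following holds: every family of n pairwise intersecting closed Jordan curves in general position in the plane that has exactly T touching pairs with T ≥ 3n determines at least c₂ · T · (log log(T/n))^(c₁) intersection points. -/

import Mathlib

noncomputable section

abbrev Plane : Type := EuclideanSpace ℝ (Fin 2)

/-- A closed Jordan curve: a subset of the plane homeomorphic to the unit circle. -/
def IsJordanCurve (γ : Set Plane) : Prop :=
  Nonempty (γ ≃ₜ Metric.sphere (0 : Plane) 1)

/-- A Jordan arc: a subset of the plane homeomorphic to the closed unit interval. -/
def IsJordanArc (γ : Set Plane) : Prop :=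
  Nonempty (γ ≃ₜ unitInterval)

/-- General position: any two distinct members intersect in a finite set, and no point
of the plane lies on three distinct members. -/
def GenPos {n : ℕ} (γ : Fin n → Set Plane) : Prop :=
  (∀ i j : Fin n, i ≠ j → (γ i ∩ γ j).Finite) ∧
  (∀ p : Plane, ∀ i j k : Fin n, p ∈ γ i → p ∈ γ j → p ∈ γ k → i = j ∨ i = k ∨ j = k)

/-- `m`-intersecting: any two distinct members intersect in at most `m` points. -/
def MIntersecting {n : ℕ} (m : ℕ) (γ : Fin n → Set Plane) : Prop :=
  ∀ i j : Fin n, i ≠ j → (γ i ∩ γ j).ncard ≤ m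

/-- Two curves touch if their intersection is a singleton. -/
def Touches (a b : Set Plane) : Prop := ∃ x, a ∩ b = {x}

/-- The number of touching pairs of the family. -/
def touchingPairs {n : ℕ} (γ : Fin n → Set Plane) : ℕ :=
  {p : Fin n × Fin n | p.1 < p.2 ∧ Touches (γ p.1) (γ p.2)}.ncard

/-- The set of intersection points of the family: points lying on at least two
distinct members. -/
def interPoints {n : ℕ} (γ : Fin n → Set Plane) : Set Plane :=
  {x : Plane | ∃ i j : Fin n, i ≠ j ∧ x ∈ γ i ∧ x ∈ γ j}

section M1
open Set

/-- continuous logarithm on ℝ -/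
theorem exists_log_real (g : ℝ → ℂ) (hg : Continuous g) (h0 : ∀ x, g x ≠ 0) :
    ∃ θ : ℝ → ℂ, Continuous θ ∧ ∀ x, Complex.exp (θ x) = g x := by
  rcases Complex.isCoveringMapOn_exp.existsUnique_continuousMap_lifts
    (⟨g, hg⟩ : C(ℝ, ℂ)) (a₀ := 0) (e₀ := Complex.log (g 0)) (Complex.exp_log (h0 0))
    (fun x => h0 x) with ⟨f, ⟨-, hf⟩, -⟩
  exact ⟨f, f.continuous, fun x => congrFun hf x⟩

theorem exists_log_real2 (g : ℝ × ℝ → ℂ) (hg : Continuous g) (h0 : ∀ x, g x ≠ 0) :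
    ∃ θ : ℝ × ℝ → ℂ, Continuous θ ∧ ∀ x, Complex.exp (θ x) = g x := by
  rcases Complex.isCoveringMapOn_exp.existsUnique_continuousMap_lifts
    (⟨g, hg⟩ : C(ℝ × ℝ, ℂ)) (a₀ := 0) (e₀ := Complex.log (g 0)) (Complex.exp_log (h0 0))
    (fun x => h0 x) with ⟨f, ⟨-, hf⟩, -⟩
  exact ⟨f, f.continuous, fun x => congrFun hf x⟩

/-- clamping to an interval -/
def clampR (s t x : ℝ) : ℝ := max (min s t) (min (max s t) x)

theorem clampR_mem (s t x : ℝ) : clampR s t x ∈ uIcc s t := by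
  unfold clampR
  rw [uIcc, mem_Icc]
  exact ⟨le_max_left _ _, max_le (min_le_max) (min_le_left _ _)⟩

theorem clampR_eq {s t x : ℝ} (h : x ∈ uIcc s t) : clampR s t x = x := by
  unfold clampR
  rw [uIcc, mem_Icc] at h
  rw [min_eq_right h.2, max_eq_right h.1]

theorem clampR_cont (s t : ℝ) : Continuous (clampR s t) := by
  unfold clampR; fun_prop

/-- angle witness -/
def AngW (g : ℝ → ℂ) (z : ℂ) (s t : ℝ) (θ : ℝ → ℂ) : Prop :=
  ContinuousOn θ (uIcc s t) ∧ ∀ x ∈ uIcc s t, Complex.exp (θ x) = g x - z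

open Classical in
/-- angle change -/
def Ang (g : ℝ → ℂ) (s t : ℝ) (z : ℂ) : ℂ :=
  if h : ∃ θ, AngW g z s t θ then h.choose t - h.choose s else 0

theorem angW_unique {g : ℝ → ℂ} {z : ℂ} {s t : ℝ} {θ θ' : ℝ → ℂ}
    (h : AngW g z s t θ) (h' : AngW g z s t θ') : θ t - θ s = θ' t - θ' s := by
  have hs : s ∈ uIcc s t := left_mem_uIcc
  have ht : t ∈ uIcc s t := right_mem_uIcc
  have hc : ContinuousOn (fun x => (θ x - θ' x) / (2 * Real.pi * Complex.I)) (uIcc s t) :=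
    (h.1.sub h'.1).div_const _
  have hne : (2 * Real.pi * Complex.I : ℂ) ≠ 0 := Complex.two_pi_I_ne_zero
  have hinteg : ∀ x ∈ uIcc s t, ∃ k : ℤ, (θ x - θ' x) / (2 * Real.pi * Complex.I) = k := by
    intro x hx
    have : Complex.exp (θ x) = Complex.exp (θ' x) := by rw [h.2 x hx, h'.2 x hx]
    rw [Complex.exp_eq_exp_iff_exists_int] at this
    obtain ⟨k, hk⟩ := this
    refine ⟨k, ?_⟩
    rw [hk]; field_simp; ring
  -- real part is continuous with integer values
  have hpre : IsPreconnected (uIcc s t) := isPreconnected_uIcc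
  have hre : ContinuousOn (fun x => ((θ x - θ' x) / (2 * Real.pi * Complex.I)).re) (uIcc s t) :=
    Complex.continuous_re.comp_continuousOn hc
  have hmap : MapsTo (fun x => ((θ x - θ' x) / (2 * Real.pi * Complex.I)).re) (uIcc s t)
      (range ((↑) : ℤ → ℝ)) := by
    intro x hx
    obtain ⟨k, hk⟩ := hinteg x hx
    exact ⟨k, by simp [hk]⟩
  have hconst := hpre.constant_of_mapsTo (T := range ((↑) : ℤ → ℝ))
    Int.isClosedEmbedding_coe_real.isEmbedding.isDiscrete_range hre hmap hs ht
  obtain ⟨k, hk⟩ := hinteg s hs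
  obtain ⟨k', hk'⟩ := hinteg t ht
  rw [hk, hk'] at hconst
  simp at hconst
  rw [← hconst, ← hk] at hk'
  have := (div_left_inj' hne).1 hk'
  linear_combination this

theorem ang_eq {g : ℝ → ℂ} {z : ℂ} {s t : ℝ} {θ : ℝ → ℂ} (h : AngW g z s t θ) :
    Ang g s t z = θ t - θ s := by
  have h' : ∃ θ, AngW g z s t θ := ⟨θ, h⟩
  rw [Ang, dif_pos h']
  exact angW_unique h'.choose_spec h

theorem exists_angW {g : ℝ → ℂ} (hg : Continuous g) {z : ℂ} {s t : ℝ}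
    (hz : z ∉ g '' uIcc s t) : ∃ θ, AngW g z s t θ := by
  obtain ⟨θ, hc, he⟩ := exists_log_real (fun x => g (clampR s t x) - z)
    ((hg.comp (clampR_cont s t)).sub continuous_const) (fun x h => hz ⟨_, clampR_mem s t x, sub_eq_zero.1 h⟩)
  exact ⟨θ, hc.continuousOn, fun x hx => by rw [he, clampR_eq hx]⟩

theorem ang_exp {g : ℝ → ℂ} (hg : Continuous g) {z : ℂ} {s t : ℝ}
    (hz : z ∉ g '' uIcc s t) : Complex.exp (Ang g s t z) * (g s - z) = g t - z := by
  obtain ⟨θ, h⟩ := exists_angW hg hz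
  rw [ang_eq h, ← h.2 s left_mem_uIcc, ← h.2 t right_mem_uIcc, ← Complex.exp_add]
  congr 1; ring

theorem ang_rev {g : ℝ → ℂ} (hg : Continuous g) {z : ℂ} {s t : ℝ}
    (hz : z ∉ g '' uIcc s t) : Ang g t s z = - Ang g s t z := by
  obtain ⟨θ, h⟩ := exists_angW hg hz
  have h' : AngW g z t s θ := by unfold AngW at *; rwa [uIcc_comm]
  rw [ang_eq h, ang_eq h']; ring

theorem ang_add {g : ℝ → ℂ} (hg : Continuous g) {z : ℂ} {s t u : ℝ} (hst : s ≤ t) (htu : t ≤ u)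
    (hz : z ∉ g '' uIcc s u) : Ang g s u z = Ang g s t z + Ang g t u z := by
  obtain ⟨θ, h⟩ := exists_angW hg hz
  have hsu := hst.trans htu
  have h1 : AngW g z s t θ := by
    unfold AngW at *
    rw [uIcc_of_le hst]; rw [uIcc_of_le hsu] at h
    exact ⟨h.1.mono (Icc_subset_Icc_right htu), fun x hx => h.2 x (Icc_subset_Icc_right htu hx)⟩
  have h2 : AngW g z t u θ := by
    unfold AngW at *
    rw [uIcc_of_le htu]; rw [uIcc_of_le hsu] at h
    exact ⟨h.1.mono (Icc_subset_Icc_left hst), fun x hx => h.2 x (Icc_subset_Icc_left hst hx)⟩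
  rw [ang_eq h, ang_eq h1, ang_eq h2]; ring

/-- abstract arcs -/
structure Arc where
  p : ℂ
  q : ℂ
  A : ℂ → ℂ

namespace Arc
def W (a b : Arc) : ℂ := a.A b.p + b.A a.q - a.A b.q - b.A a.p

/-- z is off the arc (algebraic trace of it) -/
def Off (a : Arc) (z : ℂ) : Prop := Complex.exp (a.A z) * (a.p - z) = a.q - z ∧ a.p ≠ z ∧ a.q ≠ z

structure Comp (a b : Arc) : Prop where
  ap : a.Off b.p
  aq : a.Off b.q
  bp : b.Off a.p
  bq : b.Off a.q
  w : a.W b = 0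

def rev (a : Arc) : Arc := ⟨a.q, a.p, fun z => - a.A z⟩
def cat (a b : Arc) : Arc := ⟨a.p, b.q, fun z => a.A z + b.A z⟩

theorem Off.rev {a : Arc} {z : ℂ} (h : a.Off z) : a.rev.Off z := by
  obtain ⟨h1, h2, h3⟩ := h
  refine ⟨?_, h3, h2⟩
  simp only [Arc.rev]
  rw [← h1, ← mul_assoc, ← Complex.exp_add]; simp

theorem Off.cat {a b : Arc} {z : ℂ} (ha : a.Off z) (hb : b.Off z) (h : a.q = b.p) :
    (a.cat b).Off z := by
  obtain ⟨h1, h2, h3⟩ := ha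
  obtain ⟨h4, h5, h6⟩ := hb
  refine ⟨?_, h2, h6⟩
  simp only [Arc.cat]
  rw [← h4, ← h, ← h1, Complex.exp_add]; ring

theorem Comp.symm {a b : Arc} (h : a.Comp b) : b.Comp a :=
  ⟨h.bp, h.bq, h.ap, h.aq, by have := h.w; unfold W at *; linear_combination -this⟩

theorem Comp.rev {a b : Arc} (h : a.Comp b) : a.rev.Comp b :=
  ⟨h.ap.rev, h.aq.rev, h.bq, h.bp, by
    have := h.w; unfold W Arc.rev at *; simp only; linear_combination -this⟩

theorem Comp.revr {a b : Arc} (h : a.Comp b) : a.Comp b.rev := h.symm.rev.symm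

theorem Comp.cat {a b c : Arc} (h : a.Comp c) (h' : b.Comp c) (hab : a.q = b.p) :
    (a.cat b).Comp c :=
  ⟨h.ap.cat h'.ap hab, h.aq.cat h'.aq hab, h.bp, h'.bq, by
    have h1 := h.w; have h2 := h'.w; unfold W Arc.cat at *; simp only; rw [hab] at h1
    linear_combination h1 + h2⟩

theorem Comp.catr {a b c : Arc} (h : c.Comp a) (h' : c.Comp b) (hab : a.q = b.p) :
    c.Comp (a.cat b) := (h.symm.cat h'.symm hab).symm
end Arc

/-- geometric segments -/
def segA (g : ℝ → ℂ) (s t : ℝ) : Arc := ⟨g s, g t, Ang g s t⟩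

theorem segA_off {g : ℝ → ℂ} (hg : Continuous g) {z : ℂ} {s t : ℝ}
    (hz : z ∉ g '' uIcc s t) : (segA g s t).Off z :=
  ⟨ang_exp hg hz, fun h => hz ⟨s, left_mem_uIcc, h⟩, fun h => hz ⟨t, right_mem_uIcc, h⟩⟩

theorem W_disj {g h : ℝ → ℂ} (hg : Continuous g) (hh : Continuous h) {s t s' t' : ℝ}
    (hd : ∀ x ∈ uIcc s t, ∀ y ∈ uIcc s' t', g x ≠ h y) : (segA g s t).W (segA h s' t') = 0 := by
  obtain ⟨Θ, hc, he⟩ := exists_log_real2 (fun x => g (clampR s t x.1) - h (clampR s' t' x.2))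
    (((hg.comp (clampR_cont s t)).comp continuous_fst).sub
      ((hh.comp (clampR_cont s' t')).comp continuous_snd))
    (fun x h => hd _ (clampR_mem s t x.1) _ (clampR_mem s' t' x.2) (sub_eq_zero.1 h))
  have e1 : ∀ y ∈ uIcc s' t', Ang g s t (h y) = Θ (t, y) - Θ (s, y) := by
    intro y hy
    refine ang_eq (θ := fun x => Θ (x, y)) ⟨by fun_prop, fun x hx => ?_⟩
    rw [he]; simp only; rw [clampR_eq hx, clampR_eq hy]
  have e2 : ∀ x ∈ uIcc s t, Ang h s' t' (g x) = Θ (x, t') - Θ (x, s') := by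
    intro x hx
    rw [ang_eq (θ := fun y => Θ (x, y) + Real.pi * Complex.I) ⟨by fun_prop, fun y hy => ?_⟩]
    · ring
    · rw [Complex.exp_add, he]; simp only; rw [clampR_eq hx, clampR_eq hy, Complex.exp_pi_mul_I]; ring
  unfold Arc.W segA
  simp only
  rw [e1 _ left_mem_uIcc, e1 _ right_mem_uIcc, e2 _ left_mem_uIcc, e2 _ right_mem_uIcc]
  ring

theorem comp_disj {g h : ℝ → ℂ} (hg : Continuous g) (hh : Continuous h) {s t s' t' : ℝ}
    (hd : ∀ x ∈ uIcc s t, ∀ y ∈ uIcc s' t', g x ≠ h y) : (segA g s t).Comp (segA h s' t') where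
  ap := segA_off hg (fun ⟨x, hx, e⟩ => hd x hx _ left_mem_uIcc e)
  aq := segA_off hg (fun ⟨x, hx, e⟩ => hd x hx _ right_mem_uIcc e)
  bp := segA_off hh (fun ⟨x, hx, e⟩ => hd _ left_mem_uIcc x hx e.symm)
  bq := segA_off hh (fun ⟨x, hx, e⟩ => hd _ right_mem_uIcc x hx e.symm)
  w := W_disj hg hh hd

/-- closed curve parametrization -/
structure IsLoop (g : ℝ → ℂ) : Prop where
  cont : Continuous g
  per : ∀ x, g (x + 1) = g x
  inj : ∀ x y, 0 ≤ x → x < 1 → 0 ≤ y → y < 1 → g x = g y → x = y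

theorem IsLoop.inj' {g : ℝ → ℂ} (h : IsLoop g) {x y : ℝ} (hxy : x ≤ y) (hy : y < x + 1)
    (e : g x = g y) : x = y := by
  have hper : Function.Periodic g 1 := h.per
  have hf : ∀ x, g (Int.fract x) = g x := fun x => by
    have := hper.sub_zsmul_eq (x := x) ⌊x⌋
    rw [zsmul_eq_mul, mul_one] at this
    exact this
  have := h.inj (Int.fract x) (Int.fract y) (Int.fract_nonneg _) (Int.fract_lt_one _)
    (Int.fract_nonneg _) (Int.fract_lt_one _) (by rw [hf, hf, e])
  rw [Int.fract_eq_fract] at this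
  obtain ⟨k, hk⟩ := this
  have h1 : (k : ℝ) ≤ 0 := by linarith
  have h2 : (-1 : ℝ) < k := by linarith
  have h1' : k ≤ 0 := by exact_mod_cast h1
  have h2' : -1 < k := by exact_mod_cast h2
  have : k = 0 := by omega
  rw [this] at hk; push_cast at hk; linarith

theorem W_touch_aux {g h : ℝ → ℂ} (hg : IsLoop g) (hh : IsLoop h) {s t s' t' : ℝ}
    (hst : s ≤ t) (hst' : s' ≤ t') (ht : t < s + 1) (ht' : t' < s' + 1) {x : ℂ}
    (hx : ∀ a b, g a = h b → g a = x)
    (h1 : g s ∉ range h) (h2 : g t ∉ range h) (h3 : h s' ∉ range g) (h4 : h t' ∉ range g) :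
    (segA g s t).W (segA h s' t') = 0 := by
  by_cases A : x ∈ g '' uIcc s t; swap
  · exact W_disj hg.cont hh.cont fun a ha b _ e => A ⟨a, ha, hx a b e⟩
  by_cases B : x ∈ h '' uIcc s' t'; swap
  · exact W_disj hg.cont hh.cont fun a _ b hb e => B ⟨b, hb, by rw [← e, hx a b e]⟩
  have xg : ∃ b, h b = x := by obtain ⟨b, -, e⟩ := B; exact ⟨b, e⟩
  have xh : ∃ b, g b = x := by obtain ⟨b, -, e⟩ := A; exact ⟨b, e⟩
  have A' : x ∉ g '' uIcc t (s + 1) := by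
    rintro ⟨b, hb, eb⟩
    obtain ⟨a, ha, ea⟩ := A
    rw [uIcc_of_le (by linarith), mem_Icc] at hb
    rw [uIcc_of_le hst, mem_Icc] at ha
    obtain ⟨c, hc⟩ := xg
    have n1 : g s ≠ x := fun e => h1 ⟨c, by rw [hc, e]⟩
    have n2 : g t ≠ x := fun e => h2 ⟨c, by rw [hc, e]⟩
    have n3 : g (s+1) ≠ x := by rwa [hg.per]
    have ha1 : s < a := lt_of_le_of_ne ha.1 (fun e => n1 (by rw [e, ea]))
    have ha2 : a < t := lt_of_le_of_ne ha.2 (fun e => n2 (by rw [← e, ea]))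
    have := hg.inj' (x := a) (y := b) (by linarith) (by linarith) (by rw [ea, eb])
    linarith
  have B' : x ∉ h '' uIcc t' (s' + 1) := by
    rintro ⟨b, hb, eb⟩
    obtain ⟨a, ha, ea⟩ := B
    rw [uIcc_of_le (by linarith), mem_Icc] at hb
    rw [uIcc_of_le hst', mem_Icc] at ha
    obtain ⟨c, hc⟩ := xh
    have n1 : h s' ≠ x := fun e => h3 ⟨c, by rw [hc, e]⟩
    have n2 : h t' ≠ x := fun e => h4 ⟨c, by rw [hc, e]⟩
    have n3 : h (s'+1) ≠ x := by rwa [hh.per]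
    have ha1 : s' < a := lt_of_le_of_ne ha.1 (fun e => n1 (by rw [e, ea]))
    have ha2 : a < t' := lt_of_le_of_ne ha.2 (fun e => n2 (by rw [← e, ea]))
    have := hh.inj' (x := a) (y := b) (by linarith) (by linarith) (by rw [ea, eb])
    linarith
  have w1 : (segA g t (s+1)).W (segA h s' t') = 0 :=
    W_disj hg.cont hh.cont fun a ha b _ e => A' ⟨a, ha, hx a b e⟩
  have w2 : (segA g t (s+1)).W (segA h t' (s'+1)) = 0 :=
    W_disj hg.cont hh.cont fun a ha b _ e => A' ⟨a, ha, hx a b e⟩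
  have w3 : (segA g s t).W (segA h t' (s'+1)) = 0 :=
    W_disj hg.cont hh.cont fun a _ b hb e => B' ⟨b, hb, by rw [← e, hx a b e]⟩
  unfold Arc.W segA at *
  simp only at *
  rw [hg.per] at w1 w2
  rw [hh.per] at w2 w3
  have q1 : Ang g s (s+1) (h s') = Ang g s t (h s') + Ang g t (s+1) (h s') :=
    ang_add hg.cont hst (by linarith) (fun ⟨a, _, e⟩ => h3 ⟨a, e⟩)
  have q2 : Ang g s (s+1) (h t') = Ang g s t (h t') + Ang g t (s+1) (h t') :=
    ang_add hg.cont hst (by linarith) (fun ⟨a, _, e⟩ => h4 ⟨a, e⟩)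
  linear_combination -w1 - w2 - w3

theorem comp_touch {g h : ℝ → ℂ} (hg : IsLoop g) (hh : IsLoop h) {s t s' t' : ℝ}
    (hst : |s - t| < 1) (hst' : |s' - t'| < 1) {x : ℂ}
    (hx : ∀ a b, g a = h b → g a = x)
    (h1 : g s ∉ range h) (h2 : g t ∉ range h) (h3 : h s' ∉ range g) (h4 : h t' ∉ range g) :
    (segA g s t).Comp (segA h s' t') := by
  have o1 : h s' ∉ g '' uIcc s t := fun ⟨a, _, e⟩ => h3 ⟨a, e⟩
  have o2 : h t' ∉ g '' uIcc s t := fun ⟨a, _, e⟩ => h4 ⟨a, e⟩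
  have o3 : g s ∉ h '' uIcc s' t' := fun ⟨a, _, e⟩ => h1 ⟨a, e⟩
  have o4 : g t ∉ h '' uIcc s' t' := fun ⟨a, _, e⟩ => h2 ⟨a, e⟩
  refine ⟨segA_off hg.cont o1, segA_off hg.cont o2, segA_off hh.cont o3, segA_off hh.cont o4, ?_⟩
  rw [abs_lt] at hst hst'
  have r1 := ang_rev hg.cont o1
  have r2 := ang_rev hg.cont o2
  have r3 := ang_rev hh.cont o3
  have r4 := ang_rev hh.cont o4
  rcases le_total s t with c | c <;> rcases le_total s' t' with c' | c'
  · exact W_touch_aux hg hh c c' (by linarith) (by linarith) hx h1 h2 h3 h4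
  · have := W_touch_aux hg hh c c' (by linarith) (by linarith) hx h1 h2 h4 h3
    unfold Arc.W segA at *; simp only at *
    rw [r3, r4] at this; linear_combination -this
  · have := W_touch_aux hg hh c c' (by linarith) (by linarith) hx h2 h1 h3 h4
    unfold Arc.W segA at *; simp only at *
    rw [r1, r2] at this; linear_combination -this
  · have := W_touch_aux hg hh c c' (by linarith) (by linarith) hx h2 h1 h4 h3
    unfold Arc.W segA at *; simp only at *
    rw [r1, r2, r3, r4] at this; linear_combination this
end M1

section M2
open Set

theorem vk_contra (u v : Fin 3 → ℂ) (a : Fin 3 → Fin 3 → Arc)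
    (hp : ∀ i j, (a i j).p = u i) (hq : ∀ i j, (a i j).q = v j)
    (hc : ∀ i i' j j', i ≠ i' → j ≠ j' → (a i j).Comp (a i' j')) : False := by
  have other : ∀ j : Fin 3, ∃ j', j ≠ j' := by decide
  have huu : ∀ i i', i ≠ i' → u i ≠ u i' := fun i i' h => by
    have := (hc i i' 0 1 h (by decide)).ap.2.1
    rwa [hp, hp] at this
  have hvv : ∀ i i', i ≠ i' → v i ≠ v i' := fun i i' h => by
    have := (hc 0 1 i i' (by decide) h).aq.2.2
    rwa [hq, hq] at this
  have huv : ∀ i j, u i ≠ v j := fun i j => by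
    obtain ⟨i', hi⟩ := other i
    obtain ⟨j', hj⟩ := other j
    have := (hc i i' j' j hi hj.symm).aq.2.1
    rwa [hp, hq] at this
  set pI : ℂ := Real.pi * Complex.I with hpI
  have pI0 : pI ≠ 0 := by
    simp [hpI, Real.pi_ne_zero]
  have epI : Complex.exp pI = -1 := Complex.exp_pi_mul_I
  let Lu : Fin 3 → Fin 3 → ℂ := fun i i' =>
    if i < i' then Complex.log (u i - u i') else Complex.log (u i' - u i) + pI
  let Lv : Fin 3 → Fin 3 → ℂ := fun i i' =>
    if i < i' then Complex.log (v i - v i') else Complex.log (v i' - v i) + pI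
  let Luv : Fin 3 → Fin 3 → ℂ := fun i j => Complex.log (u i - v j)
  have eLu : ∀ i i', i ≠ i' → Complex.exp (Lu i i') = u i - u i' := by
    intro i i' h
    simp only [Lu]
    split_ifs
    · exact Complex.exp_log (sub_ne_zero.2 (huu i i' h))
    · rw [Complex.exp_add, epI, Complex.exp_log (sub_ne_zero.2 (huu i' i h.symm))]; ring
  have eLv : ∀ i i', i ≠ i' → Complex.exp (Lv i i') = v i - v i' := by
    intro i i' h
    simp only [Lv]
    split_ifs
    · exact Complex.exp_log (sub_ne_zero.2 (hvv i i' h))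
    · rw [Complex.exp_add, epI, Complex.exp_log (sub_ne_zero.2 (hvv i' i h.symm))]; ring
  have eLuv : ∀ i j, Complex.exp (Luv i j) = u i - v j := fun i j =>
    Complex.exp_log (sub_ne_zero.2 (huv i j))
  have hk : ∀ i j i', ∃ k : ℤ, i ≠ i' → (a i j).A (u i') = Luv i' j + pI - Lu i i' + 2 * pI * k := by
    intro i j i'
    by_cases h : i = i'
    · exact ⟨0, fun h' => absurd h h'⟩
    obtain ⟨j', hj⟩ := other j
    have := (hc i i' j j' h hj).ap.1
    rw [hp, hp, hq] at this
    have e : Complex.exp ((a i j).A (u i')) = Complex.exp (Luv i' j + pI - Lu i i') := by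
      rw [Complex.exp_sub, Complex.exp_add, epI, eLuv, eLu i i' h, eq_div_iff (sub_ne_zero.2 (huu i i' h)),
        this]; ring
    rw [Complex.exp_eq_exp_iff_exists_int] at e
    obtain ⟨k, hk⟩ := e
    exact ⟨k, fun _ => by rw [hk, hpI]; ring⟩
  have hm : ∀ i j j', ∃ k : ℤ, j ≠ j' → (a i j).A (v j') = Lv j j' - Luv i j' + 2 * pI * k := by
    intro i j j'
    by_cases h : j = j'
    · exact ⟨0, fun h' => absurd h h'⟩
    obtain ⟨i', hj⟩ := other i
    have := (hc i i' j j' hj h).aq.1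
    rw [hp, hq, hq] at this
    have e : Complex.exp ((a i j).A (v j')) = Complex.exp (Lv j j' - Luv i j') := by
      rw [Complex.exp_sub, eLuv, eLv j j' h, eq_div_iff (sub_ne_zero.2 (huv _ _)), this]
    rw [Complex.exp_eq_exp_iff_exists_int] at e
    obtain ⟨k, hk⟩ := e
    exact ⟨k, fun _ => by rw [hk, hpI]; ring⟩
  choose k hk using hk
  choose m hm using hm
  have main : ∀ i i' j j', i < i' → j ≠ j' →
      k i j i' + m i' j' j - m i j j' - k i' j' i = if j < j' then -1 else 0 := by
    intro i i' j j' hi hj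
    have w := (hc i i' j j' hi.ne hj).w
    unfold Arc.W at w
    rw [hp, hp, hq, hq, hk i j i' hi.ne, hk i' j' i hi.ne', hm i j j' hj, hm i' j' j hj.symm] at w
    have l1 : Lu i' i = Lu i i' + pI := by
      simp only [Lu]; rw [if_neg (by omega), if_pos hi]
    have key : (2 * pI) * ((k i j i' + m i' j' j - m i j j' - k i' j' i : ℤ) : ℂ)
        = (2 * pI) * ((if j < j' then -1 else 0 : ℤ) : ℂ) := by
      by_cases c : j < j'
      · have l2 : Lv j' j = Lv j j' + pI := by
          simp only [Lv]; rw [if_neg (by omega), if_pos c]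
        rw [l1, l2] at w
        rw [if_pos c]; push_cast; linear_combination w
      · have c' : j' < j := by omega
        have l2 : Lv j j' = Lv j' j + pI := by
          simp only [Lv]; rw [if_neg (by omega), if_pos c']
        rw [l1, l2] at w
        rw [if_neg c]; push_cast; linear_combination w
    have := mul_left_cancel₀ (mul_ne_zero two_ne_zero pI0) key
    exact_mod_cast this
  have f := fun i i' j j' (h : i < i' ∧ j ≠ j') => main i i' j j' h.1 h.2
  have e1 := f 0 1 0 1 (by decide)
  have e2 := f 0 1 0 2 (by decide)
  have e3 := f 0 1 1 0 (by decide)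
  have e4 := f 0 1 1 2 (by decide)
  have e5 := f 0 1 2 0 (by decide)
  have e6 := f 0 1 2 1 (by decide)
  have e7 := f 0 2 0 1 (by decide)
  have e8 := f 0 2 0 2 (by decide)
  have e9 := f 0 2 1 0 (by decide)
  have e10 := f 0 2 1 2 (by decide)
  have e11 := f 0 2 2 0 (by decide)
  have e12 := f 0 2 2 1 (by decide)
  have e13 := f 1 2 0 1 (by decide)
  have e14 := f 1 2 0 2 (by decide)
  have e15 := f 1 2 1 0 (by decide)
  have e16 := f 1 2 1 2 (by decide)
  have e17 := f 1 2 2 0 (by decide)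
  have e18 := f 1 2 2 1 (by decide)
  simp at e1 e2 e3 e4 e5 e6 e7 e8 e9 e10 e11 e12 e13 e14 e15 e16 e17 e18
  omega
end M2

section M4
open Finset
open scoped Classical
variable {V : Type*}

/-- number of ordered adjacent pairs -/
def e2 (adj : V → V → Prop) (S : Finset V) : ℕ := ((S ×ˢ S).filter fun p => adj p.1 p.2).card

def degIn (adj : V → V → Prop) (S : Finset V) (v : V) : ℕ := (S.filter fun w => adj v w).card

theorem e2_eq_sum (adj : V → V → Prop) (S : Finset V) : e2 adj S = ∑ v ∈ S, degIn adj S v := by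
  unfold e2 degIn
  rw [card_filter, sum_product]
  exact sum_congr rfl fun v _ => (card_filter _ _).symm

theorem e2_erase {adj : V → V → Prop} (hs : ∀ x y, adj x y → adj y x) (hi : ∀ x, ¬ adj x x)
    {S : Finset V} {v : V} (hv : v ∈ S) : e2 adj (S.erase v) + 2 * degIn adj S v = e2 adj S := by
  have h1 : ∀ w ∈ S.erase v, degIn adj S w = degIn adj (S.erase v) w + if adj v w then 1 else 0 := by
    intro w hw
    unfold degIn
    have : S = insert v (S.erase v) := (insert_erase hv).symm
    conv_lhs => rw [this, filter_insert]
    have e : adj w v ↔ adj v w := ⟨hs _ _, hs _ _⟩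
    by_cases h : adj v w
    · rw [if_pos (e.2 h), if_pos h, card_insert_of_notMem (by simp)]
    · rw [if_neg (fun h' => h (e.1 h')), if_neg h]; rfl
  have h2 : degIn adj S v = ∑ w ∈ S.erase v, if adj v w then 1 else 0 := by
    unfold degIn
    rw [← card_filter]
    congr 1
    ext w
    simp only [mem_filter, mem_erase]
    constructor
    · rintro ⟨a, b⟩; exact ⟨⟨fun h => hi v (h ▸ b), a⟩, b⟩
    · rintro ⟨⟨_, a⟩, b⟩; exact ⟨a, b⟩
  rw [e2_eq_sum, e2_eq_sum, ← add_sum_erase _ _ hv, sum_congr rfl h1, sum_add_distrib, ← h2]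
  ring

def ConnIn (adj : V → V → Prop) (U : Finset V) : Prop :=
  ∀ x ∈ U, ∀ y ∈ U, Relation.ReflTransGen (fun a b => adj a b ∧ a ∈ U ∧ b ∈ U) x y

theorem connIn_singleton (adj : V → V → Prop) (v : V) : ConnIn adj {v} := by
  intro x hx y hy
  rw [mem_singleton] at hx hy
  subst hx; subst hy; exact .refl

theorem connIn_insert {adj : V → V → Prop} (hs : ∀ x y, adj x y → adj y x) {U : Finset V}
    (hU : ConnIn adj U) {v u : V} (hu : u ∈ U) (huv : adj u v) : ConnIn adj (insert v U) := by
  have mono : ∀ x ∈ U, ∀ y ∈ U,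
      Relation.ReflTransGen (fun a b => adj a b ∧ a ∈ insert v U ∧ b ∈ insert v U) x y := by
    intro x hx y hy
    exact Relation.ReflTransGen.mono (fun a b ⟨h1, h2, h3⟩ =>
      ⟨h1, mem_insert_of_mem h2, mem_insert_of_mem h3⟩) _ _ (hU x hx y hy)
  intro x hx y hy
  rw [mem_insert] at hx hy
  rcases hx with rfl | hx <;> rcases hy with rfl | hy
  · exact .refl
  · exact (mono u hu y hy).head ⟨hs _ _ huv, mem_insert_self _ _, mem_insert_of_mem hu⟩
  · exact (mono x hx u hu).tail ⟨huv, mem_insert_of_mem hu, mem_insert_self _ _⟩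
  · exact mono x hx y hy

def HasMinor (adj : V → V → Prop) (k : ℕ) (S : Finset V) : Prop :=
  ∃ B : ℕ → Finset V, ∀ i < k, (B i).Nonempty ∧ B i ⊆ S ∧ ConnIn adj (B i) ∧
    ∀ j < i, Disjoint (B i) (B j) ∧ ∃ x ∈ B i, ∃ y ∈ B j, adj x y

theorem HasMinor.mono {adj : V → V → Prop} {k : ℕ} {S S' : Finset V} (h : HasMinor adj k S)
    (hS : S ⊆ S') : HasMinor adj k S' := by
  obtain ⟨B, hB⟩ := h
  exact ⟨B, fun i hi => ⟨(hB i hi).1, (hB i hi).2.1.trans hS, (hB i hi).2.2⟩⟩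

def minA : ℕ → ℕ
  | 0 => 0
  | k + 1 => 2 * minA k + 1

theorem exists_minor {adj : V → V → Prop} (hs : ∀ x y, adj x y → adj y x) (hi : ∀ x, ¬ adj x x)
    (k : ℕ) : ∀ S : Finset V, S.Nonempty → minA k * S.card ≤ e2 adj S → HasMinor adj (k + 1) S := by
  induction k with
  | zero =>
    intro S ⟨v, hv⟩ _
    refine ⟨fun _ => {v}, fun i hi => ⟨singleton_nonempty _, by simpa using hv, connIn_singleton _ _, ?_⟩⟩
    intro j hj; omega
  | succ k ih =>
    intro S
    induction S using Finset.strongInduction with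
    | H S ihS =>
    intro hne hS
    set A := minA (k+1) with hA
    have hA' : A = 2 * minA k + 1 := rfl
    let Nb : Finset V → Finset V := fun U => (S \ U).filter fun w => ∃ u ∈ U, adj u w
    let Good : Finset V → Prop := fun U => U.Nonempty ∧ ConnIn adj U ∧
      A * ((S \ U).card + 1) ≤ e2 adj (S \ U) + 2 * (Nb U).card
    have hex : (S.powerset.filter Good).Nonempty := by
      obtain ⟨v, hv⟩ := hne
      refine ⟨{v}, ?_⟩
      rw [mem_filter, mem_powerset]
      refine ⟨by simpa using hv, singleton_nonempty _, connIn_singleton _ _, ?_⟩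
      have e : Nb {v} = S.filter fun w => adj v w := by
        ext w
        simp only [Nb, mem_filter, mem_sdiff, mem_singleton, exists_eq_left]
        constructor
        · rintro ⟨⟨a, _⟩, b⟩; exact ⟨a, b⟩
        · rintro ⟨a, b⟩; exact ⟨⟨a, fun h => hi v (by rw [h] at b; exact b)⟩, b⟩
      rw [e, sdiff_singleton_eq_erase]
      have h1 := e2_erase hs hi hv
      unfold degIn at h1
      rw [h1, card_erase_add_one hv]
      exact hS
    obtain ⟨U, hU, hmax⟩ := exists_max_image _ Finset.card hex
    rw [mem_filter, mem_powerset] at hU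
    obtain ⟨hUS, hUne, hUc, hUg⟩ := hU
    set R := S \ U with hR
    by_cases hN : (Nb U) = ∅
    · rw [hN, card_empty] at hUg
      have hRne : R.Nonempty := by
        rw [nonempty_iff_ne_empty]
        intro h0
        rw [h0] at hUg
        simp [e2] at hUg
        omega
      have hsub : R ⊂ S := by
        refine ssubset_of_subset_of_ne sdiff_subset ?_
        intro h0
        obtain ⟨u, hu⟩ := hUne
        have : u ∈ R := by rw [h0]; exact hUS hu
        rw [hR, mem_sdiff] at this
        exact this.2 hu
      refine (ihS R hsub hRne ?_).mono hsub.1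
      nlinarith
    · have hdeg : ∀ v ∈ Nb U, minA k ≤ degIn adj (Nb U) v := by
        intro v hv
        have hv' := hv
        simp only [Nb, mem_filter] at hv'
        obtain ⟨hvR, u, hu, huv⟩ := hv'
        change v ∈ R at hvR
        have hvS : v ∈ S := (mem_sdiff.1 hvR).1
        have hvU : v ∉ U := (mem_sdiff.1 hvR).2
        have hng : ¬ Good (insert v U) := by
          intro hg
          have := hmax (insert v U) (by
            rw [mem_filter, mem_powerset]
            exact ⟨insert_subset hvS hUS, hg⟩)
          rw [card_insert_of_notMem hvU] at this
          omega
        have hR' : S \ insert v U = R.erase v := by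
          rw [hR]; ext w; simp only [mem_sdiff, mem_insert, mem_erase]; tauto
        have hng' : e2 adj (R.erase v) + 2 * (Nb (insert v U)).card < A * R.card := by
          by_contra hcon
          apply hng
          refine ⟨insert_nonempty _ _, connIn_insert hs hUc hu huv, ?_⟩
          rw [hR', card_erase_add_one hvR]
          omega
        have he := e2_erase hs hi hvR
        -- compare degrees
        have hcard : (Nb U).card + degIn adj R v ≤ (Nb (insert v U)).card + 1 + degIn adj (Nb U) v := by
          have s1 : (Nb U ∪ R.filter fun w => adj v w) ⊆ insert v (Nb (insert v U)) := by
            intro w hw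
            rw [mem_insert]
            by_cases hwv : w = v
            · exact Or.inl hwv
            right
            simp only [Nb, mem_filter, hR']
            rcases mem_union.1 hw with hw | hw
            · obtain ⟨h1, u', h2, h3⟩ := mem_filter.1 hw
              exact ⟨mem_erase.2 ⟨hwv, h1⟩, u', mem_insert_of_mem h2, h3⟩
            · exact ⟨mem_erase.2 ⟨hwv, (mem_filter.1 hw).1⟩, v, mem_insert_self _ _, (mem_filter.1 hw).2⟩
          have s2 : (Nb U ∩ R.filter fun w => adj v w) ⊆ (Nb U).filter fun w => adj v w := by
            intro w hw
            exact mem_filter.2 ⟨(mem_inter.1 hw).1, (mem_filter.1 (mem_inter.1 hw).2).2⟩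
          have c1 := (card_le_card s1).trans (card_insert_le _ _)
          have c2 := card_le_card s2
          have c3 := card_union_add_card_inter (Nb U) (R.filter fun w => adj v w)
          unfold degIn
          omega
        have : A * (R.card + 1) = A * R.card + A := by ring
        omega
      have hNe : minA k * (Nb U).card ≤ e2 adj (Nb U) := by
        rw [e2_eq_sum, mul_comm, ← smul_eq_mul]
        exact card_nsmul_le_sum _ _ _ hdeg
      obtain ⟨B, hB⟩ := ih (Nb U) (nonempty_iff_ne_empty.2 hN) hNe
      have hNR : Nb U ⊆ S \ U := filter_subset _ _
      refine ⟨fun i => if i = k + 1 then U else B i, fun i hi => ?_⟩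
      by_cases hik : i = k + 1
      · simp only [hik, if_true]
        refine ⟨hUne, hUS, hUc, fun j hj => ?_⟩
        rw [if_neg hj.ne]
        obtain ⟨b1, b2, b3, b4⟩ := hB j hj
        refine ⟨?_, ?_⟩
        · rw [Finset.disjoint_left]
          intro w hw hw'
          exact (mem_sdiff.1 (hNR (b2 hw'))).2 hw
        · obtain ⟨w, hw⟩ := b1
          have := b2 hw
          simp only [Nb, mem_filter] at this
          obtain ⟨_, u, hu, huw⟩ := this
          exact ⟨u, hu, w, hw, huw⟩
      · obtain ⟨b1, b2, b3, b4⟩ := hB i (by omega)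
        simp only [if_neg hik]
        refine ⟨b1, b2.trans (hNR.trans sdiff_subset), b3, fun j hj => ?_⟩
        rw [if_neg (by omega)]
        exact b4 j hj

inductive WalkArc (adj : V → V → Prop) (arc : V → V → Arc) (Y : Finset V) : V → V → Arc → Prop
  | single (x y : V) : adj x y → x ∈ Y → y ∈ Y → WalkArc adj arc Y x y (arc x y)
  | cons (x y z : V) (a : Arc) : adj x y → x ∈ Y → y ∈ Y → WalkArc adj arc Y y z a →
      WalkArc adj arc Y x z ((arc x y).cat a)

theorem WalkArc.ends {adj : V → V → Prop} {arc : V → V → Arc} {Y : Finset V} {pt : V → ℂ}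
    (hp : ∀ x y, adj x y → (arc x y).p = pt x) (hq : ∀ x y, adj x y → (arc x y).q = pt y)
    {x y : V} {a : Arc} (h : WalkArc adj arc Y x y a) : a.p = pt x ∧ a.q = pt y := by
  induction h with
  | single x y h _ _ => exact ⟨hp _ _ h, hq _ _ h⟩
  | cons x y z a h _ _ _ ih => exact ⟨hp _ _ h, ih.2⟩

theorem WalkArc.exists {adj : V → V → Prop} {arc : V → V → Arc} {Y : Finset V} {x y : V}
    (h : Relation.TransGen (fun a b => adj a b ∧ a ∈ Y ∧ b ∈ Y) x y) :
    ∃ a, WalkArc adj arc Y x y a := by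
  induction h using Relation.TransGen.head_induction_on with
  | single h => exact ⟨_, .single _ _ h.1 h.2.1 h.2.2⟩
  | head h _ ih =>
    obtain ⟨a, ha⟩ := ih
    exact ⟨_, .cons _ _ _ _ h.1 h.2.1 h.2.2 ha⟩

theorem drawn_bound {adj : V → V → Prop} (hs : ∀ x y, adj x y → adj y x) (hi : ∀ x, ¬ adj x x)
    (pt : V → ℂ) (arc : V → V → Arc)
    (hp : ∀ x y, adj x y → (arc x y).p = pt x) (hq : ∀ x y, adj x y → (arc x y).q = pt y)
    (hc : ∀ x y x' y', adj x y → adj x' y' → x ≠ x' → x ≠ y' → y ≠ x' → y ≠ y' →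
      (arc x y).Comp (arc x' y')) (S : Finset V) : e2 adj S ≤ 31 * S.card := by
  by_contra hcon
  have hne : S.Nonempty := by
    rw [nonempty_iff_ne_empty]; rintro rfl; simp [e2] at hcon
  obtain ⟨B, hB⟩ := exists_minor hs hi 5 S hne (by
    have : minA 5 = 31 := rfl
    rw [this]; omega)
  have hdis : ∀ i j, i < 6 → j < 6 → i ≠ j → Disjoint (B i) (B j) := by
    intro i j h1 h2 h3
    rcases lt_or_gt_of_ne h3 with h | h
    · exact ((hB j h2).2.2.2 i h).1.symm
    · exact ((hB i h1).2.2.2 j h).1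
  have hrep : ∀ i : ℕ, ∃ x : V, i < 6 → x ∈ B i := by
    intro i
    by_cases h : i < 6
    · obtain ⟨x, hx⟩ := (hB i h).1
      exact ⟨x, fun _ => hx⟩
    · obtain ⟨x, _⟩ := hne
      exact ⟨x, fun h' => absurd h' h⟩
  choose r hr using hrep
  have walk : ∀ i j : Fin 3, ∃ a, WalkArc adj arc (B i ∪ B (3 + j)) (r i) (r (3 + j)) a := by
    intro i j
    have hi6 : (i : ℕ) < 6 := by omega
    have hj6 : 3 + (j : ℕ) < 6 := by omega
    apply WalkArc.exists
    obtain ⟨x, hx, y, hy, hxy⟩ := ((hB _ hj6).2.2.2 i (by omega)).2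
    have w1 := Relation.ReflTransGen.mono
      (p := fun a b => adj a b ∧ a ∈ B i ∪ B (3 + j) ∧ b ∈ B i ∪ B (3 + j))
      (fun a b ⟨h1, h2, h3⟩ => ⟨h1, mem_union_left _ h2, mem_union_left _ h3⟩) _ _
      ((hB _ hi6).2.2.1 (r i) (hr _ hi6) y hy)
    have w2 := Relation.ReflTransGen.mono
      (p := fun a b => adj a b ∧ a ∈ B i ∪ B (3 + j) ∧ b ∈ B i ∪ B (3 + j))
      (fun a b ⟨h1, h2, h3⟩ => ⟨h1, mem_union_right _ h2, mem_union_right _ h3⟩) _ _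
      ((hB _ hj6).2.2.1 x hx (r (3 + j)) (hr _ hj6))
    exact (Relation.TransGen.tail' w1
      ⟨hs _ _ hxy, mem_union_left _ hy, mem_union_right _ hx⟩).trans_left w2
  choose a ha using walk
  have comp1 : ∀ (Y Y' : Finset V) x y x' y' a', Disjoint Y Y' → adj x y → x ∈ Y → y ∈ Y →
      WalkArc adj arc Y' x' y' a' → (arc x y).Comp a' := by
    intro Y Y' x y x' y' a' hd hxy hx hy h
    have nn : ∀ z ∈ Y, ∀ w ∈ Y', z ≠ w := fun z hz w hw e =>
      Finset.disjoint_left.1 hd hz (e ▸ hw)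
    induction h with
    | single x' y' h h1 h2 => exact hc _ _ _ _ hxy h (nn _ hx _ h1) (nn _ hx _ h2) (nn _ hy _ h1) (nn _ hy _ h2)
    | cons x' y' z a h h1 h2 hw ih =>
      exact Arc.Comp.catr (hc _ _ _ _ hxy h (nn _ hx _ h1) (nn _ hx _ h2) (nn _ hy _ h1) (nn _ hy _ h2)) ih
        (by rw [hq _ _ h, (hw.ends hp hq).1])
  have comp2 : ∀ (Y Y' : Finset V) x y x' y' a a', Disjoint Y Y' → WalkArc adj arc Y x y a →
      WalkArc adj arc Y' x' y' a' → a.Comp a' := by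
    intro Y Y' x y x' y' a a' hd h h'
    induction h with
    | single x y h h1 h2 => exact comp1 _ _ _ _ _ _ _ hd h h1 h2 h'
    | cons x y z a h h1 h2 hw ih =>
      exact Arc.Comp.cat (comp1 _ _ _ _ _ _ _ hd h h1 h2 h') ih
        (by rw [hq _ _ h, (hw.ends hp hq).1])
  refine vk_contra (fun i => pt (r i)) (fun j => pt (r (3 + j))) a
    (fun i j => ((ha i j).ends hp hq).1) (fun i j => ((ha i j).ends hp hq).2) ?_
  intro i i' j j' h1 h2
  have h1' : (i : ℕ) ≠ i' := fun h => h1 (Fin.ext h)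
  have h2' : (j : ℕ) ≠ j' := fun h => h2 (Fin.ext h)
  refine comp2 _ _ _ _ _ _ _ _ ?_ (ha i j) (ha i' j')
  rw [disjoint_union_left, disjoint_union_right, disjoint_union_right]
  refine ⟨⟨hdis _ _ ?_ ?_ ?_, hdis _ _ ?_ ?_ ?_⟩, hdis _ _ ?_ ?_ ?_, hdis _ _ ?_ ?_ ?_⟩ <;> omega
end M4

section M5
open Finset
open scoped Classical

theorem count_fix {ι : Type*} [Fintype ι] [DecidableEq ι] (m : ℕ) (A : Finset ι) (g : ι → Fin m) :
    (univ.filter fun f : ι → Fin m => ∀ i ∈ A, f i = g i).card * m ^ A.card = m ^ Fintype.card ι := by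
  have h1 : (univ.filter fun f : ι → Fin m => ∀ i ∈ A, f i = g i) =
      Fintype.piFinset (fun i => if i ∈ A then ({g i} : Finset (Fin m)) else univ) := by
    ext f
    simp only [mem_filter, mem_univ, true_and, Fintype.mem_piFinset]
    constructor
    · intro h i
      by_cases hi : i ∈ A
      · rw [if_pos hi, mem_singleton]; exact h i hi
      · rw [if_neg hi]; exact mem_univ _
    · intro h i hi
      have := h i
      rwa [if_pos hi, mem_singleton] at this
  rw [h1, Fintype.card_piFinset]
  have h2 : m ^ A.card = ∏ i : ι, if i ∈ A then m else 1 := by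
    rw [Finset.prod_ite_mem]; simp
  rw [h2, ← prod_mul_distrib]
  rw [show m ^ Fintype.card ι = ∏ i : ι, m by simp]
  refine prod_congr rfl fun i _ => ?_
  split_ifs <;> simp

variable {V : Type*} [Fintype V]

def nbr (H : V → V → Prop) (v : V) : Finset V := univ.filter fun w => H v w

def codeg (H : V → V → Prop) (u w : V) : ℕ := (univ.filter fun c => H u c ∧ H c w).card

def isWalk (H : V → V → Prop) (t : V × V × V) : Prop := H t.1 t.2.1 ∧ H t.2.1 t.2.2

def wpos : Fin 3 → V × V × V → V
  | 0 => fun t => t.1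
  | 1 => fun t => t.2.1
  | 2 => fun t => t.2.2

theorem walk_pos_le {H : V → V → Prop} (hs : ∀ x y, H x y → H y x) {L : ℕ}
    (hL : ∀ v, (nbr H v).card ≤ L) (i : Fin 3) (a : V) :
    (univ.filter fun t : V × V × V => isWalk H t ∧ wpos i t = a).card ≤ L * L := by
  fin_cases i
  · have : (univ.filter fun t : V × V × V => isWalk H t ∧ wpos 0 t = a) ⊆
        (nbr H a).biUnion fun c => (nbr H c).image fun w => (a, c, w) := by
      rintro ⟨x, y, z⟩ h
      replace h := (mem_filter.1 h).2
      simp only [isWalk, wpos] at h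
      simp only [mem_biUnion, mem_image, nbr, mem_filter, mem_univ, true_and]
      obtain ⟨⟨h1, h2⟩, rfl⟩ := h
      exact ⟨y, h1, z, h2, rfl⟩
    refine (card_le_card this).trans ?_
    refine (card_biUnion_le_card_mul _ _ L fun c _ => card_image_le.trans (hL c)).trans ?_
    exact Nat.mul_le_mul_right _ (hL a)
  · have : (univ.filter fun t : V × V × V => isWalk H t ∧ wpos 1 t = a) ⊆
        (nbr H a).biUnion fun c => (nbr H a).image fun w => (c, a, w) := by
      rintro ⟨x, y, z⟩ h
      replace h := (mem_filter.1 h).2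
      simp only [isWalk, wpos] at h
      simp only [mem_biUnion, mem_image, nbr, mem_filter, mem_univ, true_and]
      obtain ⟨⟨h1, h2⟩, rfl⟩ := h
      exact ⟨x, hs _ _ h1, z, h2, rfl⟩
    refine (card_le_card this).trans ?_
    refine (card_biUnion_le_card_mul _ _ L fun c _ => card_image_le.trans (hL a)).trans ?_
    exact Nat.mul_le_mul_right _ (hL a)
  · have : (univ.filter fun t : V × V × V => isWalk H t ∧ wpos 2 t = a) ⊆
        (nbr H a).biUnion fun c => (nbr H c).image fun w => (w, c, a) := by
      rintro ⟨x, y, z⟩ h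
      replace h := (mem_filter.1 h).2
      simp only [isWalk, wpos] at h
      simp only [mem_biUnion, mem_image, nbr, mem_filter, mem_univ, true_and]
      obtain ⟨⟨h1, h2⟩, rfl⟩ := h
      exact ⟨y, hs _ _ h2, x, hs _ _ h1, rfl⟩
    refine (card_le_card this).trans ?_
    refine (card_biUnion_le_card_mul _ _ L fun c _ => card_image_le.trans (hL c)).trans ?_
    exact Nat.mul_le_mul_right _ (hL a)

def wConf (cl : V → V → Prop) (t t' : V × V × V) : Prop := ∃ i j : Fin 3, cl (wpos i t) (wpos j t')

theorem conf_le {H cl : V → V → Prop} (hs : ∀ x y, H x y → H y x) {L Y : ℕ}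
    (hL : ∀ v, (nbr H v).card ≤ L) (hY : (univ.filter fun p : V × V => cl p.1 p.2).card ≤ Y) :
    (univ.filter fun p : (V × V × V) × (V × V × V) =>
      isWalk H p.1 ∧ isWalk H p.2 ∧ wConf cl p.1 p.2).card ≤ 9 * (Y * ((L * L) * (L * L))) := by
  have sub : (univ.filter fun p : (V × V × V) × (V × V × V) =>
      isWalk H p.1 ∧ isWalk H p.2 ∧ wConf cl p.1 p.2) ⊆
      (univ : Finset (Fin 3 × Fin 3)).biUnion fun ij =>
        (univ.filter fun p : V × V => cl p.1 p.2).biUnion fun ab =>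
          (univ.filter fun t : V × V × V => isWalk H t ∧ wpos ij.1 t = ab.1) ×ˢ
          (univ.filter fun t : V × V × V => isWalk H t ∧ wpos ij.2 t = ab.2) := by
    rintro ⟨t, t'⟩ h
    simp only [mem_filter, mem_univ, true_and] at h
    obtain ⟨h1, h2, i, j, h3⟩ := h
    rw [mem_biUnion]
    refine ⟨(i, j), mem_univ _, ?_⟩
    rw [mem_biUnion]
    refine ⟨(wpos i t, wpos j t'), ?_, ?_⟩
    · simpa using h3
    · simp [h1, h2]
  refine (card_le_card sub).trans ?_
  refine (card_biUnion_le_card_mul _ _ (Y * ((L * L) * (L * L))) fun ij _ => ?_).trans ?_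
  · refine (card_biUnion_le_card_mul _ _ ((L * L) * (L * L)) fun ab _ => ?_).trans ?_
    · rw [card_product]
      exact Nat.mul_le_mul (walk_pos_le hs hL _ _) (walk_pos_le hs hL _ _)
    · exact Nat.mul_le_mul_right _ hY
  · simp

/-- light walks -/
def isLight (H : V → V → Prop) (lam : ℕ) (t : V × V × V) : Prop :=
  isWalk H t ∧ t.1 ≠ t.2.2 ∧ codeg H t.1 t.2.2 ≤ lam

theorem codeg_comm {H : V → V → Prop} (hs : ∀ x y, H x y → H y x) (u w : V) :
    codeg H u w = codeg H w u := by
  unfold codeg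
  congr 1
  ext c
  simp only [mem_filter, mem_univ, true_and]
  exact ⟨fun h => ⟨hs _ _ h.2, hs _ _ h.1⟩, fun h => ⟨hs _ _ h.2, hs _ _ h.1⟩⟩

abbrev ChF (V : Type*) (m lam : ℕ) := (V → Fin m) × (Sym2 V → Fin lam)

set_option maxHeartbeats 1000000 in
theorem light_bound {H cl : V → V → Prop} (hs : ∀ x y, H x y → H y x)
    {L Y : ℕ}
    (hL : ∀ v, (nbr H v).card ≤ L) (hY : (univ.filter fun p : V × V => cl p.1 p.2).card ≤ Y)
    (pt : V → ℂ) (arc : V × V × V → Arc)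
    (hp : ∀ t, isWalk H t → (arc t).p = pt t.1) (hq : ∀ t, isWalk H t → (arc t).q = pt t.2.2)
    (hc : ∀ t t', isWalk H t → isWalk H t' → ¬ wConf cl t t' → (arc t).Comp (arc t'))
    (m lam : ℕ) (hm : 0 < m) (hlam : 0 < lam) :
    (univ.filter fun t => isLight H lam t).card * (m ^ 2 * lam) ≤
      31 * (Fintype.card V * (m ^ 3 * lam ^ 2)) + 9 * (Y * ((L * L) * (L * L))) := by
  -- rank function
  have hrk : ∀ e : Sym2 V, ∃ r : V → Fin lam, ∀ u w, s(u, w) = e → codeg H u w ≤ lam →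
      ∀ c c', H u c → H c w → H u c' → H c' w → r c = r c' → c = c' := by
    intro e
    induction e using Sym2.ind with
    | _ u w =>
    by_cases hle : codeg H u w ≤ lam
    · let CN := univ.filter fun c => H u c ∧ H c w
      have hcard : Fintype.card CN ≤ lam := by
        rw [Fintype.card_coe]; exact hle
      have : Nonempty (CN ↪ Fin lam) := by
        apply Function.Embedding.nonempty_of_card_le
        simpa using hcard
      obtain ⟨φ⟩ := this
      refine ⟨fun c => if h : c ∈ CN then φ ⟨c, h⟩ else ⟨0, hlam⟩, ?_⟩
      have aux : ∀ c c', H u c → H c w → H u c' → H c' w →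
          (if h : c ∈ CN then φ ⟨c, h⟩ else ⟨0, hlam⟩) = (if h : c' ∈ CN then φ ⟨c', h⟩ else ⟨0, hlam⟩)
          → c = c' := by
        intro c c' h1 h2 h3 h4 he
        have m1 : c ∈ CN := by simp [CN, h1, h2]
        have m2 : c' ∈ CN := by simp [CN, h3, h4]
        rw [dif_pos m1, dif_pos m2] at he
        have := φ.injective he
        simpa using this
      intro u' w' he _ c c' h1 h2 h3 h4 hr
      rw [Sym2.eq_iff] at he
      rcases he with ⟨rfl, rfl⟩ | ⟨rfl, rfl⟩
      · exact aux c c' h1 h2 h3 h4 hr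
      · exact aux c c' (hs _ _ h2) (hs _ _ h1) (hs _ _ h4) (hs _ _ h3) hr
    · refine ⟨fun _ => ⟨0, hlam⟩, ?_⟩
      intro u' w' he hle'
      exfalso
      rw [Sym2.eq_iff] at he
      rcases he with ⟨rfl, rfl⟩ | ⟨rfl, rfl⟩
      · exact hle hle'
      · exact hle (codeg_comm hs _ _ ▸ hle')
  choose rk hrk using hrk
  let z : Fin m := ⟨0, hm⟩
  let sel : ChF V m lam → V × V × V → Prop := fun f t => isLight H lam t ∧ f.1 t.1 = z ∧ f.1 t.2.2 = z ∧
    f.2 s(t.1, t.2.2) = rk s(t.1, t.2.2) t.2.1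
  let sep : V × V × V → V × V × V → Prop := fun t t' =>
    t.1 ≠ t'.1 ∧ t.1 ≠ t'.2.2 ∧ t.2.2 ≠ t'.1 ∧ t.2.2 ≠ t'.2.2
  let cfp : (V × V × V) × (V × V × V) → Prop := fun p =>
    isLight H lam p.1 ∧ isLight H lam p.2 ∧ sep p.1 p.2 ∧ wConf cl p.1 p.2
  let spoil : ChF V m lam → V × V × V → Prop := fun f t => ∃ t', sel f t' ∧ sep t t' ∧ wConf cl t t'
  let rv : V × V × V → V × V × V := fun t => (t.2.2, t.2.1, t.1)
  have rv_light : ∀ t, isLight H lam t → isLight H lam (rv t) := by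
    rintro ⟨u, c, w⟩ ⟨⟨h1, h2⟩, h3, h4⟩
    exact ⟨⟨hs _ _ h2, hs _ _ h1⟩, fun h => h3 h.symm, by rw [codeg_comm hs]; exact h4⟩
  have rv_sel : ∀ f t, sel f t → sel f (rv t) := by
    rintro f ⟨u, c, w⟩ ⟨h1, h2, h3, h4⟩
    refine ⟨rv_light _ h1, h3, h2, ?_⟩
    simp only [rv] at *
    rw [Sym2.eq_swap]; exact h4
  have rv_conf : ∀ t t', wConf cl t t' → wConf cl (rv t) t' := by
    rintro ⟨u, c, w⟩ t' ⟨i, j, h⟩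
    fin_cases i
    · exact ⟨2, j, h⟩
    · exact ⟨1, j, h⟩
    · exact ⟨0, j, h⟩
  have rv_sep : ∀ t t', sep t t' → sep (rv t) t' := by
    rintro ⟨u, c, w⟩ ⟨u', c', w'⟩ ⟨h1, h2, h3, h4⟩
    exact ⟨h3, h4, h1, h2⟩
  have uniq : ∀ f u c c' w, sel f (u, c, w) → sel f (u, c', w) → c = c' := by
    rintro f u c c' w ⟨h1, h2, h3, h4⟩ ⟨h1', h2', h3', h4'⟩
    exact hrk _ u w rfl h1.2.2 c c' h1.1.1 h1.1.2 h1'.1.1 h1'.1.2 (by rw [← h4, ← h4'])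
  -- per choice bound
  have per : ∀ f : ChF V m lam, (univ.filter fun t => sel f t).card ≤
      31 * (univ.filter fun v => f.1 v = z).card +
      (univ.filter fun p : (V × V × V) × (V × V × V) => cfp p ∧ sel f p.1 ∧ sel f p.2).card := by
    intro f
    let adj : V → V → Prop := fun x y => ∃ c, sel f (x, c, y) ∧ ¬ spoil f (x, c, y)
    have hadj : ∀ x y, adj x y → adj y x := by
      rintro x y ⟨c, h1, h2⟩
      refine ⟨c, rv_sel f _ h1, fun ⟨t', a1, a2, a3⟩ => h2 ⟨t', a1, ?_, ?_⟩⟩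
      · exact rv_sep _ _ a2
      · exact rv_conf _ _ a3
    have hirr : ∀ x, ¬ adj x x := by
      rintro x ⟨c, h1, h2⟩
      exact h1.1.2.1 rfl
    let cen : V → V → V := fun x y => if h : adj x y then h.choose else x
    have hcen : ∀ x y, adj x y → sel f (x, cen x y, y) ∧ ¬ spoil f (x, cen x y, y) := by
      intro x y h
      simp only [cen, dif_pos h]
      exact h.choose_spec
    have hb := drawn_bound hadj hirr pt (fun x y => arc (x, cen x y, y))
      (fun x y h => hp _ (hcen x y h).1.1.1) (fun x y h => hq _ (hcen x y h).1.1.1)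
      (fun x y x' y' h h' n1 n2 n3 n4 => by
        refine hc _ _ (hcen x y h).1.1.1 (hcen x' y' h').1.1.1 fun hcf => ?_
        exact (hcen x y h).2 ⟨_, (hcen x' y' h').1, ⟨n1, n2, n3, n4⟩, hcf⟩)
      (univ.filter fun v => f.1 v = z)
    have split : (univ.filter fun t => sel f t) ⊆
        (univ.filter fun t => sel f t ∧ ¬ spoil f t) ∪ (univ.filter fun t => sel f t ∧ spoil f t) := by
      intro t ht
      simp only [mem_filter, mem_univ, true_and, mem_union] at *
      by_cases h : spoil f t
      · exact Or.inr ⟨ht, h⟩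
      · exact Or.inl ⟨ht, h⟩
    refine (card_le_card split).trans ((card_union_le _ _).trans (add_le_add (le_trans ?_ hb) ?_))
    · unfold e2
      refine card_le_card_of_injOn (fun t => (t.1, t.2.2)) ?_ ?_
      · rintro ⟨u, c, w⟩ ht
        simp only [coe_filter, mem_univ, true_and, Set.mem_ofPred_eq, mem_product, mem_filter] at *
        exact ⟨⟨ht.1.2.1, ht.1.2.2.1⟩, c, ht.1, ht.2⟩
      · rintro ⟨u, c, w⟩ ht ⟨u', c', w'⟩ ht' he
        simp only [coe_filter, mem_univ, true_and, Set.mem_ofPred_eq, Prod.mk.injEq] at *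
        obtain ⟨rfl, rfl⟩ := he
        exact ⟨rfl, uniq f _ _ _ _ ht.1 ht'.1, rfl⟩
    · have : (univ.filter fun t => sel f t ∧ spoil f t) ⊆
          (univ.filter fun p : (V × V × V) × (V × V × V) => cfp p ∧ sel f p.1 ∧ sel f p.2).image
            Prod.fst := by
        intro t ht
        simp only [mem_filter, mem_univ, true_and] at ht
        obtain ⟨h1, t', h2, h3, h4⟩ := ht
        rw [mem_image]
        refine ⟨(t, t'), ?_, rfl⟩
        simp only [mem_filter, mem_univ, true_and]
        exact ⟨⟨h1.1, h2.1, h3, h4⟩, h1, h2⟩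
      exact (card_le_card this).trans card_image_le
  -- counting of choices
  set M := m ^ Fintype.card V with hM
  set Λ := lam ^ Fintype.card (Sym2 V) with hΛ
  have cnt : ∀ (A : Finset V) (B : Finset (Sym2 V)) (g : Sym2 V → Fin lam),
      (univ.filter fun f : ChF V m lam => (∀ i ∈ A, f.1 i = z) ∧ ∀ e ∈ B, f.2 e = g e).card *
        (m ^ A.card * lam ^ B.card) = M * Λ := by
    intro A B g
    have e1 := count_fix m A (fun _ => z)
    have e2 := count_fix lam B g
    have : (univ.filter fun f : ChF V m lam => (∀ i ∈ A, f.1 i = z) ∧ ∀ e ∈ B, f.2 e = g e) =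
        (univ.filter fun f : V → Fin m => ∀ i ∈ A, f i = z) ×ˢ
        (univ.filter fun f : Sym2 V → Fin lam => ∀ i ∈ B, f i = g i) := by
      ext f; simp
    rw [this, card_product, hM, hΛ, ← e1, ← e2]
    ring
  have s1 : ∀ t, isLight H lam t → (univ.filter fun f : ChF V m lam => sel f t).card * (m ^ 2 * lam) = M * Λ := by
    rintro ⟨u, c, w⟩ ht
    have := cnt {u, w} {s(u, w)} (fun e => rk e c)
    rw [card_pair ht.2.1, card_singleton, pow_one] at this
    rw [← this]
    congr 2
    ext f
    simp only [mem_filter, mem_univ, true_and, sel, mem_insert, mem_singleton, forall_eq_or_imp, forall_eq]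
    tauto
  have s2 : ∀ v : V, (univ.filter fun f : ChF V m lam => f.1 v = z).card * m = M * Λ := by
    intro v
    by_cases hl : (lam : ℕ) = 0
    · omega
    have := cnt {v} ∅ (fun e => ⟨0, hlam⟩)
    simpa using this
  have s3 : ∀ p : (V × V × V) × (V × V × V), cfp p →
      (univ.filter fun f : ChF V m lam => sel f p.1 ∧ sel f p.2).card * (m ^ 4 * lam ^ 2) = M * Λ := by
    rintro ⟨⟨u, c, w⟩, u', c', w'⟩ ⟨h1, h2, ⟨n1, n2, n3, n4⟩, h4⟩
    have hd1 := h1.2.1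
    have hd2 := h2.2.1
    simp only at n1 n2 n3 n4 hd1 hd2
    have hne : s(u, w) ≠ s(u', w') := by
      intro h; rw [Sym2.eq_iff] at h
      rcases h with h | h
      · exact n1 h.1
      · exact n2 h.1
    have := cnt {u, w, u', w'} {s(u, w), s(u', w')} (fun e => if e = s(u, w) then rk e c else rk e c')
    have c4 : ({u, w, u', w'} : Finset V).card = 4 := by
      rw [card_insert_of_notMem (by simp [hd1, n1, n2]), card_insert_of_notMem (by simp [n3, n4]),
        card_pair hd2]
    rw [c4, card_pair hne] at this
    rw [← this]
    congr 2
    ext f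
    simp only [mem_filter, mem_univ, true_and, sel, mem_insert, mem_singleton, forall_eq_or_imp, forall_eq,
      if_true, if_neg hne.symm]
    tauto
  -- double counting
  have d1 : ∑ f : ChF V m lam, (univ.filter fun t => sel f t).card * (m ^ 2 * lam) =
      (univ.filter fun t => isLight H lam t).card * (M * Λ) := by
    rw [← sum_mul]
    have : ∑ f : ChF V m lam, (univ.filter fun t => sel f t).card =
        ∑ t ∈ univ.filter (fun t => isLight H lam t), (univ.filter fun f : ChF V m lam => sel f t).card := by
      simp only [card_filter]
      rw [sum_comm, sum_filter]
      refine sum_congr rfl fun t _ => ?_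
      split_ifs with h
      · rfl
      · refine sum_eq_zero fun f _ => ?_
        rw [if_neg]; exact fun h' => h h'.1
    rw [this, sum_mul, sum_congr rfl (fun t ht => s1 t (mem_filter.1 ht).2), sum_const, smul_eq_mul]
  have d2 : ∑ f : ChF V m lam, (univ.filter fun v => f.1 v = z).card * m = Fintype.card V * (M * Λ) := by
    rw [← sum_mul]
    have : ∑ f : ChF V m lam, (univ.filter fun v => f.1 v = z).card =
        ∑ v : V, (univ.filter fun f : ChF V m lam => f.1 v = z).card := by
      simp only [card_filter]
      rw [sum_comm]
    rw [this, sum_mul, sum_congr rfl (fun t _ => s2 t), sum_const, smul_eq_mul, card_univ]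
  have d3 : ∑ f : ChF V m lam, (univ.filter fun p : (V × V × V) × (V × V × V) =>
      cfp p ∧ sel f p.1 ∧ sel f p.2).card * (m ^ 4 * lam ^ 2) =
      (univ.filter fun p => cfp p).card * (M * Λ) := by
    rw [← sum_mul]
    have : ∑ f : ChF V m lam, (univ.filter fun p : (V × V × V) × (V × V × V) => cfp p ∧ sel f p.1 ∧ sel f p.2).card =
        ∑ p ∈ univ.filter (fun p => cfp p), (univ.filter fun f : ChF V m lam => sel f p.1 ∧ sel f p.2).card := by
      simp only [card_filter]
      rw [sum_comm, sum_filter]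
      refine sum_congr rfl fun t _ => ?_
      split_ifs with h
      · simp [h]
      · refine sum_eq_zero fun f _ => ?_
        rw [if_neg]; exact fun h' => h h'.1
    rw [this, sum_mul, sum_congr rfl (fun t ht => s3 t (mem_filter.1 ht).2), sum_const, smul_eq_mul]
  have hcfp : (univ.filter fun p => cfp p).card ≤ 9 * (Y * ((L * L) * (L * L))) := by
    refine le_trans (card_le_card ?_) (conf_le hs hL hY)
    intro p hp
    simp only [mem_filter, mem_univ, true_and] at *
    exact ⟨hp.1.1, hp.2.1.1, hp.2.2.2⟩
  have hpos : 0 < M * Λ := Nat.mul_pos (pow_pos hm _) (pow_pos hlam _)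
  have tot := sum_le_sum fun (f : ChF V m lam) (_ : f ∈ (univ : Finset (ChF V m lam))) => per f
  rw [sum_add_distrib, ← mul_sum] at tot
  have t4 := Nat.mul_le_mul_right (m ^ 4 * lam ^ 2) tot
  rw [← sum_mul] at d1 d2 d3
  have t5 : (univ.filter fun t => isLight H lam t).card * (m ^ 2 * lam) * (M * Λ) ≤
      (31 * (Fintype.card V * (m ^ 3 * lam ^ 2)) + (univ.filter fun p => cfp p).card) * (M * Λ) := by
    calc (univ.filter fun t => isLight H lam t).card * (m ^ 2 * lam) * (M * Λ)
        = (univ.filter fun t => isLight H lam t).card * (M * Λ) * (m ^ 2 * lam) := by ring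
      _ = (∑ f : ChF V m lam, (univ.filter fun t => sel f t).card) * (m ^ 4 * lam ^ 2) := by rw [← d1]; ring
      _ ≤ _ := t4
      _ = 31 * (((∑ f : ChF V m lam, (univ.filter fun v => f.1 v = z).card) * m) * (m ^ 3 * lam ^ 2)) +
          (∑ f : ChF V m lam, (univ.filter fun p : (V × V × V) × (V × V × V) =>
            cfp p ∧ sel f p.1 ∧ sel f p.2).card) * (m ^ 4 * lam ^ 2) := by ring
      _ = _ := by rw [d2, d3]; ring
  have t6 := Nat.le_of_mul_le_mul_right t5 hpos
  exact t6.trans (Nat.add_le_add_left hcfp _)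
end M5

section M6
open Finset
open scoped Classical
variable {V : Type*} [Fintype V]

/-- closed 4-walks -/
def quadF (H : V → V → Prop) : Finset (V × V × V × V) :=
  univ.filter fun q => H q.1 q.2.1 ∧ H q.1 q.2.2.1 ∧ H q.2.1 q.2.2.2 ∧ H q.2.2.1 q.2.2.2

def eBip (H : V → V → Prop) (U W : Finset V) : ℕ := ((U ×ˢ W).filter fun p => H p.1 p.2).card

theorem walk_card (H : V → V → Prop) (hs : ∀ x y, H x y → H y x) :
    (univ.filter fun t : V × V × V => isWalk H t).card = ∑ c, (nbr H c).card ^ 2 := by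
  have h := card_eq_sum_card_fiberwise (s := univ.filter fun t : V × V × V => isWalk H t)
    (t := (univ : Finset V)) (f := fun t => t.2.1) (fun _ _ => by simp)
  rw [h]
  refine sum_congr rfl fun c _ => ?_
  rw [pow_two, ← card_product]
  refine card_nbij' (fun t => (t.1, t.2.2)) (fun p => (p.1, c, p.2)) ?_ ?_ ?_ ?_
  · rintro ⟨u, c', w⟩ ht
    simp only [coe_filter, mem_filter, mem_univ, true_and, Set.mem_ofPred_eq] at ht
    obtain ⟨⟨h1, h2⟩, rfl⟩ := ht
    simp only [coe_product, Set.mem_prod, mem_coe, nbr, mem_filter, mem_univ, true_and]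
    exact ⟨hs _ _ h1, h2⟩
  · rintro ⟨u, w⟩ ht
    simp only [coe_product, Set.mem_prod, mem_coe, nbr, mem_filter, mem_univ, true_and] at ht
    simp only [coe_filter, mem_filter, mem_univ, true_and, Set.mem_ofPred_eq, and_true]
    exact ⟨hs _ _ ht.1, ht.2⟩
  · rintro ⟨u, c', w⟩ ht
    simp only [coe_filter, mem_filter, mem_univ, true_and, Set.mem_ofPred_eq] at ht
    simp [ht.2]
  · rintro ⟨u, w⟩ _; rfl

theorem sum_codeg_le (H : V → V → Prop) (hs : ∀ x y, H x y → H y x) (S : Finset (V × V × V))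
    (hS : ∀ t ∈ S, isWalk H t) : ∑ t ∈ S, codeg H t.1 t.2.2 ≤ (quadF H).card := by
  have : ∑ t ∈ S, codeg H t.1 t.2.2 = (S.sigma fun t => univ.filter fun c => H t.1 c ∧ H c t.2.2).card := by
    rw [card_sigma]; rfl
  rw [this]
  refine card_le_card_of_injOn (fun x => (x.1.2.1, x.1.1, x.1.2.2, x.2)) ?_ ?_
  · rintro ⟨⟨u, c, w⟩, c'⟩ h
    simp only [coe_sigma, Set.mem_sigma_iff, mem_coe, mem_filter, mem_univ, true_and] at h
    obtain ⟨h1, h2, h3⟩ := h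
    have := hS _ h1
    simp only [quadF, coe_filter, mem_univ, true_and, Set.mem_ofPred_eq]
    exact ⟨hs _ _ this.1, this.2, h2, hs _ _ h3⟩
  · rintro ⟨⟨u, c, w⟩, c'⟩ _ ⟨⟨u', d, w'⟩, d'⟩ _ h
    simp only [Prod.mk.injEq] at h
    obtain ⟨rfl, rfl, rfl, rfl⟩ := h
    rfl

theorem c4_bound {H cl : V → V → Prop} (hs : ∀ x y, H x y → H y x)
    {L Y T K lam B A : ℕ}
    (hL : ∀ v, (nbr H v).card ≤ L) (hY : (univ.filter fun p : V × V => cl p.1 p.2).card ≤ Y)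
    (pt : V → ℂ) (arc : V × V × V → Arc)
    (hp : ∀ t, isWalk H t → (arc t).p = pt t.1) (hq : ∀ t, isWalk H t → (arc t).q = pt t.2.2)
    (hc : ∀ t t', isWalk H t → isWalk H t' → ¬ wConf cl t t' → (arc t).Comp (arc t'))
    (hE : ∑ v, (nbr H v).card = 2 * T) (hT : 0 < T) (hK : 0 < K) (hlam : 0 < lam)
    (hB : B = 150660 * K ^ 4) (hA : A = 558 * K ^ 2 * B) (hLA : L = A * lam) (hLK : 6 * K ≤ L)
    (hV : Fintype.card V * L ≤ 3 * K * T) (hYK : Y ≤ 5 * K * T) :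
    2 * T * L ^ 2 ≤ (quadF H).card * (3 * A * K) := by
  have hBpos : 0 < B := by rw [hB]; positivity
  have hLpos : 0 < L := by omega
  set m := B * L with hm
  have hmpos : 0 < m := Nat.mul_pos hBpos hLpos
  have hl := light_bound hs hL hY pt arc hp hq hc m lam hmpos hlam
  set light := (univ.filter fun t => isLight H lam t).card with hlight
  set n := Fintype.card V with hn
  have hlK : 3 * K * light ≤ T * L := by
    have hpos : 0 < m ^ 2 * lam := Nat.mul_pos (pow_pos hmpos _) hlam
    have t1 : 31 * (n * (m ^ 3 * lam ^ 2)) ≤ 93 * K * T * B * lam * (m ^ 2 * lam) := by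
      calc 31 * (n * (m ^ 3 * lam ^ 2)) = 31 * (n * L) * B * lam * (m ^ 2 * lam) := by rw [hm]; ring
        _ ≤ 31 * (3 * K * T) * B * lam * (m ^ 2 * lam) := by gcongr
        _ = _ := by ring
    have t2 : 6 * K * (9 * (Y * ((L * L) * (L * L)))) ≤ T * L * (m ^ 2 * lam) := by
      calc 6 * K * (9 * (Y * ((L * L) * (L * L)))) ≤ 6 * K * (9 * ((5 * K * T) * ((L * L) * (L * L)))) := by gcongr
        _ = T * L * L ^ 2 * (270 * K ^ 2 * L) := by ring
        _ = T * L * L ^ 2 * (B ^ 2 * lam) := by rw [hLA, hA, hB]; ring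
        _ = _ := by rw [hm]; ring
    have t3 : 6 * K * light * (m ^ 2 * lam) ≤ 2 * (T * L) * (m ^ 2 * lam) := by
      calc 6 * K * light * (m ^ 2 * lam) = 6 * K * (light * (m ^ 2 * lam)) := by ring
        _ ≤ 6 * K * (31 * (n * (m ^ 3 * lam ^ 2)) + 9 * (Y * ((L * L) * (L * L)))) := by gcongr
        _ = 6 * K * (31 * (n * (m ^ 3 * lam ^ 2))) + 6 * K * (9 * (Y * ((L * L) * (L * L)))) := by ring
        _ ≤ 6 * K * (93 * K * T * B * lam * (m ^ 2 * lam)) + T * L * (m ^ 2 * lam) := by gcongr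
        _ = (T * (558 * K ^ 2 * B * lam) + T * L) * (m ^ 2 * lam) := by ring
        _ = _ := by rw [← hA, ← hLA]; ring
    have := Nat.le_of_mul_le_mul_right t3 hpos
    nlinarith
  have hP : 4 * T * L ≤ 3 * K * ∑ c, (nbr H c).card ^ 2 := by
    have h := sq_sum_le_card_mul_sum_sq (s := (univ : Finset V)) (f := fun v => (nbr H v).card)
    rw [hE, card_univ, ← hn] at h
    rw [Nat.cast_id] at h
    have h2 : T * (4 * T * L) ≤ T * (3 * K * ∑ c, (nbr H c).card ^ 2) := by
      calc T * (4 * T * L) = (2 * T) ^ 2 * L := by ring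
        _ ≤ (n * ∑ c, (nbr H c).card ^ 2) * L := by gcongr
        _ = (n * L) * ∑ c, (nbr H c).card ^ 2 := by ring
        _ ≤ (3 * K * T) * ∑ c, (nbr H c).card ^ 2 := by gcongr
        _ = _ := by ring
    exact Nat.le_of_mul_le_mul_left h2 hT
  rw [← walk_card H hs] at hP
  set heavy := univ.filter fun t : V × V × V => isWalk H t ∧ lam < codeg H t.1 t.2.2 with hheavy
  have hdiag : (univ.filter fun t : V × V × V => isWalk H t ∧ t.1 = t.2.2).card ≤ 2 * T := by
    rw [← hE]
    have : ∑ v, (nbr H v).card = ((univ : Finset V).sigma fun v => nbr H v).card := by rw [card_sigma]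
    rw [this]
    refine card_le_card_of_injOn (fun t => ⟨t.1, t.2.1⟩) ?_ ?_
    · rintro ⟨u, c, w⟩ h
      simp only [coe_filter, mem_univ, true_and, Set.mem_ofPred_eq] at h
      simp only [coe_sigma, Set.mem_sigma_iff, mem_coe, mem_univ, true_and, nbr, mem_filter]
      exact h.1.1
    · rintro ⟨u, c, w⟩ h ⟨u', c', w'⟩ h' e
      simp only [coe_filter, mem_univ, true_and, Set.mem_ofPred_eq] at h h'
      simp only [Sigma.mk.injEq, heq_eq_eq] at e
      obtain ⟨rfl, rfl⟩ := e
      rw [← h.2, ← h'.2]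
  have hsplit : (univ.filter fun t : V × V × V => isWalk H t).card ≤ 2 * T + light + heavy.card := by
    have : (univ.filter fun t : V × V × V => isWalk H t) ⊆
        ((univ.filter fun t : V × V × V => isWalk H t ∧ t.1 = t.2.2) ∪
        (univ.filter fun t => isLight H lam t)) ∪ heavy := by
      intro t ht
      have ht' := (mem_filter.1 ht).2
      simp only [mem_union, mem_filter, mem_univ, true_and, hheavy]
      by_cases e : t.1 = t.2.2
      · exact Or.inl (Or.inl ⟨ht', e⟩)
      by_cases e' : codeg H t.1 t.2.2 ≤ lam
      · exact Or.inl (Or.inr ⟨ht', e, e'⟩)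
      · exact Or.inr ⟨ht', by omega⟩
    refine (card_le_card this).trans ((card_union_le _ _).trans ?_)
    gcongr
    refine (card_union_le _ _).trans ?_
    gcongr
  have hheavyK : 2 * T * L ≤ 3 * K * heavy.card := by
    have h1 : 3 * K * (univ.filter fun t : V × V × V => isWalk H t).card ≤
      3 * K * (2 * T + light + heavy.card) := by gcongr
    have h2 : 6 * K * T ≤ L * T := by gcongr
    nlinarith
  have hQ : lam * heavy.card ≤ (quadF H).card := by
    refine le_trans ?_ (sum_codeg_le H hs heavy fun t ht => (mem_filter.1 ht).2.1)
    rw [mul_comm, ← smul_eq_mul]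
    exact card_nsmul_le_sum _ _ _ fun t ht => (mem_filter.1 ht).2.2.le
  calc 2 * T * L ^ 2 = A * lam * (2 * T * L) := by rw [hLA]; ring
    _ ≤ A * lam * (3 * K * heavy.card) := by gcongr
    _ = 3 * A * K * (lam * heavy.card) := by ring
    _ ≤ 3 * A * K * (quadF H).card := by gcongr
    _ = _ := by ring

/-- good edge selection -/
theorem edge_select {H bad : V → V → Prop} (hs : ∀ x y, H x y → H y x)
    {L E β M b : ℕ} (hL : ∀ v, (nbr H v).card ≤ L)
    (hE : ∑ v, (nbr H v).card = E) (hLp : 0 < L)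
    (hQ : E * L ^ 2 ≤ (quadF H).card * β)
    (hb : (univ.filter fun p : V × V => bad p.1 p.2).card ≤ b)
    (hEb : 4 * β * M * b < E) :
    ∃ c u, L ^ 2 ≤ 2 * β * eBip H (nbr H c) (nbr H u) ∧
      M * eBip bad (nbr H c) (nbr H c) ≤ L ^ 2 ∧ M * eBip bad (nbr H u) (nbr H u) ≤ L ^ 2 := by
  by_contra hcon
  push Not at hcon
  let Ed : Finset (V × V) := univ.filter fun p => H p.1 p.2
  have hEd : Ed.card = E := by
    rw [← hE]
    have h := card_eq_sum_card_fiberwise (s := Ed) (t := (univ : Finset V)) (f := fun t => t.1)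
      (fun _ _ => by simp)
    rw [h]
    refine sum_congr rfl fun c _ => ?_
    refine card_nbij' (fun t => t.2) (fun p => (c, p)) ?_ ?_ ?_ ?_
    · rintro ⟨u, w⟩ ht
      simp only [Ed, coe_filter, mem_filter, mem_univ, true_and, Set.mem_ofPred_eq] at ht
      obtain ⟨h1, rfl⟩ := ht
      simpa [nbr] using h1
    · intro w hw
      simp only [Ed, coe_filter, mem_filter, mem_univ, true_and, Set.mem_ofPred_eq, and_true]
      simpa [nbr] using hw
    · rintro ⟨u, w⟩ ht
      simp only [Ed, coe_filter, mem_filter, mem_univ, true_and, Set.mem_ofPred_eq] at ht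
      simp [ht.2]
    · intro w _; rfl
  have hsumQ : (quadF H).card ≤ ∑ p ∈ Ed, eBip H (nbr H p.1) (nbr H p.2) := by
    have h := card_eq_sum_card_fiberwise (s := quadF H) (t := Ed) (f := fun t => (t.1, t.2.1))
      (fun q hq => by
        simp only [quadF, coe_filter, mem_univ, true_and, Set.mem_ofPred_eq] at hq
        simp only [Ed, coe_filter, mem_univ, true_and, Set.mem_ofPred_eq]
        exact hq.1)
    rw [h]
    refine sum_le_sum fun p _ => ?_
    unfold eBip
    refine card_le_card_of_injOn (fun q => (q.2.2.1, q.2.2.2)) ?_ ?_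
    · rintro ⟨c, u, x, y⟩ hq
      simp only [quadF, coe_filter, mem_filter, mem_univ, true_and, Set.mem_ofPred_eq] at hq
      obtain ⟨⟨h1, h2, h3, h4⟩, rfl⟩ := hq
      simp only [coe_filter, mem_product, nbr, mem_filter, mem_univ, true_and, Set.mem_ofPred_eq]
      exact ⟨⟨h2, h3⟩, h4⟩
    · rintro ⟨c, u, x, y⟩ hq ⟨c', u', x', y'⟩ hq' e
      simp only [coe_filter, mem_filter, Set.mem_ofPred_eq] at hq hq'
      have := hq.2.trans hq'.2.symm
      simp only [Prod.mk.injEq] at this e ⊢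
      exact ⟨this.1, this.2, e.1, e.2⟩
  have hbad1 : ∑ p ∈ Ed, eBip bad (nbr H p.1) (nbr H p.1) ≤ b * L ^ 2 := by
    have e1 : ∑ p ∈ Ed, eBip bad (nbr H p.1) (nbr H p.1) =
      (Ed.sigma fun p => ((nbr H p.1) ×ˢ (nbr H p.1)).filter fun q => bad q.1 q.2).card := by
      rw [card_sigma]; rfl
    rw [e1]
    have sub : (Ed.sigma fun p => ((nbr H p.1) ×ˢ (nbr H p.1)).filter fun q => bad q.1 q.2) ⊆
        (univ.filter fun p : V × V => bad p.1 p.2).biUnion fun q =>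
          (nbr H q.1).biUnion fun c => (nbr H c).image fun u => ⟨(c, u), q⟩ := by
      rintro ⟨⟨c, u⟩, x, y⟩ h
      simp only [mem_sigma, Ed, mem_filter, mem_univ, true_and, mem_product, nbr] at h
      simp only [mem_biUnion, mem_filter, mem_univ, true_and, nbr, mem_image]
      exact ⟨(x, y), h.2.2, c, hs _ _ h.2.1.1, u, h.1, rfl⟩
    refine (card_le_card sub).trans ?_
    refine (card_biUnion_le_card_mul _ _ (L ^ 2) fun q _ => ?_).trans (Nat.mul_le_mul_right _ hb)
    refine (card_biUnion_le_card_mul _ _ L fun q _ => card_image_le.trans (hL _)).trans ?_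
    rw [pow_two]; exact Nat.mul_le_mul_right _ (hL _)
  have hbad2 : ∑ p ∈ Ed, eBip bad (nbr H p.2) (nbr H p.2) ≤ b * L ^ 2 := by
    refine le_trans (le_of_eq ?_) hbad1
    refine sum_nbij' (fun p => p.swap) (fun p => p.swap) ?_ ?_ ?_ ?_ ?_
    · rintro ⟨x, y⟩ h
      simp only [Ed, mem_filter, mem_univ, true_and, Prod.swap] at *
      exact hs _ _ h
    · rintro ⟨x, y⟩ h
      simp only [Ed, mem_filter, mem_univ, true_and, Prod.swap] at *
      exact hs _ _ h
    · simp
    · simp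
    · simp
  have hper : ∀ p ∈ Ed, 2 * β * eBip H (nbr H p.1) (nbr H p.2) ≤ L ^ 2 + 2 * β * M *
      (eBip bad (nbr H p.1) (nbr H p.1) + eBip bad (nbr H p.2) (nbr H p.2)) := by
    rintro ⟨c, u⟩ _
    have hle : eBip H (nbr H c) (nbr H u) ≤ L ^ 2 := by
      unfold eBip
      refine (card_filter_le _ _).trans ?_
      rw [card_product, pow_two]
      exact Nat.mul_le_mul (hL _) (hL _)
    simp only
    by_cases h1 : L ^ 2 ≤ 2 * β * eBip H (nbr H c) (nbr H u)
    · have h2 := hcon c u h1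
      by_cases h3 : M * eBip bad (nbr H c) (nbr H c) ≤ L ^ 2
      · have h4 := h2 h3
        calc 2 * β * eBip H (nbr H c) (nbr H u) ≤ 2 * β * L ^ 2 := by gcongr
          _ ≤ 2 * β * (M * eBip bad (nbr H u) (nbr H u)) := by gcongr
          _ ≤ _ := by nlinarith [Nat.zero_le (2 * β * M * eBip bad (nbr H c) (nbr H c)), Nat.zero_le (L^2)]
      · push Not at h3
        calc 2 * β * eBip H (nbr H c) (nbr H u) ≤ 2 * β * L ^ 2 := by gcongr
          _ ≤ 2 * β * (M * eBip bad (nbr H c) (nbr H c)) := by gcongr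
          _ ≤ _ := by nlinarith [Nat.zero_le (2 * β * M * eBip bad (nbr H u) (nbr H u)), Nat.zero_le (L^2)]
    · omega
  have hsum := sum_le_sum hper
  rw [sum_add_distrib, ← mul_sum, ← mul_sum, sum_add_distrib, sum_const, smul_eq_mul, hEd] at hsum
  have f1 : 2 * β * (quadF H).card ≤ E * L ^ 2 + 2 * β * M * (b * L ^ 2 + b * L ^ 2) := by
    refine le_trans ?_ (hsum.trans ?_)
    · gcongr
    · gcongr
  have f2 : E * L ^ 2 ≤ 4 * β * M * b * L ^ 2 := by nlinarith
  have f3 := Nat.le_of_mul_le_mul_right f2 (pow_pos hLp 2)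
  omega
end M6

section M6b
open Finset
open scoped Classical
variable {V : Type*} [Fintype V]

theorem nat_pow_sum {α : Type*} (s : Finset α) (f : α → ℕ) (k : ℕ) :
    (∑ i ∈ s, f i) ^ (k + 1) ≤ s.card ^ k * ∑ i ∈ s, f i ^ (k + 1) := by
  have h := pow_sum_le_card_mul_sum_pow (s := s) (f := fun i => (f i : ℝ))
    (fun i _ => Nat.cast_nonneg _) k
  exact_mod_cast h

theorem pi_fix {ι : Type*} [Fintype ι] [DecidableEq ι] (S : ι → Finset V) (L : ℕ) (hS : ∀ i, (S i).card ≤ L)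
    (A : Finset ι) (g : ι → V) :
    ((Fintype.piFinset S).filter fun f => ∀ i ∈ A, f i = g i).card * L ^ A.card ≤
      L ^ Fintype.card ι := by
  have h1 : ((Fintype.piFinset S).filter fun f => ∀ i ∈ A, f i = g i) ⊆
      Fintype.piFinset (fun i => if i ∈ A then ({g i} : Finset V) else S i) := by
    intro f hf
    simp only [mem_filter, Fintype.mem_piFinset] at hf ⊢
    intro i
    split_ifs with h
    · simpa using hf.2 i h
    · exact hf.1 i
  calc _ ≤ (Fintype.piFinset (fun i => if i ∈ A then ({g i} : Finset V) else S i)).card * L ^ A.card := by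
        gcongr
    _ = (∏ i, (if i ∈ A then ({g i} : Finset V) else S i).card) * ∏ i, (if i ∈ A then L else 1) := by
        rw [Fintype.card_piFinset]
        congr 1
        rw [prod_ite, prod_const, prod_const_one, mul_one]
        congr 2
        ext; simp
    _ = ∏ i, ((if i ∈ A then ({g i} : Finset V) else S i).card * (if i ∈ A then L else 1)) := by
        rw [prod_mul_distrib]
    _ ≤ ∏ _i : ι, L := by
        refine prod_le_prod' fun i _ => ?_
        split_ifs
        · simp
        · simpa using hS i
    _ = _ := by rw [prod_const, card_univ]

theorem ev_pair {ι : Type*} [Fintype ι] [DecidableEq ι] (S : ι → Finset V) (L : ℕ) (hS : ∀ i, (S i).card ≤ L)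
    {i j : ι} (hij : i ≠ j) (R : Finset (V × V)) (Q : (ι → V) → Prop) [DecidablePred Q]
    (hQ : ∀ f ∈ Fintype.piFinset S, Q f → (f i, f j) ∈ R) :
    ((Fintype.piFinset S).filter Q).card * L ^ 2 ≤ R.card * L ^ Fintype.card ι := by
  have h := card_eq_sum_card_fiberwise (s := (Fintype.piFinset S).filter Q) (t := R)
    (f := fun f => (f i, f j)) (fun f hf => by
      simp only [coe_filter, Set.mem_ofPred_eq] at hf
      exact hQ f hf.1 hf.2)
  rw [h, sum_mul, ← smul_eq_mul, ← sum_const]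
  refine sum_le_sum fun r _ => ?_
  have := pi_fix S L hS {i, j} (fun k => if k = i then r.1 else r.2)
  rw [card_pair hij] at this
  refine le_trans ?_ this
  gcongr
  intro f hf
  simp only [mem_filter] at hf ⊢
  refine ⟨hf.1.1, ?_⟩
  rw [← hf.2]
  intro k hk
  simp only [mem_insert, mem_singleton] at hk
  rcases hk with rfl | rfl
  · simp
  · simp [hij.symm]

theorem ev_triple {ι : Type*} [Fintype ι] [DecidableEq ι] (S : ι → Finset V) (L : ℕ) (hS : ∀ i, (S i).card ≤ L)
    {i j k : ι} (hij : i ≠ j) (hik : i ≠ k) (hjk : j ≠ k) (R : Finset (V × V × V)) (Q : (ι → V) → Prop) [DecidablePred Q]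
    (hQ : ∀ f ∈ Fintype.piFinset S, Q f → (f i, f j, f k) ∈ R) :
    ((Fintype.piFinset S).filter Q).card * L ^ 3 ≤ R.card * L ^ Fintype.card ι := by
  have h := card_eq_sum_card_fiberwise (s := (Fintype.piFinset S).filter Q) (t := R)
    (f := fun f => (f i, f j, f k)) (fun f hf => by
      simp only [coe_filter, Set.mem_ofPred_eq] at hf
      exact hQ f hf.1 hf.2)
  rw [h, sum_mul, ← smul_eq_mul, ← sum_const]
  refine sum_le_sum fun r _ => ?_
  have := pi_fix S L hS {i, j, k} (fun x => if x = i then r.1 else if x = j then r.2.1 else r.2.2)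
  have hc : ({i, j, k} : Finset ι).card = 3 := card_eq_three.2 ⟨i, j, k, hij, hik, hjk, rfl⟩
  rw [hc] at this
  refine le_trans ?_ this
  gcongr
  intro f hf
  simp only [mem_filter] at hf ⊢
  refine ⟨hf.1.1, ?_⟩
  rw [← hf.2]
  intro x hx
  simp only [mem_insert, mem_singleton] at hx
  rcases hx with rfl | rfl | rfl
  · simp
  · simp [hij.symm]
  · simp [hik.symm, hjk.symm]

/-- number of homomorphisms of a complete bipartite graph -/
theorem hom_count (H : V → V → Prop) (U W : Finset V) (L β : ℕ) (hU : U.card ≤ L) (hW : W.card ≤ L)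
    (hLp : 0 < L) (he : L ^ 2 ≤ β * eBip H U W) (s N : ℕ) (hs : 0 < s) (hN : 0 < N) :
    L ^ (s + N) ≤ β ^ (s * N) *
      ((Fintype.piFinset (fun _ : Fin s => U) ×ˢ Fintype.piFinset (fun _ : Fin N => W)).filter
        fun p => ∀ i j, H (p.1 i) (p.2 j)).card := by
  obtain ⟨s, rfl⟩ : ∃ t, s = t + 1 := ⟨s - 1, by omega⟩
  obtain ⟨N, rfl⟩ : ∃ t, N = t + 1 := ⟨N - 1, by omega⟩
  set homs := ((Fintype.piFinset (fun _ : Fin (s+1) => U) ×ˢ Fintype.piFinset (fun _ : Fin (N+1) => W)).filter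
        fun p => ∀ i j, H (p.1 i) (p.2 j)).card with hh
  set e := eBip H U W with hedef
  let PW := Fintype.piFinset (fun _ : Fin (N+1) => W)
  let cd : (Fin (N+1) → V) → Finset V := fun b => U.filter fun a => ∀ j, H a (b j)
  let dg : V → Finset V := fun a => W.filter fun b => H a b
  have h1 : homs = ∑ b ∈ PW, (cd b).card ^ (s + 1) := by
    have : ∀ b, (cd b).card ^ (s+1) = (Fintype.piFinset (fun _ : Fin (s+1) => cd b)).card := by
      intro b; rw [Fintype.card_piFinset]; simp
    simp_rw [this]
    rw [← card_sigma, hh]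
    refine card_nbij' (fun p => ⟨p.2, p.1⟩) (fun x => (x.2, x.1)) ?_ ?_ ?_ ?_
    · rintro ⟨a, b⟩ h
      simp only [coe_filter, mem_product, Fintype.mem_piFinset, Set.mem_ofPred_eq] at h
      simp only [coe_sigma, Set.mem_sigma_iff, mem_coe, PW, Fintype.mem_piFinset, cd, mem_filter]
      exact ⟨h.1.2, fun i => ⟨h.1.1 i, fun j => h.2 i j⟩⟩
    · rintro ⟨b, a⟩ h
      simp only [coe_sigma, Set.mem_sigma_iff, mem_coe, PW, Fintype.mem_piFinset, cd, mem_filter] at h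
      simp only [coe_filter, mem_product, Fintype.mem_piFinset, Set.mem_ofPred_eq]
      exact ⟨⟨fun i => (h.2 i).1, h.1⟩, fun i j => (h.2 i).2 j⟩
    · intro p _; rfl
    · intro p _; rfl
  have h2 : ∑ b ∈ PW, (cd b).card = ∑ a ∈ U, (dg a).card ^ (N + 1) := by
    have : ∀ a, (dg a).card ^ (N+1) = (Fintype.piFinset (fun _ : Fin (N+1) => dg a)).card := by
      intro b; rw [Fintype.card_piFinset]; simp
    simp_rw [this]
    rw [← card_sigma, ← card_sigma]
    refine card_nbij' (fun p => ⟨p.2, p.1⟩) (fun x => ⟨x.2, x.1⟩) ?_ ?_ ?_ ?_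
    · rintro ⟨b, a⟩ h
      simp only [coe_sigma, Set.mem_sigma_iff, mem_coe, PW, Fintype.mem_piFinset, cd, mem_filter] at h
      simp only [coe_sigma, Set.mem_sigma_iff, mem_coe, Fintype.mem_piFinset, dg, mem_filter]
      exact ⟨h.2.1, fun j => ⟨h.1 j, h.2.2 j⟩⟩
    · rintro ⟨a, b⟩ h
      simp only [coe_sigma, Set.mem_sigma_iff, mem_coe, Fintype.mem_piFinset, dg, mem_filter] at h
      simp only [coe_sigma, Set.mem_sigma_iff, mem_coe, PW, Fintype.mem_piFinset, cd, mem_filter]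
      exact ⟨fun j => (h.2 j).1, h.1, fun j => (h.2 j).2⟩
    · intro p _; rfl
    · intro p _; rfl
  have h3 : e = ∑ a ∈ U, (dg a).card := by
    rw [← card_sigma, hedef, eBip]
    refine card_nbij' (fun p => ⟨p.1, p.2⟩) (fun x => (x.1, x.2)) ?_ ?_ ?_ ?_
    · rintro ⟨a, b⟩ h
      simpa [dg, and_assoc] using h
    · rintro ⟨a, b⟩ h
      simpa [dg, and_assoc] using h
    · intro p _; rfl
    · intro p _; rfl
  have j1 := nat_pow_sum U (fun a => (dg a).card) N
  have j2 := nat_pow_sum PW (fun b => (cd b).card) s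
  rw [← h3, ← h2] at j1
  rw [← h1] at j2
  have hPW : PW.card ≤ L ^ (N + 1) := by
    simp only [PW, Fintype.card_piFinset, prod_const, card_univ, Fintype.card_fin]
    gcongr
  have k1 : (e ^ (N + 1)) ^ (s + 1) ≤ (L ^ N) ^ (s + 1) * ((L ^ (N + 1)) ^ s * homs) := by
    calc (e ^ (N + 1)) ^ (s + 1) ≤ (U.card ^ N * ∑ b ∈ PW, (cd b).card) ^ (s + 1) := by gcongr
      _ = (U.card ^ N) ^ (s + 1) * (∑ b ∈ PW, (cd b).card) ^ (s + 1) := by rw [mul_pow]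
      _ ≤ (L ^ N) ^ (s + 1) * ((L ^ (N + 1)) ^ s * homs) := by
          gcongr
          exact j2.trans (by gcongr)
  have k2 : L ^ (N * (s + 1) + (N + 1) * s) * L ^ (s + 1 + (N + 1)) ≤
      L ^ (N * (s + 1) + (N + 1) * s) * (β ^ ((s + 1) * (N + 1)) * homs) := by
    calc L ^ (N * (s + 1) + (N + 1) * s) * L ^ (s + 1 + (N + 1)) = ((L ^ 2) ^ (N + 1)) ^ (s + 1) := by
          rw [← pow_add, ← pow_mul, ← pow_mul]; congr 1; ring
      _ ≤ ((β * e) ^ (N + 1)) ^ (s + 1) := by gcongr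
      _ = β ^ ((s + 1) * (N + 1)) * (e ^ (N + 1)) ^ (s + 1) := by
          rw [mul_pow, mul_pow, ← pow_mul, mul_comm (N + 1) (s + 1)]
      _ ≤ β ^ ((s + 1) * (N + 1)) * ((L ^ N) ^ (s + 1) * ((L ^ (N + 1)) ^ s * homs)) := by gcongr
      _ = _ := by rw [← pow_mul, ← pow_mul, pow_add]; ring
  exact Nat.le_of_mul_le_mul_left k2 (pow_pos hLp _)

theorem biclique_sample (H bad : V → V → Prop) (hsym : ∀ x y, H x y → H y x)
    (U W : Finset V) (L β M l : ℕ) (hU : U.card ≤ L) (hW : W.card ≤ L)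
    (hLp : 0 < L) (he : L ^ 2 ≤ β * eBip H U W)
    (hbU : M * eBip bad U U ≤ L ^ 2) (hbW : M * eBip bad W W ≤ L ^ 2)
    (ch : V → V → ℕ) (hch : ∀ p k, (univ.filter fun q => H p q ∧ ch p q = k).card ≤ l)
    (hl : M * l ≤ L) (s N : ℕ) (hs : 0 < s) (hN : 0 < N)
    (hM : 2 * (s + N) ^ 3 * β ^ (s * N) < M) :
    ∃ (a : Fin s → V) (b : Fin N → V), (∀ i j, H (a i) (b j)) ∧
      (∀ i i', i ≠ i' → ¬ bad (a i) (a i')) ∧ (∀ j j', j ≠ j' → ¬ bad (b j) (b j')) ∧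
      (∀ i, Function.Injective fun j => ch (a i) (b j)) ∧
      (∀ j, Function.Injective fun i => ch (b j) (a i)) := by
  let ι := Fin s ⊕ Fin N
  have hι : Fintype.card ι = s + N := by simp [ι]
  let S : ι → Finset V := Sum.elim (fun _ => U) (fun _ => W)
  have hS : ∀ i, (S i).card ≤ L := by rintro (i | i) <;> simp [S, hU, hW]
  have hbS : ∀ i, M * eBip bad (S i) (S i) ≤ L ^ 2 := by rintro (i | i) <;> simp [S, hbU, hbW]
  let E2 : ι × ι → (ι → V) → Prop := fun x f => x.1 ≠ x.2 ∧ S x.1 = S x.2 ∧ bad (f x.1) (f x.2)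
  let E3 : ι × ι × ι → (ι → V) → Prop := fun x f => x.1 ≠ x.2.1 ∧ x.1 ≠ x.2.2 ∧ x.2.1 ≠ x.2.2 ∧
    H (f x.1) (f x.2.1) ∧ H (f x.1) (f x.2.2) ∧ ch (f x.1) (f x.2.1) = ch (f x.1) (f x.2.2)
  let P := Fintype.piFinset S
  have c2 : ∀ x, (P.filter (E2 x)).card * M ≤ L ^ (s + N) := by
    rintro ⟨i, j⟩
    by_cases hx : i ≠ j ∧ S i = S j
    · have := ev_pair S L hS hx.1 ((S i ×ˢ S i).filter fun p => bad p.1 p.2) (E2 (i, j)) (by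
        intro f hf h
        rw [Fintype.mem_piFinset] at hf
        simp only [mem_filter, mem_product]
        exact ⟨⟨hf i, h.2.1 ▸ hf j⟩, h.2.2⟩)
      have hb : M * ((S i ×ˢ S i).filter fun p => bad p.1 p.2).card ≤ L ^ 2 := hbS i
      rw [hι] at this
      refine Nat.le_of_mul_le_mul_left ?_ (show 0 < L ^ 2 by positivity)
      calc L ^ 2 * ((P.filter (E2 (i, j))).card * M) = ((P.filter (E2 (i, j))).card * L ^ 2) * M := by ring
        _ ≤ (((S i ×ˢ S i).filter fun p => bad p.1 p.2).card * L ^ (s + N)) * M := Nat.mul_le_mul_right M this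
        _ = (M * ((S i ×ˢ S i).filter fun p => bad p.1 p.2).card) * L ^ (s + N) := by ring
        _ ≤ _ := by gcongr
    · rw [filter_false_of_mem]
      · simp
      · intro f _ h; exact hx ⟨h.1, h.2.1⟩
  have c3 : ∀ x, (P.filter (E3 x)).card * M ≤ L ^ (s + N) := by
    rintro ⟨i, j, k⟩
    by_cases hx : i ≠ j ∧ i ≠ k ∧ j ≠ k
    · let R : Finset (V × V × V) := ((S i ×ˢ S j).biUnion fun p =>
        (univ.filter fun q => H p.1 q ∧ ch p.1 q = ch p.1 p.2).image fun q => (p.1, p.2, q))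
      have hR : R.card ≤ L * L * l := by
        refine (card_biUnion_le_card_mul _ _ l fun p _ => card_image_le.trans (hch _ _)).trans ?_
        rw [card_product]
        gcongr
        · exact hS i
        · exact hS j
      have := ev_triple S L hS hx.1 hx.2.1 hx.2.2 R (E3 (i, j, k)) (by
        intro f hf h
        rw [Fintype.mem_piFinset] at hf
        simp only [R, mem_biUnion, mem_image, mem_filter, mem_univ, true_and, mem_product]
        exact ⟨(f i, f j), ⟨hf i, hf j⟩, f k, ⟨h.2.2.2.2.1, h.2.2.2.2.2.symm⟩, rfl⟩)
      rw [hι] at this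
      refine Nat.le_of_mul_le_mul_left ?_ (show 0 < L ^ 3 by positivity)
      calc L ^ 3 * ((P.filter (E3 (i, j, k))).card * M) = ((P.filter (E3 (i, j, k))).card * L ^ 3) * M := by ring
        _ ≤ (R.card * L ^ (s + N)) * M := Nat.mul_le_mul_right M this
        _ ≤ ((L * L * l) * L ^ (s + N)) * M := by gcongr
        _ = L * L * L ^ (s + N) * (M * l) := by ring
        _ ≤ L * L * L ^ (s + N) * L := by gcongr
        _ = _ := by ring
    · rw [filter_false_of_mem]
      · simp
      · intro f _ h; exact hx ⟨h.1, h.2.1, h.2.2.1⟩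
  by_contra hcon
  have hom := hom_count H U W L β hU hW hLp he s N hs hN
  set homs := ((Fintype.piFinset (fun _ : Fin s => U) ×ˢ Fintype.piFinset (fun _ : Fin N => W)).filter
        fun p => ∀ i j, H (p.1 i) (p.2 j)) with hh
  have hle : homs.card ≤ ((univ.biUnion fun x => P.filter (E2 x)) ∪ (univ.biUnion fun x => P.filter (E3 x))).card := by
    refine card_le_card_of_injOn (fun p => Sum.elim p.1 p.2) ?_ ?_
    · rintro ⟨a, b⟩ h
      simp only [hh, coe_filter, mem_product, Fintype.mem_piFinset, Set.mem_ofPred_eq] at h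
      obtain ⟨⟨ha, hb⟩, hab⟩ := h
      have hP : Sum.elim a b ∈ P := by
        rw [Fintype.mem_piFinset]
        rintro (i | i)
        · exact ha i
        · exact hb i
      by_contra hn
      simp only [coe_union, Set.mem_union, mem_coe, mem_biUnion, mem_univ, true_and, mem_filter, not_or,
        not_exists, not_and] at hn
      obtain ⟨n2, n3⟩ := hn
      refine hcon ⟨a, b, hab, ?_, ?_, ?_, ?_⟩
      · intro i i' hi hbad
        exact n2 (Sum.inl i, Sum.inl i') hP ⟨fun h => hi (Sum.inl_injective h), rfl, hbad⟩
      · intro i i' hi hbad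
        exact n2 (Sum.inr i, Sum.inr i') hP ⟨fun h => hi (Sum.inr_injective h), rfl, hbad⟩
      · intro i j j' hj
        by_contra hne
        exact n3 (Sum.inl i, Sum.inr j, Sum.inr j') hP ⟨by simp, by simp, fun h => hne (Sum.inr_injective h), hab _ _, hab _ _, hj⟩
      · intro j i i' hi
        by_contra hne
        exact n3 (Sum.inr j, Sum.inl i, Sum.inl i') hP ⟨by simp, by simp, fun h => hne (Sum.inl_injective h),
          hsym _ _ (hab _ _), hsym _ _ (hab _ _), hi⟩
    · rintro ⟨a, b⟩ _ ⟨a', b'⟩ _ h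
      have h1 : ∀ x, Sum.elim a b x = Sum.elim a' b' x := fun x => congrFun h x
      exact Prod.ext (funext fun i => h1 (Sum.inl i)) (funext fun i => h1 (Sum.inr i))
  have u2 : (univ.biUnion fun x => P.filter (E2 x)).card * M ≤ (s + N) ^ 2 * L ^ (s + N) := by
    calc _ ≤ (∑ x, (P.filter (E2 x)).card) * M := by gcongr; exact card_biUnion_le
      _ = ∑ x, (P.filter (E2 x)).card * M := sum_mul ..
      _ ≤ ∑ _x : ι × ι, L ^ (s + N) := sum_le_sum fun x _ => c2 x
      _ = _ := by rw [sum_const, card_univ, Fintype.card_prod, hι, smul_eq_mul]; ring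
  have u3 : (univ.biUnion fun x => P.filter (E3 x)).card * M ≤ (s + N) ^ 3 * L ^ (s + N) := by
    calc _ ≤ (∑ x, (P.filter (E3 x)).card) * M := by gcongr; exact card_biUnion_le
      _ = ∑ x, (P.filter (E3 x)).card * M := sum_mul ..
      _ ≤ ∑ _x : ι × ι × ι, L ^ (s + N) := sum_le_sum fun x _ => c3 x
      _ = _ := by rw [sum_const, card_univ, Fintype.card_prod, Fintype.card_prod, hι, smul_eq_mul]; ring
  have hsN : (s + N) ^ 2 ≤ (s + N) ^ 3 := Nat.pow_le_pow_right (by omega) (by norm_num)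
  have hpos : 0 < homs.card := by
    rcases Nat.eq_zero_or_pos homs.card with h0 | h0
    · rw [h0, mul_zero] at hom
      have : 0 < L ^ (s + N) := by positivity
      omega
    · exact h0
  have fin : homs.card * M ≤ homs.card * (2 * (s + N) ^ 3 * β ^ (s * N)) := by
    calc homs.card * M ≤ _ * M := Nat.mul_le_mul_right M (hle.trans (card_union_le _ _))
      _ ≤ (s + N) ^ 2 * L ^ (s + N) + (s + N) ^ 3 * L ^ (s + N) := by rw [add_mul]; exact add_le_add u2 u3
      _ ≤ (s + N) ^ 3 * L ^ (s + N) + (s + N) ^ 3 * L ^ (s + N) := by gcongr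
      _ = 2 * (s + N) ^ 3 * L ^ (s + N) := by ring
      _ ≤ 2 * (s + N) ^ 3 * (β ^ (s * N) * homs.card) := by gcongr
      _ = _ := by ring
  have := Nat.le_of_mul_le_mul_left fin hpos
  omega
end M6b

section M3
open Finset
open scoped Classical

theorem IsLoop.fract {g : ℝ → ℂ} (h : IsLoop g) (x : ℝ) : g (Int.fract x) = g x := by
  have hper : Function.Periodic g 1 := h.per
  have := hper.sub_zsmul_eq (x := x) ⌊x⌋
  rw [zsmul_eq_mul, mul_one] at this
  exact this

/-- an arrangement of loops in general position -/
structure Arr (n : ℕ) where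
  F : Fin n → ℝ → ℂ
  loop : ∀ i, IsLoop (F i)
  Pts : Finset ℂ
  mem : ∀ x, x ∈ Pts ↔ ∃ i j, i ≠ j ∧ x ∈ Set.range (F i) ∧ x ∈ Set.range (F j)
  gp : ∀ x i j k, x ∈ Set.range (F i) → x ∈ Set.range (F j) → x ∈ Set.range (F k) → i = j ∨ i = k ∨ j = k

namespace Arr
variable {n : ℕ} (R : Arr n)

def G (i : Fin n) : Set ℂ := Set.range (R.F i)

theorem exists_tm {i : Fin n} {x : ℂ} (h : x ∈ R.G i) : ∃ t, 0 ≤ t ∧ t < 1 ∧ R.F i t = x := by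
  obtain ⟨t, rfl⟩ := h
  exact ⟨Int.fract t, Int.fract_nonneg t, Int.fract_lt_one t, (R.loop i).fract t⟩

def tm (i : Fin n) (x : ℂ) : ℝ := if h : x ∈ R.G i then (R.exists_tm h).choose else 0

theorem tm_spec {i : Fin n} {x : ℂ} (h : x ∈ R.G i) :
    0 ≤ R.tm i x ∧ R.tm i x < 1 ∧ R.F i (R.tm i x) = x := by
  rw [tm, dif_pos h]; exact (R.exists_tm h).choose_spec

theorem tm_eq {i : Fin n} {t : ℝ} (h0 : 0 ≤ t) (h1 : t < 1) : R.tm i (R.F i t) = t := by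
  have h := R.tm_spec (i := i) (x := R.F i t) ⟨t, rfl⟩
  exact (R.loop i).inj _ _ h.1 h.2.1 h0 h1 h.2.2

theorem tm_inj {i : Fin n} {x y : ℂ} (hx : x ∈ R.G i) (hy : y ∈ R.G i) (h : R.tm i x = R.tm i y) : x = y := by
  rw [← (R.tm_spec hx).2.2, ← (R.tm_spec hy).2.2, h]

def on (i : Fin n) : Finset ℂ := R.Pts.filter fun x => x ∈ R.G i

theorem mem_on {i : Fin n} {x : ℂ} : x ∈ R.on i ↔ x ∈ R.Pts ∧ x ∈ R.G i := by simp [on]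

theorem on_of {i j : Fin n} {x : ℂ} (hij : i ≠ j) (hi : x ∈ R.G i) (hj : x ∈ R.G j) : x ∈ R.on i :=
  R.mem_on.2 ⟨(R.mem x).2 ⟨i, j, hij, hi, hj⟩, hi⟩

def idx (i : Fin n) (x : ℂ) : ℕ := ((R.on i).filter fun y => R.tm i y < R.tm i x).card

theorem idx_mono {i : Fin n} {x y : ℂ} (h : R.tm i x ≤ R.tm i y) : R.idx i x ≤ R.idx i y := by
  refine card_le_card fun z hz => ?_
  simp only [mem_filter] at hz ⊢
  exact ⟨hz.1, hz.2.trans_le h⟩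

theorem idx_lt {i : Fin n} {x y : ℂ} (hx : x ∈ R.on i) (h : R.tm i x < R.tm i y) : R.idx i x < R.idx i y := by
  refine card_lt_card ((ssubset_iff_of_subset fun z hz => ?_).2 ⟨x, ?_, ?_⟩)
  · simp only [mem_filter] at hz ⊢
    exact ⟨hz.1, hz.2.trans h⟩
  · simp [hx, h]
  · simp

theorem idx_inj {i : Fin n} {x y : ℂ} (hx : x ∈ R.on i) (hy : y ∈ R.on i) (h : R.idx i x = R.idx i y) : x = y := by
  rcases lt_trichotomy (R.tm i x) (R.tm i y) with h1 | h1 | h1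
  · exact absurd h (R.idx_lt hx h1).ne
  · exact R.tm_inj (R.mem_on.1 hx).2 (R.mem_on.1 hy).2 h1
  · exact absurd h.symm (R.idx_lt hy h1).ne

theorem idx_lt_card {i : Fin n} {x : ℂ} (hx : x ∈ R.on i) : R.idx i x < (R.on i).card := by
  refine card_lt_card ((ssubset_iff_of_subset (filter_subset _ _)).2 ⟨x, hx, by simp⟩)

theorem cnt (i : Fin n) (l k : ℕ) (hl : 0 < l) : ((R.on i).filter fun x => R.idx i x / l = k).card ≤ l := by
  have : ((R.on i).filter fun x => R.idx i x / l = k).card ≤ (Finset.Ico (l * k) (l * k + l)).card := by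
    refine card_le_card_of_injOn (R.idx i) ?_ ?_
    · intro x hx
      simp only [coe_filter, Set.mem_ofPred_eq] at hx
      rw [mem_coe, Finset.mem_Ico]
      have h1 := Nat.div_add_mod (R.idx i x) l
      have h2 := Nat.mod_lt (R.idx i x) hl
      rw [hx.2] at h1
      omega
    · intro x hx y hy h
      simp only [coe_filter, Set.mem_ofPred_eq] at hx hy
      exact R.idx_inj hx.1 hy.1 h
  simpa using this

/-- incidences -/
def inc : Finset (Fin n × ℂ) := (univ ×ˢ R.Pts).filter fun p => p.2 ∈ R.G p.1

theorem mem_inc {p : Fin n × ℂ} : p ∈ R.inc ↔ p.2 ∈ R.on p.1 := by simp [inc, on]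

/-- pieces -/
def Vs (L : ℕ) : Finset (Fin n × ℕ) := R.inc.image fun p => (p.1, R.idx p.1 p.2 / L)

def inP (L : ℕ) (v : Fin n × ℕ) (x : ℂ) : Prop := x ∈ R.on v.1 ∧ R.idx v.1 x / L = v.2

theorem vs_ne {L : ℕ} {v : Fin n × ℕ} (h : v ∈ R.Vs L) : ∃ x, R.inP L v x := by
  simp only [Vs, mem_image] at h
  obtain ⟨p, hp, rfl⟩ := h
  exact ⟨p.2, R.mem_inc.1 hp, rfl⟩

theorem inP_vs {L : ℕ} {v : Fin n × ℕ} {x : ℂ} (h : R.inP L v x) : v ∈ R.Vs L := by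
  simp only [Vs, mem_image]
  exact ⟨(v.1, x), R.mem_inc.2 h.1, Prod.ext rfl h.2⟩

/-- Time interval of a piece. -/
structure IsInt (L : ℕ) (v : Fin n × ℕ) (lo ρ : ℝ) : Prop where
  lo0 : 0 ≤ lo
  ρ1 : ρ < 1
  gen : R.F v.1 ρ ∉ R.Pts
  le : ∀ x, R.inP L v x → lo ≤ R.tm v.1 x ∧ R.tm v.1 x < ρ
  pts : ∀ x ∈ R.on v.1, lo ≤ R.tm v.1 x → R.tm v.1 x ≤ ρ → R.inP L v x
  att : ∃ x, R.inP L v x ∧ R.tm v.1 x = lo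

theorem exists_int {L : ℕ} {v : Fin n × ℕ} (h : v ∈ R.Vs L) : ∃ lo ρ, R.IsInt L v lo ρ := by
  let S := (R.on v.1).filter fun x => R.inP L v x
  have hS : S.Nonempty := by
    obtain ⟨x, hx⟩ := R.vs_ne h
    exact ⟨x, by simp [S, hx, hx.1]⟩
  have hmS : ∀ x, x ∈ S ↔ R.inP L v x := fun x => by
    simp only [S, mem_filter]; exact ⟨fun h => h.2, fun h => ⟨h.1, h⟩⟩
  obtain ⟨a, ha, hamin⟩ := S.exists_min_image (R.tm v.1) hS
  obtain ⟨b, hb, hbmax⟩ := S.exists_max_image (R.tm v.1) hS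
  rw [hmS] at ha hb
  let Q : Finset ℝ := insert 1 (((R.on v.1).image (R.tm v.1)).filter fun t => R.tm v.1 b < t)
  have hbG := (R.mem_on.1 hb.1).2
  have hQ : ∀ t ∈ Q, R.tm v.1 b < t := by
    intro t ht
    simp only [Q, mem_insert, mem_filter] at ht
    rcases ht with rfl | ht
    · exact (R.tm_spec hbG).2.1
    · exact ht.2
  obtain ⟨c, hc, hcmin⟩ := Q.exists_min_image id (by simp [Q])
  simp only [id] at hcmin
  have hbc := hQ c hc
  have hc1 : c ≤ 1 := hcmin 1 (by simp [Q])
  have hbt := R.tm_spec hbG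
  have hle : ∀ x ∈ R.on v.1, R.tm v.1 x ≤ (R.tm v.1 b + c) / 2 → R.tm v.1 x ≤ R.tm v.1 b := by
    intro x hx hle
    by_contra hcon
    push Not at hcon
    have := hcmin (R.tm v.1 x) (by
      simp only [Q, mem_insert, mem_filter, mem_image]
      exact Or.inr ⟨⟨x, hx, rfl⟩, hcon⟩)
    linarith
  refine ⟨R.tm v.1 a, (R.tm v.1 b + c) / 2, (R.tm_spec (R.mem_on.1 ha.1).2).1, by linarith, ?_, ?_, ?_, a, ha, rfl⟩
  · intro hP
    have ht := R.tm_eq (i := v.1) (t := (R.tm v.1 b + c) / 2) (by linarith) (by linarith)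
    have := hle _ (R.mem_on.2 ⟨hP, ⟨_, rfl⟩⟩) ht.le
    rw [ht] at this
    linarith
  · intro x hx
    have h1 := hamin x ((hmS x).2 hx)
    have h2 := hbmax x ((hmS x).2 hx)
    exact ⟨h1, by linarith⟩
  · intro x hx h1 h2
    have h3 := hle x hx h2
    have e1 := R.idx_mono h1
    have e2 := R.idx_mono h3
    refine ⟨hx, le_antisymm ?_ ?_⟩
    · rw [← hb.2]; exact Nat.div_le_div_right e2
    · rw [← ha.2]; exact Nat.div_le_div_right e1

def lo (L : ℕ) (v : Fin n × ℕ) : ℝ := if h : v ∈ R.Vs L then (R.exists_int h).choose else 0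
def rho (L : ℕ) (v : Fin n × ℕ) : ℝ := if h : v ∈ R.Vs L then (R.exists_int h).choose_spec.choose else 0

theorem isInt {L : ℕ} {v : Fin n × ℕ} (h : v ∈ R.Vs L) : R.IsInt L v (R.lo L v) (R.rho L v) := by
  rw [lo, rho, dif_pos h, dif_pos h]; exact (R.exists_int h).choose_spec.choose_spec

/-- t is a time in the interval of piece v -/
def InI (L : ℕ) (v : Fin n × ℕ) (t : ℝ) : Prop := R.lo L v ≤ t ∧ t ≤ R.rho L v

variable {R} {L : ℕ} {p q : Fin n × ℕ}

theorem InI.nn (hp : p ∈ R.Vs L) {t : ℝ} (h : R.InI L p t) : 0 ≤ t := (R.isInt hp).lo0.trans h.1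
theorem InI.lt1 (hp : p ∈ R.Vs L) {t : ℝ} (h : R.InI L p t) : t < 1 := h.2.trans_lt (R.isInt hp).ρ1

theorem InI_rho (hp : p ∈ R.Vs L) : R.InI L p (R.rho L p) := by
  obtain ⟨x, hx⟩ := R.vs_ne hp
  have := (R.isInt hp).le x hx
  exact ⟨by linarith, le_rfl⟩

theorem inP.inI {x : ℂ} (h : R.inP L p x) : R.InI L p (R.tm p.1 x) :=
  ⟨((R.isInt (R.inP_vs h)).le x h).1, ((R.isInt (R.inP_vs h)).le x h).2.le⟩

theorem inP_of_time (hp : p ∈ R.Vs L) {t : ℝ} (h : R.InI L p t) (hx : R.F p.1 t ∈ R.Pts) :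
    R.inP L p (R.F p.1 t) := by
  have e := R.tm_eq (i := p.1) (h.nn hp) (h.lt1 hp)
  exact (R.isInt hp).pts _ (R.mem_on.2 ⟨hx, ⟨_, rfl⟩⟩) (by rw [e]; exact h.1) (by rw [e]; exact h.2)

theorem disj_same (hp : p ∈ R.Vs L) (hq : q ∈ R.Vs L) (hpq : p ≠ q) (h1 : p.1 = q.1) {t t' : ℝ}
    (h : R.InI L p t) (h' : R.InI L q t') : R.F p.1 t ≠ R.F q.1 t' := by
  intro e
  rw [h1] at e
  have ht : t = t' := (R.loop _).inj _ _ (h.nn hp) (h.lt1 hp) (h'.nn hq) (h'.lt1 hq) e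
  subst ht
  obtain ⟨x, hx, ex⟩ := (R.isInt hp).att
  obtain ⟨y, hy, ey⟩ := (R.isInt hq).att
  apply hpq
  refine Prod.ext h1 ?_
  rcases le_total (R.lo L p) (R.lo L q) with hle | hle
  · have hyp : R.inP L p y := (R.isInt hp).pts y (h1 ▸ hy.1) (by rw [h1, ey]; exact hle)
      (by rw [h1, ey]; exact h'.1.trans h.2)
    rw [← hyp.2, ← hy.2, h1]
  · have hyp : R.inP L q x := (R.isInt hq).pts x (h1 ▸ hx.1) (by rw [← h1, ex]; exact hle)
      (by rw [← h1, ex]; exact h.1.trans h'.2)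
    rw [← hyp.2, ← hx.2, h1]

theorem meet_inP (hp : p ∈ R.Vs L) (hq : q ∈ R.Vs L) (h1 : p.1 ≠ q.1) {t t' : ℝ}
    (h : R.InI L p t) (h' : R.InI L q t') (e : R.F p.1 t = R.F q.1 t') :
    R.inP L p (R.F p.1 t) ∧ R.inP L q (R.F p.1 t) := by
  have hx : R.F p.1 t ∈ R.Pts := (R.mem _).2 ⟨p.1, q.1, h1, ⟨_, rfl⟩, ⟨t', e.symm⟩⟩
  refine ⟨inP_of_time hp h hx, ?_⟩
  rw [e] at hx ⊢
  exact inP_of_time hq h' hx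

variable (R) in
def Tch (i j : Fin n) : Prop := i ≠ j ∧ ∃ x, R.G i ∩ R.G j = {x}

variable (R) in
def Cross (L : ℕ) (p q : Fin n × ℕ) : Prop :=
  p.1 ≠ q.1 ∧ ¬ R.Tch p.1 q.1 ∧ ∃ x, R.inP L p x ∧ R.inP L q x

theorem uIcc_inI {s t x : ℝ} (hs : R.InI L p s) (ht : R.InI L p t) (hx : x ∈ Set.uIcc s t) : R.InI L p x := by
  rw [Set.uIcc, Set.mem_Icc] at hx
  exact ⟨(le_min hs.1 ht.1).trans hx.1, hx.2.trans (max_le hs.2 ht.2)⟩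

theorem abs_lt1 (hp : p ∈ R.Vs L) {s t : ℝ} (hs : R.InI L p s) (ht : R.InI L p t) : |s - t| < 1 := by
  have := hs.nn hp; have := hs.lt1 hp; have := ht.nn hp; have := ht.lt1 hp
  rw [abs_lt]; constructor <;> linarith

variable (R) in
/-- point z avoids the interval of the piece -/
def Av (L : ℕ) (q : Fin n × ℕ) (z : ℂ) : Prop := ∀ t, R.InI L q t → R.F q.1 t ≠ z

theorem null (hp : p ∈ R.Vs L) (hq : q ∈ R.Vs L) (hpq : p ≠ q) (hX : ¬ R.Cross L p q) {s t s' t' : ℝ}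
    (hs : R.InI L p s) (ht : R.InI L p t) (hs' : R.InI L q s') (ht' : R.InI L q t')
    (as : R.Av L q (R.F p.1 s)) (at' : R.Av L q (R.F p.1 t))
    (as' : R.Av L p (R.F q.1 s')) (at'' : R.Av L p (R.F q.1 t')) :
    (segA (R.F p.1) s t).Comp (segA (R.F q.1) s' t') := by
  by_cases h1 : p.1 = q.1
  · exact comp_disj (R.loop _).cont (R.loop _).cont fun x hx y hy =>
      disj_same hp hq hpq h1 (uIcc_inI hs ht hx) (uIcc_inI hs' ht' hy)
  by_cases hm : ∃ x, R.inP L p x ∧ R.inP L q x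
  · obtain ⟨x, hx, hx'⟩ := hm
    have hT : R.Tch p.1 q.1 := by
      by_contra hT; exact hX ⟨h1, hT, x, hx, hx'⟩
    obtain ⟨_, z, hz⟩ := hT
    have hxz : x = z := by
      have : x ∈ R.G p.1 ∩ R.G q.1 := ⟨(R.mem_on.1 hx.1).2, (R.mem_on.1 hx'.1).2⟩
      rw [hz] at this; exact this
    subst hxz
    have key : ∀ w, w ∈ R.G p.1 → w ∈ R.G q.1 → w = x := by
      intro w h h'
      have : w ∈ R.G p.1 ∩ R.G q.1 := ⟨h, h'⟩
      rw [hz] at this; exact this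
    have e1 : R.F p.1 (R.tm p.1 x) = x := (R.tm_spec (R.mem_on.1 hx.1).2).2.2
    have e2 : R.F q.1 (R.tm q.1 x) = x := (R.tm_spec (R.mem_on.1 hx'.1).2).2.2
    refine comp_touch (R.loop _) (R.loop _) (abs_lt1 hp hs ht) (abs_lt1 hq hs' ht') (x := x)
      (fun a b e => key _ ⟨a, rfl⟩ ⟨b, e.symm⟩) ?_ ?_ ?_ ?_
    · intro h
      exact as _ hx'.inI (by rw [e2]; exact (key _ ⟨_, rfl⟩ h).symm)
    · intro h
      exact at' _ hx'.inI (by rw [e2]; exact (key _ ⟨_, rfl⟩ h).symm)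
    · intro h
      exact as' _ hx.inI (by rw [e1]; exact (key _ h ⟨_, rfl⟩).symm)
    · intro h
      exact at'' _ hx.inI (by rw [e1]; exact (key _ h ⟨_, rfl⟩).symm)
  · refine comp_disj (R.loop _).cont (R.loop _).cont fun x hx y hy e => ?_
    exact hm ⟨_, meet_inP hp hq h1 (uIcc_inI hs ht hx) (uIcc_inI hs' ht' hy) e⟩

end Arr
end M3

section M3b
open Finset
open scoped Classical
namespace Arr
variable {n : ℕ} (R : Arr n)

def tp (i j : Fin n) : ℂ := if h : R.Tch i j then h.2.choose else 0

variable {R}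
theorem Tch.symm {i j : Fin n} (h : R.Tch i j) : R.Tch j i :=
  ⟨h.1.symm, by rw [Set.inter_comm]; exact h.2⟩

theorem tp_spec {i j : Fin n} (h : R.Tch i j) : R.G i ∩ R.G j = {R.tp i j} := by
  rw [tp, dif_pos h]; exact h.2.choose_spec

theorem tp_mem {i j : Fin n} (h : R.Tch i j) : R.tp i j ∈ R.G i ∧ R.tp i j ∈ R.G j := by
  have : R.tp i j ∈ R.G i ∩ R.G j := by rw [tp_spec h]; rfl
  exact this

theorem tp_unique {i j : Fin n} (h : R.Tch i j) {x : ℂ} (h1 : x ∈ R.G i) (h2 : x ∈ R.G j) : x = R.tp i j := by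
  have : x ∈ R.G i ∩ R.G j := ⟨h1, h2⟩
  rw [tp_spec h] at this; exact this

theorem tp_comm {i j : Fin n} (h : R.Tch i j) : R.tp i j = R.tp j i :=
  tp_unique h.symm (tp_mem h).2 (tp_mem h).1

variable (R) in
def HL (L : ℕ) (p q : Fin n × ℕ) : Prop :=
  R.Tch p.1 q.1 ∧ R.inP L p (R.tp p.1 q.1) ∧ R.inP L q (R.tp p.1 q.1)

variable {L : ℕ} {p q : Fin n × ℕ}

theorem HL.symm (h : R.HL L p q) : R.HL L q p :=
  ⟨h.1.symm, by rw [← tp_comm h.1]; exact h.2.2, by rw [← tp_comm h.1]; exact h.2.1⟩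

theorem HL.ne (h : R.HL L p q) : p ≠ q := fun e => h.1.1 (by rw [e])

theorem HL.ncross (h : R.HL L p q) : ¬ R.Cross L p q := fun c => c.2.1 h.1

theorem av_gen (hp : p ∈ R.Vs L) (hq : q ∈ R.Vs L) (hpq : p ≠ q) {t : ℝ} (ht : R.InI L p t)
    (hg : R.F p.1 t ∉ R.Pts) : R.Av L q (R.F p.1 t) := by
  intro s hs e
  by_cases h1 : p.1 = q.1
  · exact disj_same hp hq hpq h1 ht hs e.symm
  · exact hg ((R.mem _).2 ⟨p.1, q.1, h1, ⟨_, rfl⟩, ⟨s, e⟩⟩)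

theorem tm_tp {i j : Fin n} (h : R.Tch i j) : R.F i (R.tm i (R.tp i j)) = R.tp i j :=
  (R.tm_spec (tp_mem h).1).2.2

theorem tm_tp' {i j : Fin n} (h : R.Tch i j) : R.F j (R.tm j (R.tp i j)) = R.tp i j :=
  (R.tm_spec (tp_mem h).2).2.2

theorem av_tp {r : Fin n × ℕ} (hr : r ∈ R.Vs L) (h : R.HL L p q) (hpr : p ≠ r) (hqr : q ≠ r) :
    R.Av L r (R.tp p.1 q.1) := by
  intro s hs e
  by_cases h1 : p.1 = r.1
  · exact disj_same (R.inP_vs h.2.1) hr hpr h1 h.2.1.inI hs ((tm_tp h.1).trans e.symm)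
  by_cases h2 : q.1 = r.1
  · exact disj_same (R.inP_vs h.2.2) hr hqr h2 h.2.2.inI hs ((tm_tp' h.1).trans e.symm)
  rcases R.gp _ _ _ _ (tp_mem h.1).1 (tp_mem h.1).2 ⟨s, e⟩ with h' | h' | h'
  · exact h.1.1 h'
  · exact h1 h'
  · exact h2 h'

variable (R) in
/-- piece type -/
abbrev VT (L : ℕ) := {v // v ∈ R.Vs L}

variable (R) in
def HV (L : ℕ) (p q : R.VT L) : Prop := R.HL L p.1 q.1

variable (R) in
def clV (L : ℕ) (p q : R.VT L) : Prop := p = q ∨ R.Cross L p.1 q.1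

variable (R) in
def stt (L : ℕ) (t : R.VT L × R.VT L × R.VT L) : Fin 3 → ℝ :=
  ![R.rho L t.1.1, R.tm t.2.1.1.1 (R.tp t.1.1.1 t.2.1.1.1), R.tm t.2.2.1.1 (R.tp t.2.1.1.1 t.2.2.1.1)]

variable (R) in
def enn (L : ℕ) (t : R.VT L × R.VT L × R.VT L) : Fin 3 → ℝ :=
  ![R.tm t.1.1.1 (R.tp t.1.1.1 t.2.1.1.1), R.tm t.2.1.1.1 (R.tp t.2.1.1.1 t.2.2.1.1), R.rho L t.2.2.1]

variable (R) in
def sgm (L : ℕ) (t : R.VT L × R.VT L × R.VT L) (k : Fin 3) : Arc :=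
  segA (R.F (wpos k t).1.1) (R.stt L t k) (R.enn L t k)

variable (R) in
def wArc (L : ℕ) (t : R.VT L × R.VT L × R.VT L) : Arc :=
  (R.sgm L t 0).cat ((R.sgm L t 1).cat (R.sgm L t 2))

theorem endp {t : R.VT L × R.VT L × R.VT L} (h : isWalk (R.HV L) t) (k : Fin 3) {q : Fin n × ℕ}
    (hq : q ∈ R.Vs L) (hne : ∀ i, (wpos i t).1 ≠ q) :
    R.Av L q (R.F (wpos k t).1.1 (R.stt L t k)) ∧ R.Av L q (R.F (wpos k t).1.1 (R.enn L t k)) := by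
  obtain ⟨⟨u, hu⟩, ⟨c, hc⟩, ⟨w, hw⟩⟩ := t
  obtain ⟨h1, h2⟩ := h
  have n0 := hne 0
  have n1 := hne 1
  have n2 := hne 2
  simp only [wpos, HV] at n0 n1 n2 h1 h2
  have a1 := av_tp hq h1 n0 n1
  have a2 := av_tp hq h2 n1 n2
  have g0 := av_gen hu hq n0 (InI_rho hu) (R.isInt hu).gen
  have g2 := av_gen hw hq n2 (InI_rho hw) (R.isInt hw).gen
  fin_cases k
  · refine ⟨g0, ?_⟩
    show R.Av L q (R.F u.1 (R.tm u.1 (R.tp u.1 c.1)))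
    rw [tm_tp h1.1]; exact a1
  · show R.Av L q (R.F c.1 (R.tm c.1 (R.tp u.1 c.1))) ∧ R.Av L q (R.F c.1 (R.tm c.1 (R.tp c.1 w.1)))
    rw [tm_tp' h1.1, tm_tp h2.1]; exact ⟨a1, a2⟩
  · refine ⟨?_, g2⟩
    show R.Av L q (R.F w.1 (R.tm w.1 (R.tp c.1 w.1)))
    rw [tm_tp' h2.1]; exact a2

theorem endI {t : R.VT L × R.VT L × R.VT L} (h : isWalk (R.HV L) t) (k : Fin 3) :
    R.InI L (wpos k t).1 (R.stt L t k) ∧ R.InI L (wpos k t).1 (R.enn L t k) := by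
  obtain ⟨⟨u, hu⟩, ⟨c, hc⟩, ⟨w, hw⟩⟩ := t
  obtain ⟨h1, h2⟩ := h
  simp only [HV] at h1 h2
  fin_cases k
  · exact ⟨InI_rho hu, h1.2.1.inI⟩
  · exact ⟨h1.2.2.inI, h2.2.1.inI⟩
  · exact ⟨h2.2.2.inI, InI_rho hw⟩

theorem join {t : R.VT L × R.VT L × R.VT L} (h : isWalk (R.HV L) t) :
    (R.sgm L t 0).q = ((R.sgm L t 1).cat (R.sgm L t 2)).p ∧ (R.sgm L t 1).q = (R.sgm L t 2).p := by
  obtain ⟨⟨u, hu⟩, ⟨c, hc⟩, ⟨w, hw⟩⟩ := t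
  obtain ⟨h1, h2⟩ := h
  simp only [HV] at h1 h2
  constructor
  · show R.F u.1 (R.tm u.1 (R.tp u.1 c.1)) = R.F c.1 (R.tm c.1 (R.tp u.1 c.1))
    rw [tm_tp h1.1, tm_tp' h1.1]
  · show R.F c.1 (R.tm c.1 (R.tp c.1 w.1)) = R.F w.1 (R.tm w.1 (R.tp c.1 w.1))
    rw [tm_tp h2.1, tm_tp' h2.1]

theorem wArc_comp {t t' : R.VT L × R.VT L × R.VT L} (h : isWalk (R.HV L) t) (h' : isWalk (R.HV L) t')
    (hn : ¬ wConf (R.clV L) t t') : (R.wArc L t).Comp (R.wArc L t') := by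
  have hne : ∀ i j, (wpos i t).1 ≠ (wpos j t').1 := fun i j e => hn ⟨i, j, Or.inl (Subtype.ext e)⟩
  have key : ∀ k k', (R.sgm L t k).Comp (R.sgm L t' k') := by
    intro k k'
    have e := endp h k (wpos k' t').2 (fun i => hne i k')
    have e' := endp h' k' (wpos k t).2 (fun i => (hne k i).symm)
    exact null (wpos k t).2 (wpos k' t').2 (hne k k') (fun c => hn ⟨k, k', Or.inr c⟩)
      (endI h k).1 (endI h k).2 (endI h' k').1 (endI h' k').2 e.1 e.2 e'.1 e'.2
  have row : ∀ k, (R.sgm L t k).Comp (R.wArc L t') := fun k =>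
    (key k 0).catr ((key k 1).catr (key k 2) (join h').2) (join h').1
  exact (row 0).cat ((row 1).cat (row 2) (join h).2) (join h).1

theorem wArc_p (t : R.VT L × R.VT L × R.VT L) : (R.wArc L t).p = R.F t.1.1.1 (R.rho L t.1.1) := rfl
theorem wArc_q (t : R.VT L × R.VT L × R.VT L) : (R.wArc L t).q = R.F t.2.2.1.1 (R.rho L t.2.2.1) := rfl

/-! counting -/
theorem nbr_cnt (p : R.VT L) (l k : ℕ) (hl : 0 < l) :
    (univ.filter fun q : R.VT L => R.HV L p q ∧ R.idx p.1.1 (R.tp p.1.1 q.1.1) / l = k).card ≤ l := by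
  refine le_trans ?_ (R.cnt p.1.1 l k hl)
  refine card_le_card_of_injOn (fun q => R.tp p.1.1 q.1.1) ?_ ?_
  · intro q hq
    simp only [coe_filter, mem_univ, true_and, Set.mem_ofPred_eq] at hq ⊢
    exact ⟨hq.1.2.1.1, hq.2⟩
  · intro q hq q' hq' e
    simp only [coe_filter, mem_univ, true_and, Set.mem_ofPred_eq] at hq hq' e
    have h1 := hq.1
    have h2 := hq'.1
    unfold HV HL at h1 h2
    rw [← e] at h2
    have hc : q.1.1 = q'.1.1 := by
      rcases R.gp _ _ _ _ (tp_mem h1.1).1 (R.mem_on.1 h1.2.2.1).2 (R.mem_on.1 h2.2.2.1).2 with h | h | h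
      · exact absurd h h1.1.1
      · exact absurd h h2.1.1
      · exact h
    apply Subtype.ext
    refine Prod.ext hc ?_
    rw [← h1.2.2.2, ← h2.2.2.2, hc]

theorem deg_le (hL : 0 < L) (p : R.VT L) : (nbr (R.HV L) p).card ≤ L := by
  refine le_trans (card_le_card fun q hq => ?_) (nbr_cnt p L p.1.2 hL)
  simp only [nbr, mem_filter, mem_univ, true_and] at hq ⊢
  exact ⟨hq, hq.2.1.2⟩

theorem sum_deg : ∑ v, (nbr (R.HV L) v).card = (univ.filter fun x : Fin n × Fin n => R.Tch x.1 x.2).card := by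
  rw [← card_sigma]
  refine card_bij (fun x _ => (x.1.1.1, x.2.1.1)) ?_ ?_ ?_
  · rintro ⟨p, q⟩ h
    simp only [mem_sigma, mem_univ, true_and, nbr, mem_filter] at h ⊢
    exact h.1
  · rintro ⟨p, q⟩ h ⟨p', q'⟩ h' e
    simp only [mem_sigma, mem_univ, true_and, nbr, mem_filter] at h h'
    unfold HV HL at h h'
    simp only [Prod.mk.injEq] at e
    rw [← e.1, ← e.2] at h'
    have hp : p = p' := by
      apply Subtype.ext
      refine Prod.ext e.1 ?_
      rw [← h.2.1.2, ← h'.2.1.2, e.1]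
    have hq : q = q' := by
      apply Subtype.ext
      refine Prod.ext e.2 ?_
      rw [← h.2.2.2, ← h'.2.2.2, e.2]
    subst hp hq
    rfl
  · rintro ⟨i, j⟩ h
    simp only [mem_filter, mem_univ, true_and] at h
    have m := tp_mem h
    have m1 : R.tp i j ∈ R.on i := R.on_of h.1 m.1 m.2
    have m2 : R.tp i j ∈ R.on j := R.on_of h.1.symm m.2 m.1
    have v1 : R.inP L (i, R.idx i (R.tp i j) / L) (R.tp i j) := ⟨m1, rfl⟩
    have v2 : R.inP L (j, R.idx j (R.tp i j) / L) (R.tp i j) := ⟨m2, rfl⟩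
    refine ⟨⟨⟨_, R.inP_vs v1⟩, ⟨_, R.inP_vs v2⟩⟩, ?_, rfl⟩
    simp only [mem_sigma, mem_univ, true_and, nbr, mem_filter]
    exact ⟨h, v1, v2⟩

theorem inc_card : R.inc.card ≤ 2 * R.Pts.card := by
  have h := card_eq_sum_card_fiberwise (s := R.inc) (t := R.Pts) (f := fun p => p.2) (fun p hp => by
    exact (R.mem_on.1 (R.mem_inc.1 hp)).1)
  rw [h, mul_comm, ← smul_eq_mul, ← sum_const]
  refine sum_le_sum fun x _ => ?_
  by_contra hc
  push Not at hc
  rw [two_lt_card_iff] at hc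
  obtain ⟨a, b, c, ha, hb, hc, hab, hac, hbc⟩ := hc
  simp only [mem_filter, mem_inc, mem_on] at ha hb hc
  rcases R.gp x a.1 b.1 c.1 (ha.2 ▸ ha.1.2) (hb.2 ▸ hb.1.2) (hc.2 ▸ hc.1.2) with h | h | h
  · exact hab (Prod.ext h (ha.2.trans hb.2.symm))
  · exact hac (Prod.ext h (ha.2.trans hc.2.symm))
  · exact hbc (Prod.ext h (hb.2.trans hc.2.symm))

theorem sum_on : ∑ i, (R.on i).card = R.inc.card := by
  rw [← card_sigma]
  refine card_nbij' (fun x => (x.1, x.2)) (fun x => ⟨x.1, x.2⟩) ?_ ?_ ?_ ?_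
  · rintro ⟨i, x⟩ h; simpa [mem_inc] using h
  · rintro ⟨i, x⟩ h; simpa [mem_inc] using h
  · intro p _; rfl
  · intro p _; rfl

theorem vs_card (hL : 0 < L) : Fintype.card (R.VT L) * L ≤ 2 * R.Pts.card + n * L := by
  rw [Fintype.card_coe]
  have h1 : (R.Vs L).card ≤ ∑ i, ((R.on i).card / L + 1) := by
    have : ∑ i, ((R.on i).card / L + 1) = ((univ : Finset (Fin n)).sigma fun i => range ((R.on i).card / L + 1)).card := by
      rw [card_sigma]; simp
    rw [this]
    refine card_le_card_of_injOn (fun v => ⟨v.1, v.2⟩) ?_ ?_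
    · intro v hv
      obtain ⟨x, hx⟩ := R.vs_ne hv
      simp only [coe_sigma, Set.mem_sigma_iff, mem_coe, mem_univ, true_and, mem_range]
      rw [← hx.2]
      exact Nat.lt_succ_of_le (Nat.div_le_div_right (R.idx_lt_card hx.1).le)
    · rintro ⟨a, b⟩ _ ⟨a', b'⟩ _ h
      simp only [Sigma.mk.injEq, heq_eq_eq] at h
      exact Prod.ext h.1 h.2
  calc (R.Vs L).card * L ≤ (∑ i, ((R.on i).card / L + 1)) * L := by gcongr
    _ = ∑ i, ((R.on i).card / L * L + L) := by rw [sum_mul]; simp_rw [add_mul, one_mul]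
    _ ≤ ∑ i, ((R.on i).card + L) := sum_le_sum fun i _ => by gcongr; exact Nat.div_mul_le_self _ _
    _ = R.inc.card + n * L := by rw [sum_add_distrib, sum_on]; simp
    _ ≤ _ := by gcongr; exact inc_card

variable (R) in
/-- ordered double incidences -/
def inc2 : Finset (Fin n × Fin n × ℂ) :=
  (univ ×ˢ univ ×ˢ R.Pts).filter fun y => y.1 ≠ y.2.1 ∧ y.2.2 ∈ R.on y.1 ∧ y.2.2 ∈ R.on y.2.1

theorem mem_inc2 {y : Fin n × Fin n × ℂ} : y ∈ R.inc2 ↔ y.1 ≠ y.2.1 ∧ y.2.2 ∈ R.on y.1 ∧ y.2.2 ∈ R.on y.2.1 := by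
  simp only [inc2, mem_filter, mem_product, mem_univ, true_and, and_iff_right_iff_imp]
  intro h
  exact (R.mem_on.1 h.2.1).1

theorem inc2_card : R.inc2.card ≤ 2 * R.Pts.card := by
  refine le_trans ?_ inc_card
  refine card_le_card_of_injOn (fun y => (y.1, y.2.2)) ?_ ?_
  · intro y hy
    exact R.mem_inc.2 (mem_inc2.1 hy).2.1
  · rintro ⟨i, j, x⟩ h ⟨i', j', x'⟩ h' e
    simp only [Prod.mk.injEq] at e
    obtain ⟨rfl, rfl⟩ := e
    rw [mem_coe, mem_inc2] at h h'
    simp only at h h'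
    rcases R.gp x i j j' (R.mem_on.1 h.2.1).2 (R.mem_on.1 h.2.2).2 (R.mem_on.1 h'.2.2).2 with e | e | e
    · exact absurd e h.1
    · exact absurd e h'.1
    · rw [e]

variable (R) in
def psi (l : ℕ) (y : Fin n × Fin n × ℂ) : (Fin n × ℕ) × (Fin n × ℕ) :=
  ((y.1, R.idx y.1 y.2.2 / l), (y.2.1, R.idx y.2.1 y.2.2 / l))

variable (R) in
def Phi (l : ℕ) : ℕ := (R.inc2.image (R.psi l)).card

theorem cross_card : (univ.filter fun x : R.VT L × R.VT L => R.clV L x.1 x.2).card ≤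
    2 * R.Pts.card + Fintype.card (R.VT L) := by
  have : (univ.filter fun x : R.VT L × R.VT L => R.clV L x.1 x.2) ⊆
      (univ.filter fun x : R.VT L × R.VT L => R.Cross L x.1.1 x.2.1) ∪ univ.image fun v => (v, v) := by
    rintro ⟨a, b⟩ h
    simp only [mem_filter, mem_univ, true_and, mem_union, mem_image] at h ⊢
    unfold clV at h
    rcases h with h | h
    · exact Or.inr ⟨a, by rw [h]⟩
    · exact Or.inl h
  refine (card_le_card this).trans ((card_union_le _ _).trans (add_le_add ?_ ?_))
  · refine le_trans ?_ inc2_card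
    refine le_trans ?_ (card_image_le (s := R.inc2) (f := R.psi L))
    refine card_le_card_of_injOn (fun x => (x.1.1, x.2.1)) ?_ ?_
    · rintro ⟨a, b⟩ h
      simp only [coe_filter, mem_univ, true_and, Set.mem_ofPred_eq] at h
      obtain ⟨h1, _, x, hx, hx'⟩ := h
      rw [mem_coe, mem_image]
      refine ⟨(a.1.1, b.1.1, x), mem_inc2.2 ⟨h1, hx.1, hx'.1⟩, ?_⟩
      exact Prod.ext (Prod.ext rfl hx.2) (Prod.ext rfl hx'.2)
    · rintro ⟨a, b⟩ _ ⟨a', b'⟩ _ h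
      simp only [Prod.mk.injEq] at h
      exact Prod.ext (Subtype.ext h.1) (Subtype.ext h.2)
  · refine card_image_le.trans ?_
    rw [card_univ]

variable (R) in
def Bad (L l : ℕ) (p q : Fin n × ℕ) : Prop :=
  p.1 ≠ q.1 ∧ ∃ x x', R.inP L p x ∧ R.inP L q x ∧ R.inP L p x' ∧ R.inP L q x' ∧
    (R.idx p.1 x / l ≠ R.idx p.1 x' / l ∨ R.idx q.1 x / l ≠ R.idx q.1 x' / l)

theorem fib_lemma {α β : Type*} [DecidableEq β] (S : Finset α) (π : α → β) (B : Finset β)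
    (hB : ∀ b ∈ B, ∃ x ∈ S, ∃ y ∈ S, x ≠ y ∧ π x = b ∧ π y = b) :
    B.card + (S.image π).card ≤ S.card := by
  have hsub : B ⊆ S.image π := fun b hb => by
    obtain ⟨x, hx, _, _, _, e, _⟩ := hB b hb
    exact mem_image.2 ⟨x, hx, e⟩
  rw [card_eq_sum_card_image π S]
  have : B.card + (S.image π).card = ∑ b ∈ S.image π, ((if b ∈ B then 1 else 0) + 1) := by
    rw [sum_add_distrib, sum_const, smul_eq_mul, mul_one, sum_ite_mem, inter_eq_right.2 hsub]
    simp
  rw [this]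
  refine sum_le_sum fun b hb => ?_
  split_ifs with h
  · obtain ⟨x, hx, y, hy, hxy, e1, e2⟩ := hB b h
    exact Finset.one_lt_card.2 ⟨x, by simp [hx, e1], y, by simp [hy, e2], hxy⟩
  · obtain ⟨x, hx, e⟩ := mem_image.1 hb
    exact Finset.card_pos.2 ⟨x, by simp [hx, e]⟩

theorem bad_card {l d : ℕ} (hL : L = l * d) :
    (univ.filter fun x : R.VT L × R.VT L => R.Bad L l x.1.1 x.2.1).card + R.Phi L ≤ R.Phi l := by
  let π : (Fin n × ℕ) × (Fin n × ℕ) → (Fin n × ℕ) × (Fin n × ℕ) := fun z =>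
    ((z.1.1, z.1.2 / d), (z.2.1, z.2.2 / d))
  have hπ : ∀ y, π (R.psi l y) = R.psi L y := by
    intro y
    simp only [π, psi, Nat.div_div_eq_div_mul, hL]
  have him : R.inc2.image (R.psi L) = (R.inc2.image (R.psi l)).image π := by
    rw [image_image]
    refine image_congr fun y _ => (hπ y).symm
  have h := fib_lemma (R.inc2.image (R.psi l)) π
    ((univ.filter fun x : R.VT L × R.VT L => R.Bad L l x.1.1 x.2.1).image fun x => (x.1.1, x.2.1)) (by
      intro b hb
      simp only [mem_image, mem_filter, mem_univ, true_and] at hb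
      obtain ⟨⟨p, q⟩, ⟨h1, x, x', hp, hq, hp', hq', hne⟩, rfl⟩ := hb
      have i1 : (p.1.1, q.1.1, x) ∈ R.inc2 := mem_inc2.2 ⟨h1, hp.1, hq.1⟩
      have i2 : (p.1.1, q.1.1, x') ∈ R.inc2 := mem_inc2.2 ⟨h1, hp'.1, hq'.1⟩
      refine ⟨_, mem_image_of_mem _ i1, _, mem_image_of_mem _ i2, ?_, ?_, ?_⟩
      · intro e
        simp only [psi, Prod.mk.injEq, true_and] at e
        rcases hne with h | h
        · exact h e.1
        · exact h e.2
      · rw [hπ]; exact Prod.ext (Prod.ext rfl hp.2) (Prod.ext rfl hq.2)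
      · rw [hπ]; exact Prod.ext (Prod.ext rfl hp'.2) (Prod.ext rfl hq'.2))
  rw [← him, card_image_of_injOn] at h
  · exact h
  · rintro ⟨a, b⟩ _ ⟨a', b'⟩ _ h
    simp only [Prod.mk.injEq] at h
    exact Prod.ext (Subtype.ext h.1) (Subtype.ext h.2)

theorem exists_level (d r : ℕ) (hr : 0 < r) : ∃ k < r,
    r * (univ.filter fun x : R.VT (d ^ (k + 1)) × R.VT (d ^ (k + 1)) =>
      R.Bad (d ^ (k + 1)) (d ^ k) x.1.1 x.2.1).card ≤ 2 * R.Pts.card := by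
  by_contra hc
  push Not at hc
  set b : ℕ → ℕ := fun k => (univ.filter fun x : R.VT (d ^ (k + 1)) × R.VT (d ^ (k + 1)) =>
      R.Bad (d ^ (k + 1)) (d ^ k) x.1.1 x.2.1).card with hb
  have h1 : ∀ m, ∑ k ∈ range m, b k + R.Phi (d ^ m) ≤ R.Phi (d ^ 0) := by
    intro m
    induction m with
    | zero => simp
    | succ m ih =>
      rw [sum_range_succ]
      have := bad_card (R := R) (L := d ^ (m + 1)) (l := d ^ m) (d := d) (pow_succ _ _)
      have e : b m + R.Phi (d ^ (m + 1)) ≤ R.Phi (d ^ m) := this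
      omega
  have h2 : R.Phi (d ^ 0) ≤ 2 * R.Pts.card := card_image_le.trans inc2_card
  have h3 := h1 r
  have h4 : r * (2 * R.Pts.card + 1) ≤ ∑ k ∈ range r, r * b k := by
    rw [← smul_eq_mul]
    conv_lhs => rw [← card_range r]
    rw [← sum_const]
    exact sum_le_sum fun k hk => hc k (mem_range.1 hk)
  rw [← mul_sum] at h4
  have := Nat.le_of_mul_le_mul_left h4 hr
  omega

end Arr
end M3b

section M7
open Finset
open scoped Classical

theorem mono_sub {α : Type*} [LinearOrder α] (f : α → ℕ) : ∀ (m a b : ℕ), a + b = m → ∀ S : Finset α,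
    2 ^ m ≤ S.card → Set.InjOn f S →
    (∃ T ⊆ S, T.card = a ∧ StrictMonoOn f T) ∨ (∃ T ⊆ S, T.card = b ∧ StrictAntiOn f T) := by
  intro m
  induction m with
  | zero =>
    intro a b h S _ _
    exact Or.inl ⟨∅, empty_subset _, by simp; omega, by intro x hx; simp at hx⟩
  | succ m ih =>
    intro a b hab S hS hf
    rcases Nat.eq_zero_or_pos a with rfl | ha
    · exact Or.inl ⟨∅, empty_subset _, by simp, by intro x hx; simp at hx⟩
    rcases Nat.eq_zero_or_pos b with rfl | hb
    · exact Or.inr ⟨∅, empty_subset _, by simp, by intro x hx; simp at hx⟩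
    have hne : S.Nonempty := by
      rw [← Finset.card_pos]; exact lt_of_lt_of_le (by positivity) hS
    set x := S.min' hne with hx
    have hxS : x ∈ S := S.min'_mem hne
    set S1 := (S.erase x).filter fun y => f x < f y with h1
    set S2 := (S.erase x).filter fun y => ¬ f x < f y with h2
    have hc : S1.card + S2.card = S.card - 1 := by
      rw [h1, h2, card_filter_add_card_filter_not, card_erase_of_mem hxS]
    have hlt : ∀ y ∈ S.erase x, x < y := fun y hy =>
      lt_of_le_of_ne (S.min'_le y (mem_of_mem_erase hy)) (ne_of_mem_erase hy).symm
    have s1 : S1 ⊆ S := (filter_subset _ _).trans (erase_subset _ _)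
    have s2 : S2 ⊆ S := (filter_subset _ _).trans (erase_subset _ _)
    have hbig : 2 ^ m ≤ S1.card ∨ 2 ^ m ≤ S2.card ∨ m = 0 := by
      rw [pow_succ] at hS
      rcases Nat.eq_zero_or_pos m with h | h
      · exact Or.inr (Or.inr h)
      · have : 2 ∣ 2 ^ m := dvd_pow_self 2 h.ne'
        omega
    have hsub1 : S1 ⊆ S.erase x := filter_subset _ _
    have hsub2 : S2 ⊆ S.erase x := filter_subset _ _
    rcases hbig with hb1 | hb2 | h0
    · rcases ih (a - 1) b (by omega) S1 hb1 (hf.mono (by exact_mod_cast s1)) with ⟨T, hT, hTc, hm⟩ | ⟨T, hT, hTc, hm⟩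
      · left
        have hxT : x ∉ T := fun h => (notMem_erase x S) (hsub1 (hT h))
        refine ⟨insert x T, insert_subset hxS (hT.trans s1), by rw [card_insert_of_notMem hxT]; omega, ?_⟩
        intro y hy z hz hyz
        simp only [coe_insert, Set.mem_insert_iff, mem_coe] at hy hz
        rcases hy with rfl | hy
        · rcases hz with rfl | hz
          · exact absurd hyz (lt_irrefl _)
          · exact (mem_filter.1 (hT hz)).2
        · rcases hz with rfl | hz
          · exact absurd hyz (hlt _ (hsub1 (hT hy))).not_gt
          · exact hm hy hz hyz
      · exact Or.inr ⟨T, hT.trans s1, hTc, hm⟩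
    · rcases ih a (b - 1) (by omega) S2 hb2 (hf.mono (by exact_mod_cast s2)) with ⟨T, hT, hTc, hm⟩ | ⟨T, hT, hTc, hm⟩
      · exact Or.inl ⟨T, hT.trans s2, hTc, hm⟩
      · right
        have hxT : x ∉ T := fun h => (notMem_erase x S) (hsub2 (hT h))
        refine ⟨insert x T, insert_subset hxS (hT.trans s2), by rw [card_insert_of_notMem hxT]; omega, ?_⟩
        intro y hy z hz hyz
        simp only [coe_insert, Set.mem_insert_iff, mem_coe] at hy hz
        rcases hy with rfl | hy
        · rcases hz with rfl | hz
          · exact absurd hyz (lt_irrefl _)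
          · have h3 := (mem_filter.1 (hT hz)).2
            refine lt_of_le_of_ne (not_lt.1 h3) fun e => ?_
            have := hf (s2 (hT hz)) hxS e
            exact hyz.ne' this
        · rcases hz with rfl | hz
          · exact absurd hyz (hlt _ (hsub2 (hT hy))).not_gt
          · exact hm hy hz hyz
    · omega

theorem mono_multi (m k : ℕ) : ∃ N, ∀ {α : Type} [LinearOrder α] (f : Fin m → α → ℕ) (S : Finset α),
    N ≤ S.card → (∀ i, Function.Injective (f i)) →
    ∃ T ⊆ S, T.card = k ∧ ∀ i, StrictMonoOn (f i) T ∨ StrictAntiOn (f i) T := by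
  induction m with
  | zero =>
    refine ⟨k, fun f S hS _ => ?_⟩
    obtain ⟨T, hT, hc⟩ := exists_subset_card_eq hS
    exact ⟨T, hT, hc, fun i => i.elim0⟩
  | succ m ih =>
    obtain ⟨N, hN⟩ := ih
    refine ⟨2 ^ (N + N), ?_⟩
    intro α _ f S hS hf
    have : ∃ T ⊆ S, T.card = N ∧ (StrictMonoOn (f 0) T ∨ StrictAntiOn (f 0) T) := by
      rcases mono_sub (f 0) (N + N) N N rfl S hS (hf 0).injOn with ⟨T, h1, h2, h3⟩ | ⟨T, h1, h2, h3⟩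
      · exact ⟨T, h1, h2, Or.inl h3⟩
      · exact ⟨T, h1, h2, Or.inr h3⟩
    obtain ⟨T, hT, hTc, h0⟩ := this
    obtain ⟨T', hT', hc', h'⟩ := hN (fun i => f i.succ) T hTc.ge (fun i => hf _)
    refine ⟨T', hT'.trans hT, hc', fun i => ?_⟩
    refine Fin.cases ?_ (fun j => h' j) i
    have hs : (T' : Set α) ⊆ (T : Set α) := by exact_mod_cast hT'
    rcases h0 with h | h
    · exact Or.inl (h.mono hs)
    · exact Or.inr (h.mono hs)

/-- triples are separated -/
def SepT {α : Type*} (f : α → ℕ) (A B : Fin 3 → α) : Prop :=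
  (∀ k k', f (A k) < f (B k')) ∨ (∀ k k', f (B k) < f (A k'))

theorem ramsey : ∃ N, 0 < N ∧ ∀ (ca : Fin 21 → Fin N → ℕ) (cb : Fin N → Fin 21 → ℕ),
    (∀ i, Function.Injective (ca i)) → (∀ j, Function.Injective (cb j)) →
    ∃ (P : Fin 7 → Fin 3 → Fin 21) (Q : Fin 7 → Fin 3 → Fin N),
      (∀ x, Function.Injective (P x)) ∧ (∀ y, Function.Injective (Q y)) ∧
      (∀ i y y', y ≠ y' → SepT (ca i) (Q y) (Q y')) ∧
      (∀ y k x x', x ≠ x' → SepT (cb (Q y k)) (P x) (P x')) := by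
  obtain ⟨N1, hN1⟩ := mono_multi 21 21
  set Z := Fintype.card (Fin 21 → Fin 21 → Bool) with hZ
  refine ⟨Z * N1 + 1, Nat.succ_pos _, fun ca cb ha hb => ?_⟩
  let pat : Fin (Z * N1 + 1) → (Fin 21 → Fin 21 → Bool) := fun j i i' => decide (cb j i < cb j i')
  obtain ⟨w, -, hw⟩ := exists_le_card_fiber_of_mul_le_card_of_maps_to (s := univ) (t := univ) (f := pat)
    (n := N1) (fun _ _ => mem_univ _) univ_nonempty (by
      rw [card_univ, card_univ, Fintype.card_fin, ← hZ]; omega)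
  obtain ⟨T, hT, hTc, hmon⟩ := hN1 ca _ hw ha
  let e := T.orderEmbOfFin hTc
  have heT : ∀ k, e k ∈ T := fun k => T.orderEmbOfFin_mem hTc k
  let g : Fin 7 → Fin 3 → Fin 21 := fun x k => finProdFinEquiv (x, k)
  have hg : ∀ x x' k k', x < x' → g x k < g x' k' := by
    intro x x' k k' h
    rw [Fin.lt_def] at h ⊢
    simp only [g, finProdFinEquiv_apply_val]
    have := k.2
    omega
  have hginj : ∀ x, Function.Injective (g x) := fun x k k' h => by
    have := finProdFinEquiv.injective h
    exact (Prod.mk.inj this).2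
  let b0 := e 0
  let σ := Tuple.sort (cb b0)
  have hσ : StrictMono (cb b0 ∘ σ) :=
    (Tuple.monotone_sort (cb b0)).strictMono_of_injective ((hb b0).comp σ.injective)
  have hpat : ∀ k i i', cb (e k) i < cb (e k) i' ↔ cb b0 i < cb b0 i' := by
    intro k i i'
    have h1 : pat (e k) = w := (mem_filter.1 (hT (heT k))).2
    have h2 : pat b0 = w := (mem_filter.1 (hT (heT 0))).2
    have h3 := congrFun (congrFun (h1.trans h2.symm) i) i'
    simpa [pat] using h3
  refine ⟨fun x k => σ (g x k), fun y k => e (g y k), fun x => σ.injective.comp (hginj x),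
    fun y => e.injective.comp (hginj y), ?_, ?_⟩
  · intro i y y' hy
    rcases hmon i with h | h <;> rcases lt_or_gt_of_ne hy with hl | hl
    · exact Or.inl fun k k' => h (heT _) (heT _) (e.strictMono (hg _ _ _ _ hl))
    · exact Or.inr fun k k' => h (heT _) (heT _) (e.strictMono (hg _ _ _ _ hl))
    · exact Or.inr fun k k' => h (heT _) (heT _) (e.strictMono (hg _ _ _ _ hl))
    · exact Or.inl fun k k' => h (heT _) (heT _) (e.strictMono (hg _ _ _ _ hl))
  · intro y k x x' hx
    rcases lt_or_gt_of_ne hx with hl | hl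
    · exact Or.inl fun i i' => (hpat _ _ _).2 (hσ (hg _ _ _ _ hl))
    · exact Or.inr fun i i' => (hpat _ _ _).2 (hσ (hg _ _ _ _ hl))

theorem pigeon49 (A B : Fin 7 → Fin 3 → Fin 7 → Prop)
    (h : ∀ x y, (∃ c, A x c y) ∨ (∃ c, B y c x))
    (hA : ∀ x c y y', A x c y → A x c y' → y = y')
    (hB : ∀ x c y y', B x c y → B x c y' → y = y') : False := by
  have : ∀ z : Fin 7 × Fin 7, ∃ s : (Fin 7 × Fin 3) ⊕ (Fin 7 × Fin 3),
      (∀ x c, s = Sum.inl (x, c) → x = z.1 ∧ A x c z.2) ∧ (∀ y c, s = Sum.inr (y, c) → y = z.2 ∧ B y c z.1) := by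
    intro z
    rcases h z.1 z.2 with ⟨c, hc⟩ | ⟨c, hc⟩
    · refine ⟨Sum.inl (z.1, c), ?_, ?_⟩
      · intro x c' e
        simp only [Sum.inl.injEq, Prod.mk.injEq] at e
        obtain ⟨rfl, rfl⟩ := e
        exact ⟨rfl, hc⟩
      · intro y c' e; cases e
    · refine ⟨Sum.inr (z.2, c), ?_, ?_⟩
      · intro y c' e; cases e
      · intro x c' e
        simp only [Sum.inr.injEq, Prod.mk.injEq] at e
        obtain ⟨rfl, rfl⟩ := e
        exact ⟨rfl, hc⟩
  choose f hf using this
  have hinj : Function.Injective f := by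
    intro z z' e
    rcases hz : f z with ⟨x, c⟩ | ⟨y, c⟩
    · have h1 := (hf z).1 x c hz
      have h2 := (hf z').1 x c (e ▸ hz)
      exact Prod.ext (h1.1.symm.trans h2.1) (hA _ _ _ _ h1.2 h2.2)
    · have h1 := (hf z).2 y c hz
      have h2 := (hf z').2 y c (e ▸ hz)
      exact Prod.ext (hB _ _ _ _ h1.2 h2.2) (h1.1.symm.trans h2.1)
  have := Fintype.card_le_of_injective f hinj
  simp at this
end M7

section M7b
open Finset
open scoped Classical
namespace Arr
variable {n : ℕ} {R : Arr n} {L l : ℕ}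

variable (R) in
def ch (l : ℕ) (p q : Fin n × ℕ) : ℕ := R.idx p.1 (R.tp p.1 q.1) / l

variable (R) in
def tt (p q : Fin n × ℕ) : ℝ := R.tm p.1 (R.tp p.1 q.1)

variable (R) in
def Span (p : Fin n × ℕ) (Q : Fin 3 → Fin n × ℕ) (t : ℝ) : Prop :=
  (∃ k, R.tt p (Q k) ≤ t) ∧ (∃ k, t ≤ R.tt p (Q k))

variable (R) in
def Meet (p p' : Fin n × ℕ) (Q : Fin 3 → Fin n × ℕ) : Prop :=
  ∃ t t', R.Span p Q t ∧ R.Span p' Q t' ∧ R.F p.1 t = R.F p'.1 t'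

theorem HL.ttI {p q : Fin n × ℕ} (h : R.HL L p q) : R.InI L p (R.tt p q) := h.2.1.inI

theorem Span.inI {p : Fin n × ℕ} {Q : Fin 3 → Fin n × ℕ} {t : ℝ} (hH : ∀ k, R.HL L p (Q k))
    (h : R.Span p Q t) : R.InI L p t := by
  obtain ⟨⟨k, hk⟩, ⟨k', hk'⟩⟩ := h
  exact ⟨(hH k).ttI.1.trans hk, hk'.trans (hH k').ttI.2⟩

theorem Span.uIcc {p : Fin n × ℕ} {Q : Fin 3 → Fin n × ℕ} {s t x : ℝ}
    (hs : R.Span p Q s) (ht : R.Span p Q t) (hx : x ∈ Set.uIcc s t) : R.Span p Q x := by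
  rw [Set.uIcc, Set.mem_Icc] at hx
  obtain ⟨⟨a, ha⟩, ⟨b, hb⟩⟩ := hs
  obtain ⟨⟨c, hc⟩, ⟨d, hd⟩⟩ := ht
  constructor
  · rcases le_total s t with h | h
    · rw [min_eq_left h] at hx; exact ⟨a, ha.trans hx.1⟩
    · rw [min_eq_right h] at hx; exact ⟨c, hc.trans hx.1⟩
  · rcases le_total s t with h | h
    · rw [max_eq_right h] at hx; exact ⟨d, hx.2.trans hd⟩
    · rw [max_eq_left h] at hx; exact ⟨b, hx.2.trans hb⟩

theorem span_tt (p : Fin n × ℕ) (Q : Fin 3 → Fin n × ℕ) (k : Fin 3) : R.Span p Q (R.tt p (Q k)) :=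
  ⟨⟨k, le_rfl⟩, ⟨k, le_rfl⟩⟩

theorem span_idx {p : Fin n × ℕ} {Q : Fin 3 → Fin n × ℕ} {t : ℝ} (hp : p ∈ R.Vs L) (hH : ∀ k, R.HL L p (Q k))
    (h : R.Span p Q t) : (∃ k, R.ch l p (Q k) ≤ R.idx p.1 (R.F p.1 t) / l) ∧
      (∃ k, R.idx p.1 (R.F p.1 t) / l ≤ R.ch l p (Q k)) := by
  have hI := h.inI hH
  have e := R.tm_eq (i := p.1) (hI.nn hp) (hI.lt1 hp)
  obtain ⟨⟨k, hk⟩, ⟨k', hk'⟩⟩ := h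
  exact ⟨⟨k, Nat.div_le_div_right (R.idx_mono (by rw [e]; exact hk))⟩,
    ⟨k', Nat.div_le_div_right (R.idx_mono (by rw [e]; exact hk'))⟩⟩

theorem meet_unique {p p' : Fin n × ℕ} {Q Q' : Fin 3 → Fin n × ℕ} (hpp : p ≠ p') (hp : p ∈ R.Vs L)
    (hp' : p' ∈ R.Vs L)
    (hb : ¬ R.Bad L l p p') (h1 : ∀ k, R.HL L p (Q k)) (h2 : ∀ k, R.HL L p (Q' k))
    (h3 : ∀ k, R.HL L p' (Q k)) (h4 : ∀ k, R.HL L p' (Q' k))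
    (hs : SepT (R.ch l p) Q Q') (m : R.Meet p p' Q) (m' : R.Meet p p' Q') : False := by
  obtain ⟨t, t', ht, ht', e⟩ := m
  obtain ⟨s, s', hs1, hs', e'⟩ := m'
  by_cases h : p.1 = p'.1
  · exact disj_same hp hp' hpp h (ht.inI h1) (ht'.inI h3) e
  have x1 := meet_inP hp hp' h (ht.inI h1) (ht'.inI h3) e
  have x2 := meet_inP hp hp' h (hs1.inI h2) (hs'.inI h4) e'
  obtain ⟨⟨k1, hk1⟩, ⟨k2, hk2⟩⟩ := span_idx (l := l) hp h1 ht
  obtain ⟨⟨k3, hk3⟩, ⟨k4, hk4⟩⟩ := span_idx (l := l) hp h2 hs1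
  refine hb ⟨h, _, _, x1.1, x1.2, x2.1, x2.2, Or.inl ?_⟩
  rcases hs with hs | hs
  · have := hs k2 k3; omega
  · have := hs k4 k1; omega

theorem exists_gen {p : Fin n × ℕ} {Q : Fin 3 → Fin n × ℕ} (hp : p ∈ R.Vs L) (hH : ∀ k, R.HL L p (Q k))
    (hi : Function.Injective fun k => R.ch l p (Q k)) : ∃ t, R.Span p Q t ∧ R.F p.1 t ∉ R.Pts := by
  have hne : R.tt p (Q 0) ≠ R.tt p (Q 1) := by
    intro e
    have h0 : R.tp p.1 (Q 0).1 = R.tp p.1 (Q 1).1 := R.tm_inj (tp_mem (hH 0).1).1 (tp_mem (hH 1).1).1 e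
    have : (0 : Fin 3) = 1 := hi (by simp only [ch, h0])
    exact absurd this (by decide)
  have hlt : min (R.tt p (Q 0)) (R.tt p (Q 1)) < max (R.tt p (Q 0)) (R.tt p (Q 1)) := min_lt_max.2 hne
  obtain ⟨t, ht, hn⟩ := (Set.Ioo_infinite hlt).exists_notMem_finset ((R.on p.1).image (R.tm p.1))
  have hS : R.Span p Q t :=
    (span_tt p Q 0).uIcc (span_tt p Q 1) (Set.Ioo_subset_Icc_self ht)
  refine ⟨t, hS, fun hP => hn ?_⟩
  have hI := hS.inI hH
  exact mem_image.2 ⟨R.F p.1 t, R.mem_on.2 ⟨hP, ⟨_, rfl⟩⟩, R.tm_eq (hI.nn hp) (hI.lt1 hp)⟩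

theorem vk_local (P Q : Fin 3 → Fin n × ℕ) (hH : ∀ i j, R.HL L (P i) (Q j))
    (hP : Function.Injective P) (hQ : Function.Injective Q)
    (h1 : ∀ i, Function.Injective fun k => R.ch l (P i) (Q k))
    (h2 : ∀ j, Function.Injective fun k => R.ch l (Q j) (P k))
    (m1 : ∀ i i', i ≠ i' → ¬ R.Meet (P i) (P i') Q) (m2 : ∀ j j', j ≠ j' → ¬ R.Meet (Q j) (Q j') P) : False := by
  have vP : ∀ i, P i ∈ R.Vs L := fun i => R.inP_vs (hH i 0).2.1
  have vQ : ∀ j, Q j ∈ R.Vs L := fun j => R.inP_vs (hH 0 j).2.2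
  have hH' : ∀ j i, R.HL L (Q j) (P i) := fun j i => (hH i j).symm
  choose τ hτ gτ using fun i => exists_gen (vP i) (hH i) (h1 i)
  choose θ hθ gθ using fun j => exists_gen (vQ j) (hH' j) (h2 j)
  let A : Fin 3 → Fin 3 → Arc := fun i j => segA (R.F (P i).1) (τ i) (R.tt (P i) (Q j))
  let B : Fin 3 → Fin 3 → Arc := fun i j => segA (R.F (Q j).1) (R.tt (Q j) (P i)) (θ j)
  have eA : ∀ i j, R.F (P i).1 (R.tt (P i) (Q j)) = R.tp (P i).1 (Q j).1 := fun i j => tm_tp (hH i j).1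
  have eB : ∀ i j, R.F (Q j).1 (R.tt (Q j) (P i)) = R.tp (P i).1 (Q j).1 := fun i j => by
    rw [tp_comm (hH i j).1]; exact tm_tp (hH' j i).1
  have hj : ∀ i j, (A i j).q = (B i j).p := fun i j => (eA i j).trans (eB i j).symm
  have AB : ∀ i i' j j', i ≠ i' → j ≠ j' → (A i j).Comp (B i' j') := by
    intro i i' j j' hi hjj
    refine null (vP i) (vQ j') (hH i j').ne (hH i j').ncross ((hτ i).inI (hH i)) (hH i j).ttI
      (hH' j' i').ttI ((hθ j').inI (hH' j')) ?_ ?_ ?_ ?_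
    · exact av_gen (vP i) (vQ j') (hH i j').ne ((hτ i).inI (hH i)) (gτ i)
    · rw [eA]; exact av_tp (vQ j') (hH i j) (hH i j').ne (fun e => hjj (hQ e))
    · rw [eB]; exact av_tp (vP i) (hH i' j') (fun e => hi (hP e).symm) (hH i j').ne.symm
    · exact av_gen (vQ j') (vP i) (hH i j').ne.symm ((hθ j').inI (hH' j')) (gθ j')
  refine vk_contra (fun i => R.F (P i).1 (τ i)) (fun j => R.F (Q j).1 (θ j))
    (fun i j => (A i j).cat (B i j)) (fun _ _ => rfl) (fun _ _ => rfl) ?_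
  intro i i' j j' hi hjj
  have cAA : (A i j).Comp (A i' j') := by
    refine comp_disj (R.loop _).cont (R.loop _).cont fun x hx y hy e => ?_
    exact m1 i i' hi ⟨x, y, (hτ i).uIcc (span_tt _ _ j) hx, (hτ i').uIcc (span_tt _ _ j') hy, e⟩
  have cBB : (B i j).Comp (B i' j') := by
    refine comp_disj (R.loop _).cont (R.loop _).cont fun x hx y hy e => ?_
    exact m2 j j' hjj ⟨x, y, (span_tt _ _ i).uIcc (hθ j) hx, (span_tt _ _ i').uIcc (hθ j') hy, e⟩
  exact (cAA.catr (AB i i' j j' hi hjj) (hj _ _)).cat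
    ((AB i' i j' j hi.symm hjj.symm).symm.catr cBB (hj _ _)) (hj _ _)

theorem Meet.symm {p p' : Fin n × ℕ} {Q : Fin 3 → Fin n × ℕ} (h : R.Meet p p' Q) : R.Meet p' p Q := by
  obtain ⟨t, t', h1, h2, h3⟩ := h
  exact ⟨t', t, h2, h1, h3.symm⟩

end Arr

def NR : ℕ := ramsey.choose
theorem NR_pos : 0 < NR := ramsey.choose_spec.1

theorem fin3_pair : ∀ i i' : Fin 3, i ≠ i' → ∃ c : Fin 3, (i = c + 1 ∧ i' = c + 2) ∨ (i' = c + 1 ∧ i = c + 2) := by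
  decide

theorem fin3_ne : ∀ c : Fin 3, c + 1 ≠ c + 2 := by decide

theorem Arr.biclique_false {n : ℕ} {R : Arr n} {L l : ℕ} (a : Fin 21 → Fin n × ℕ) (b : Fin NR → Fin n × ℕ)
    (hH : ∀ i j, R.HL L (a i) (b j))
    (ha : ∀ i i', i ≠ i' → ¬ R.Bad L l (a i) (a i')) (hb : ∀ i i', i ≠ i' → ¬ R.Bad L l (b i) (b i'))
    (ia : ∀ i, Function.Injective fun j => R.ch l (a i) (b j))
    (ib : ∀ j, Function.Injective fun i => R.ch l (b j) (a i)) : False := by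
  obtain ⟨P, Q, hP, hQ, sQ, sP⟩ := ramsey.choose_spec.2 (fun i j => R.ch l (a i) (b j))
    (fun j i => R.ch l (b j) (a i)) ia ib
  have aI : Function.Injective a := fun i i' e => ib ⟨0, NR_pos⟩ (by simp only [e])
  have bI : Function.Injective b := fun i i' e => ia 0 (by simp only [e])
  have hH' : ∀ j i, R.HL L (b j) (a i) := fun j i => (hH i j).symm
  have va : ∀ i, a i ∈ R.Vs L := fun i => R.inP_vs (hH i ⟨0, NR_pos⟩).2.1
  have vb : ∀ i, b i ∈ R.Vs L := fun i => R.inP_vs (hH 0 i).2.2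
  refine pigeon49
    (fun x c y => R.Meet (a (P x (c + 1))) (a (P x (c + 2))) (fun k => b (Q y k)))
    (fun y c x => R.Meet (b (Q y (c + 1))) (b (Q y (c + 2))) (fun k => a (P x k))) ?_ ?_ ?_
  · intro x y
    by_contra hcon
    push Not at hcon
    refine Arr.vk_local (R := R) (L := L) (l := l) (fun k => a (P x k)) (fun k => b (Q y k)) (fun i j => hH _ _)
      (aI.comp (hP x)) (bI.comp (hQ y)) (fun i => (ia _).comp (hQ y)) (fun i => (ib _).comp (hP x)) ?_ ?_
    · intro i i' hi hm
      obtain ⟨c, ⟨rfl, rfl⟩ | ⟨rfl, rfl⟩⟩ := fin3_pair i i' hi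
      · exact hcon.1 c hm
      · exact hcon.1 c hm.symm
    · intro i i' hi hm
      obtain ⟨c, ⟨rfl, rfl⟩ | ⟨rfl, rfl⟩⟩ := fin3_pair i i' hi
      · exact hcon.2 c hm
      · exact hcon.2 c hm.symm
  · intro x c y y' h h'
    by_contra hy
    have hne := fun e => fin3_ne c (hP x e)
    exact Arr.meet_unique (fun e => hne (aI e)) (va _) (va _) (ha _ _ hne) (fun k => hH _ _) (fun k => hH _ _)
      (fun k => hH _ _) (fun k => hH _ _) (sQ _ y y' hy) h h'
  · intro y c x x' h h'
    by_contra hx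
    have hne := fun e => fin3_ne c (hQ y e)
    exact Arr.meet_unique (fun e => hne (bI e)) (vb _) (vb _) (hb _ _ hne) (fun k => hH' _ _) (fun k => hH' _ _)
      (fun k => hH' _ _) (fun k => hH' _ _) (sP y _ x x' hx) h h'
end M7b

section M8
open Finset
open scoped Classical
namespace Arr
variable {n : ℕ}

def kA (K : ℕ) : ℕ := 558 * K ^ 2 * (150660 * K ^ 4)
def kB (K : ℕ) : ℕ := 3 * kA K * K
def kM (K : ℕ) : ℕ := 2 * (21 + NR) ^ 3 * (2 * kB K) ^ (21 * NR) + 1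
def kd (K : ℕ) : ℕ := kA K * kM K
def kr (K : ℕ) : ℕ := 4 * kB K * kM K * K + 1

theorem kA_pos {K : ℕ} (hK : 0 < K) : 0 < kA K := by unfold kA; positivity

theorem core (R : Arr n) {T K : ℕ} (hK : 0 < K) (hT : 0 < T)
    (hE : (univ.filter fun x : Fin n × Fin n => R.Tch x.1 x.2).card = 2 * T)
    (hX : R.Pts.card ≤ K * T) (hn : n * kd K ^ kr K ≤ T) : False := by
  have hA := kA_pos hK
  have hM : 0 < kM K := Nat.succ_pos _
  have hd : 0 < kd K := Nat.mul_pos hA hM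
  obtain ⟨k, hk, hb⟩ := R.exists_level (kd K) (kr K) (Nat.succ_pos _)
  generalize hbb : (univ.filter fun x : R.VT (kd K ^ (k + 1)) × R.VT (kd K ^ (k + 1)) =>
      R.Bad (kd K ^ (k + 1)) (kd K ^ k) x.1.1 x.2.1).card = b at hb
  have hLe : kd K ^ (k + 1) = kA K * (kM K * kd K ^ k) := by
    rw [pow_succ]; unfold kd; ring
  have hl : 0 < kd K ^ k := pow_pos hd k
  have hLp : 0 < kd K ^ (k + 1) := pow_pos hd _
  have hnL : n * kd K ^ (k + 1) ≤ T :=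
    (Nat.mul_le_mul_left _ (Nat.pow_le_pow_right hd hk)).trans hn
  generalize hLL : kd K ^ (k + 1) = L at *
  generalize hll : kd K ^ k = l at *
  have hTK : T ≤ K * T := Nat.le_mul_of_pos_left _ hK
  have hV : Fintype.card (R.VT L) * L ≤ 3 * K * T := by
    have := R.vs_card hLp
    nlinarith
  have hVV : Fintype.card (R.VT L) ≤ 3 * K * T := (Nat.le_mul_of_pos_right _ hLp).trans hV
  have hY : (univ.filter fun x : R.VT L × R.VT L => R.clV L x.1 x.2).card ≤ 5 * K * T := by
    have := R.cross_card (L := L)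
    nlinarith
  have hAL : kA K ≤ L := by
    rw [hLe]; exact Nat.le_mul_of_pos_right _ (Nat.mul_pos hM hl)
  have hKA : 6 * K ≤ kA K := by
    have : kA K = 6 * K * (93 * K * (150660 * K ^ 4)) := by unfold kA; ring
    rw [this]; exact Nat.le_mul_of_pos_right _ (by positivity)
  have hML : kM K * l ≤ L := by
    rw [hLe]; exact Nat.le_mul_of_pos_left _ hA
  have hdeg := fun v => R.deg_le hLp v
  have hsy : ∀ x y, R.HV L x y → R.HV L y x := fun x y h => HL.symm h
  have hsum : ∑ v, (nbr (R.HV L) v).card = 2 * T := by rw [R.sum_deg, hE]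
  have hQ := c4_bound (H := R.HV L) (cl := R.clV L) hsy hdeg hY
    (fun v => R.F v.1.1 (R.rho L v.1)) (R.wArc L)
    (fun t _ => rfl) (fun t _ => rfl) (fun t t' h h' hn => wArc_comp h h' hn)
    hsum hT hK (Nat.mul_pos hM hl) rfl rfl hLe (hKA.trans hAL) hV le_rfl
  change _ ≤ _ * kB K at hQ
  obtain ⟨c, u, h1, h2, h3⟩ := edge_select (H := R.HV L) (bad := fun p q => R.Bad L l p.1 q.1)
    (M := kM K) (b := b) hsy hdeg hsum hLp hQ hbb.le (by
      have e : kr K = 4 * kB K * kM K * K + 1 := rfl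
      by_contra hc
      push Not at hc
      have : kr K * (2 * T) ≤ 4 * kB K * kM K * (2 * (K * T)) := by
        calc kr K * (2 * T) ≤ kr K * (4 * kB K * kM K * b) := Nat.mul_le_mul_left _ hc
          _ = 4 * kB K * kM K * (kr K * b) := by ring
          _ ≤ _ := Nat.mul_le_mul_left _ (hb.trans (Nat.mul_le_mul_left _ hX))
      rw [e] at this
      nlinarith)
  obtain ⟨a, b', g1, g2, g3, g4, g5⟩ := biclique_sample (R.HV L) (fun p q => R.Bad L l p.1 q.1) hsy
    (nbr (R.HV L) c) (nbr (R.HV L) u) L (2 * kB K) (kM K) l (hdeg c) (hdeg u) hLp h1 h2 h3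
    (fun p q => R.ch l p.1 q.1) (fun p k => R.nbr_cnt p l k hl) hML 21 NR (by norm_num) NR_pos
    (Nat.lt_succ_self _)
  exact R.biclique_false (fun i => (a i).1) (fun i => (b' i).1) g1 g2 g3 g4 g5
end Arr
end M8

section M9
open Finset
open scoped Classical

def PB (f : ℕ → ℕ) : Prop := ∃ c e : ℕ, ∀ K, 0 < K → f K ≤ c * K ^ e

theorem PB.mul {f g : ℕ → ℕ} (hf : PB f) (hg : PB g) : PB fun K => f K * g K := by
  obtain ⟨c, e, h⟩ := hf
  obtain ⟨c', e', h'⟩ := hg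
  refine ⟨c * c', e + e', fun K hK => (Nat.mul_le_mul (h K hK) (h' K hK)).trans (le_of_eq ?_)⟩
  ring

theorem PB.add {f g : ℕ → ℕ} (hf : PB f) (hg : PB g) : PB fun K => f K + g K := by
  obtain ⟨c, e, h⟩ := hf
  obtain ⟨c', e', h'⟩ := hg
  refine ⟨c + c', e + e', fun K hK => ?_⟩
  have h1 := Nat.pow_le_pow_right hK (Nat.le_add_right e e')
  have h2 := Nat.pow_le_pow_right hK (Nat.le_add_left e' e)
  have h3 := (h K hK).trans (Nat.mul_le_mul_left c h1)
  have h4 := (h' K hK).trans (Nat.mul_le_mul_left c' h2)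
  rw [add_mul]
  exact Nat.add_le_add h3 h4

theorem PB.const (c : ℕ) : PB fun _ => c := ⟨c, 0, fun K _ => by simp⟩
theorem PB.id : PB fun K => K := ⟨1, 1, fun K _ => by simp⟩
theorem PB.pow {f : ℕ → ℕ} (hf : PB f) (m : ℕ) : PB fun K => f K ^ m := by
  induction m with
  | zero => simpa using PB.const 1
  | succ m ih => simpa only [pow_succ] using ih.mul hf

theorem PB.kk : PB fun K => Arr.kr K * Arr.kd K := by
  have hA : PB Arr.kA := ((PB.const _).mul (PB.id.pow 2)).mul ((PB.const _).mul (PB.id.pow 4))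
  have hB : PB Arr.kB := ((PB.const _).mul hA).mul PB.id
  have hM : PB Arr.kM := ((PB.const _).mul (((PB.const _).mul hB).pow _)).add (PB.const _)
  have hd : PB Arr.kd := hA.mul hM
  have hr : PB Arr.kr := ((((PB.const _).mul hB).mul hM).mul PB.id).add (PB.const _)
  exact hr.mul hd

theorem log_kk : ∃ C : ℝ, 0 < C ∧ ∀ K : ℕ, 0 < K →
    Real.log ((Arr.kr K : ℝ) * Arr.kd K) ≤ C * K := by
  obtain ⟨c, e, h⟩ := PB.kk
  refine ⟨c + e + 1, by positivity, fun K hK => ?_⟩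
  have hp : 0 < Arr.kr K * Arr.kd K :=
    Nat.mul_pos (Nat.succ_pos _) (Nat.mul_pos (Arr.kA_pos hK) (Nat.succ_pos _))
  have h0 := h K hK
  have hc : 0 < c := by
    rcases Nat.eq_zero_or_pos c with rfl | h'
    · rw [zero_mul] at h0; exact absurd h0 (not_le.2 hp)
    · exact h'
  have hK1 : (1 : ℝ) ≤ K := by exact_mod_cast hK
  have h1 : ((Arr.kr K : ℝ) * Arr.kd K) ≤ c * (K : ℝ) ^ e := by exact_mod_cast h0
  have hc' : (0 : ℝ) < c := by exact_mod_cast hc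
  calc Real.log ((Arr.kr K : ℝ) * Arr.kd K) ≤ Real.log (c * (K : ℝ) ^ e) :=
        Real.log_le_log (by exact_mod_cast hp) h1
    _ = Real.log c + e * Real.log K := by
        rw [Real.log_mul hc'.ne' (by positivity), Real.log_pow]
    _ ≤ c + e * K := by
        have := Real.log_le_self hc'.le
        have h2 := Real.log_le_self (by positivity : (0 : ℝ) ≤ K)
        gcongr
    _ ≤ (c + e + 1) * K := by nlinarith

theorem loglog_le {T n r d : ℕ} (hT : 3 * n ≤ T) (hn : 0 < n) (hd : 0 < d) (h : T < n * d ^ r) (hr : 0 < r) :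
    Real.log (Real.log ((T : ℝ) / n)) ≤ Real.log ((r : ℝ) * d) := by
  have hn' : (0 : ℝ) < n := by exact_mod_cast hn
  have hT' : (3 : ℝ) * n ≤ T := by exact_mod_cast hT
  have hd' : (0 : ℝ) < d := by exact_mod_cast hd
  have h' : (T : ℝ) < n * (d : ℝ) ^ r := by exact_mod_cast h
  have h3 : 3 ≤ (T : ℝ) / n := by rw [le_div_iff₀ hn']; exact hT'
  have h4 : (T : ℝ) / n ≤ (d : ℝ) ^ r := by rw [div_le_iff₀ hn']; linarith
  have h5 : 0 < Real.log ((T : ℝ) / n) := Real.log_pos (by linarith)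
  refine Real.log_le_log h5 ?_
  calc _ ≤ Real.log ((d : ℝ) ^ r) := Real.log_le_log (by linarith) h4
    _ = r * Real.log d := Real.log_pow _ _
    _ ≤ _ := by
      have := Real.log_le_self hd'.le
      gcongr

/-! transport -/
def cP : ℂ ≃ₗᵢ[ℝ] Plane := Complex.orthonormalBasisOneI.repr

def sph (s : ℝ) : Metric.sphere (0 : Plane) 1 :=
  ⟨cP (Complex.exp ((2 * Real.pi * s : ℝ) * Complex.I)), by
    rw [mem_sphere_zero_iff_norm, LinearIsometryEquiv.norm_map, Complex.norm_exp_ofReal_mul_I]⟩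

theorem sph_cont : Continuous sph := by
  refine Continuous.subtype_mk (cP.continuous.comp ?_) _
  fun_prop

theorem sph_eq {s t : ℝ} (h : sph s = sph t) : ∃ k : ℤ, s = t + k := by
  have h1 := cP.injective (congrArg Subtype.val h)
  obtain ⟨k, hk⟩ := Complex.exp_eq_exp_iff_exists_int.1 h1
  refine ⟨k, ?_⟩
  have h2 := congrArg Complex.im hk
  simp at h2
  have hp := Real.pi_pos
  have : 2 * Real.pi * (s - (t + k)) = 0 := by linarith
  have h3 := (mul_eq_zero.1 this).resolve_left (by positivity)
  linarith

theorem sph_per (s : ℝ) : sph (s + 1) = sph s := by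
  apply Subtype.ext
  simp only [sph]
  congr 1
  rw [Complex.exp_eq_exp_iff_exists_int]
  exact ⟨1, by push_cast; ring⟩

theorem sph_surj (x : Metric.sphere (0 : Plane) 1) : ∃ s, sph s = x := by
  set z := cP.symm x.1 with hz
  have hn : ‖z‖ = 1 := by
    rw [hz, LinearIsometryEquiv.norm_map]
    exact mem_sphere_zero_iff_norm.1 x.2
  refine ⟨Complex.arg z / (2 * Real.pi), Subtype.ext ?_⟩
  have hp := Real.pi_pos
  have e : 2 * Real.pi * (Complex.arg z / (2 * Real.pi)) = Complex.arg z := by field_simp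
  simp only [sph, e]
  have := Complex.norm_mul_exp_arg_mul_I z
  rw [hn] at this
  simp only [Complex.ofReal_one, one_mul] at this
  rw [this, hz, LinearIsometryEquiv.apply_symm_apply]

theorem exists_loop {γ : Set Plane} (h : IsJordanCurve γ) :
    ∃ g : ℝ → ℂ, IsLoop g ∧ Set.range g = cP.symm '' γ := by
  obtain ⟨f⟩ := h
  refine ⟨fun s => cP.symm (f.symm (sph s)).1, ⟨?_, ?_, ?_⟩, ?_⟩
  · exact cP.symm.continuous.comp (continuous_subtype_val.comp (f.symm.continuous.comp sph_cont))
  · intro x; simp only [sph_per]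
  · intro x y hx hx' hy hy' e
    have h1 := f.symm.injective (Subtype.ext (cP.symm.injective e))
    obtain ⟨k, hk⟩ := sph_eq h1
    have a1 : ((-1 : ℤ) : ℝ) < k := by push_cast; linarith
    have a2 : (k : ℝ) < ((1 : ℤ) : ℝ) := by push_cast; linarith
    have b1 := Int.cast_lt.1 a1
    have b2 := Int.cast_lt.1 a2
    have : k = 0 := by omega
    rw [hk, this]; simp
  · ext z
    constructor
    · rintro ⟨s, rfl⟩
      exact ⟨_, (f.symm (sph s)).2, rfl⟩
    · rintro ⟨x, hx, rfl⟩
      obtain ⟨s, hs⟩ := sph_surj (f ⟨x, hx⟩)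
      exact ⟨s, by simp only [hs, Homeomorph.symm_apply_apply]⟩

theorem inter_fin {n : ℕ} {γ : Fin n → Set Plane} (hg : GenPos γ) : (interPoints γ).Finite := by
  have : interPoints γ ⊆ ⋃ i, ⋃ j, ⋃ (_ : i ≠ j), γ i ∩ γ j := by
    rintro x ⟨i, j, h, h1, h2⟩
    simp only [Set.mem_iUnion]
    exact ⟨i, j, h, h1, h2⟩
  refine Set.Finite.subset ?_ this
  exact Set.finite_iUnion fun i => Set.finite_iUnion fun j => Set.finite_iUnion fun h => hg.1 i j h

theorem touch_le {n : ℕ} {γ : Fin n → Set Plane} (hg : GenPos γ) :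
    touchingPairs γ ≤ (interPoints γ).ncard := by
  have hex : ∀ p : Fin n × Fin n, ∃ x, Touches (γ p.1) (γ p.2) → x ∈ γ p.1 ∧ x ∈ γ p.2 := by
    intro p
    by_cases h : Touches (γ p.1) (γ p.2)
    · obtain ⟨x, hx⟩ := h
      have : x ∈ γ p.1 ∩ γ p.2 := by rw [hx]; rfl
      exact ⟨x, fun _ => this⟩
    · exact ⟨0, fun h' => absurd h' h⟩
  choose f hf using hex
  refine Set.ncard_le_ncard_of_injOn f ?_ ?_ (inter_fin hg)
  · intro p hp
    exact ⟨p.1, p.2, hp.1.ne, (hf p hp.2).1, (hf p hp.2).2⟩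
  · rintro ⟨i, j⟩ hp ⟨i', j'⟩ hq e
    have h1 := hf _ hp.2
    have h2 := hf _ hq.2
    rw [e] at h1
    have l1 : i < j := hp.1
    have l2 : i' < j' := hq.1
    have c1 := hg.2 _ i j i' h1.1 h1.2 h2.1
    have c2 := hg.2 _ i j j' h1.1 h1.2 h2.2
    simp only [Prod.mk.injEq]
    omega

theorem exists_arr {n : ℕ} {γ : Fin n → Set Plane} (hJ : ∀ i, IsJordanCurve (γ i)) (hg : GenPos γ) :
    ∃ R : Arr n, (univ.filter fun x : Fin n × Fin n => R.Tch x.1 x.2).card = 2 * touchingPairs γ ∧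
      R.Pts.card = (interPoints γ).ncard := by
  choose g hl hr using fun i => exists_loop (hJ i)
  have hinj : Function.Injective cP.symm := cP.symm.injective
  have hm : ∀ x i, x ∈ Set.range (g i) ↔ cP x ∈ γ i := by
    intro x i
    rw [hr]
    constructor
    · rintro ⟨y, hy, rfl⟩; simpa using hy
    · intro h; exact ⟨_, h, by simp⟩
  let R : Arr n :=
    { F := g
      loop := hl
      Pts := (inter_fin hg).toFinset.image cP.symm
      mem := by
        intro x
        simp only [hm, Finset.mem_image, Set.Finite.mem_toFinset]
        constructor
        · rintro ⟨y, hy, rfl⟩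
          rw [LinearIsometryEquiv.apply_symm_apply]; exact hy
        · intro h; exact ⟨cP x, h, by simp⟩
      gp := by
        intro x i j k h1 h2 h3
        rw [hm] at h1 h2 h3
        exact hg.2 _ i j k h1 h2 h3 }
  have hT : ∀ i j, R.Tch i j ↔ i ≠ j ∧ Touches (γ i) (γ j) := by
    intro i j
    have e : R.G i ∩ R.G j = cP.symm '' (γ i ∩ γ j) := by
      rw [Set.image_inter hinj, ← hr, ← hr]; rfl
    unfold Arr.Tch
    rw [e]
    refine and_congr_right fun _ => ⟨?_, ?_⟩
    · rintro ⟨x, hx⟩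
      refine ⟨cP x, ?_⟩
      apply hinj.image_injective
      rw [hx]; simp
    · rintro ⟨x, hx⟩
      exact ⟨cP.symm x, by rw [hx]; simp⟩
  have hsym : ∀ i j, R.Tch i j → R.Tch j i := by
    intro i j h
    exact ⟨h.1.symm, by rw [Set.inter_comm]; exact h.2⟩
  refine ⟨R, ?_, ?_⟩
  · have h1 : touchingPairs γ =
        (univ.filter fun x : Fin n × Fin n => x.1 < x.2 ∧ R.Tch x.1 x.2).card := by
      unfold touchingPairs
      rw [← Set.ncard_coe_finset]
      congr 1
      ext p
      simp only [Finset.coe_filter, mem_univ, true_and, Set.mem_ofPred_eq, hT]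
      constructor
      · rintro ⟨a, b⟩; exact ⟨a, a.ne, b⟩
      · rintro ⟨a, _, b⟩; exact ⟨a, b⟩
    have h2 : (univ.filter fun x : Fin n × Fin n => x.1 < x.2 ∧ R.Tch x.1 x.2).card =
        (univ.filter fun x : Fin n × Fin n => x.2 < x.1 ∧ R.Tch x.1 x.2).card := by
      refine Finset.card_bij (fun x _ => x.swap) ?_ ?_ ?_
      · intro x hx
        simp only [mem_filter, mem_univ, true_and, Prod.fst_swap, Prod.snd_swap] at hx ⊢
        exact ⟨hx.1, hsym _ _ hx.2⟩
      · intro x _ y _ e; exact Prod.swap_injective e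
      · intro x hx
        simp only [mem_filter, mem_univ, true_and] at hx
        refine ⟨x.swap, ?_, by simp⟩
        simp only [mem_filter, mem_univ, true_and, Prod.fst_swap, Prod.snd_swap]
        exact ⟨hx.1, hsym _ _ hx.2⟩
    have h3 : (univ.filter fun x : Fin n × Fin n => R.Tch x.1 x.2) =
        (univ.filter fun x : Fin n × Fin n => x.1 < x.2 ∧ R.Tch x.1 x.2) ∪
        (univ.filter fun x : Fin n × Fin n => x.2 < x.1 ∧ R.Tch x.1 x.2) := by
      ext x
      simp only [mem_filter, mem_univ, true_and, mem_union]
      constructor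
      · intro h
        rcases lt_or_gt_of_ne h.1 with h' | h'
        · exact Or.inl ⟨h', h⟩
        · exact Or.inr ⟨h', h⟩
      · rintro (h | h) <;> exact h.2
    rw [h3, card_union_of_disjoint, ← h2, h1]
    · ring
    · rw [Finset.disjoint_left]
      intro x hx hy
      simp only [mem_filter, mem_univ, true_and] at hx hy
      exact lt_asymm hx.1 hy.1
  · change ((inter_fin hg).toFinset.image cP.symm).card = _
    rw [card_image_of_injective _ hinj, Set.ncard_eq_toFinset_card _ (inter_fin hg)]

theorem prt_final :
    ∃ c₁ c₂ : ℝ, 0 < c₁ ∧ 0 < c₂ ∧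
      ∀ (n T : ℕ) (γ : Fin n → Set Plane),
        Function.Injective γ →
        (∀ i, IsJordanCurve (γ i)) →
        GenPos γ →
        (∀ i j : Fin n, i ≠ j → (γ i ∩ γ j).Nonempty) →
        touchingPairs γ = T →
        3 * n ≤ T →
        c₂ * (T : ℝ) * (Real.log (Real.log ((T : ℝ) / (n : ℝ)))) ^ c₁ ≤
          ((interPoints γ).ncard : ℝ) := by
  obtain ⟨C, hC, hlog⟩ := log_kk
  refine ⟨1, 1 / (2 * C), one_pos, by positivity, ?_⟩
  intro n T γ _ hJ hg _ hT h3
  rw [Real.rpow_one]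
  rcases Nat.eq_zero_or_pos T with rfl | hTp
  · simp
  have hn : 0 < n := by
    rcases Nat.eq_zero_or_pos n with rfl | h
    · exfalso
      have : touchingPairs γ = 0 := by
        unfold touchingPairs
        rw [Set.eq_empty_of_isEmpty {p : Fin 0 × Fin 0 | p.1 < p.2 ∧ Touches (γ p.1) (γ p.2)}]
        simp
      omega
    · exact h
  obtain ⟨R, hE, hX⟩ := exists_arr hJ hg
  have hle := touch_le hg
  generalize (interPoints γ).ncard = X at *
  rw [hT] at hE hle
  have hdm := Nat.div_add_mod X T
  have hmod := Nat.mod_lt X hTp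
  set K := X / T + 1 with hK
  have hK0 : 0 < K := Nat.succ_pos _
  have hXK : X ≤ K * T := by rw [hK, add_mul, mul_comm (X / T)]; omega
  have hK2 : K * T ≤ 2 * X := by rw [hK, add_mul, mul_comm (X / T)]; omega
  have hlt : T < n * Arr.kd K ^ Arr.kr K := by
    by_contra hc
    exact R.core hK0 hTp hE (by omega) (not_lt.1 hc)
  have h5 := (loglog_le h3 hn (Nat.mul_pos (Arr.kA_pos hK0) (Nat.succ_pos _)) hlt (Nat.succ_pos _)).trans (hlog K hK0)
  have hT0 : (0 : ℝ) < T := by exact_mod_cast hTp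
  have hK3 : (K : ℝ) * T ≤ 2 * X := by exact_mod_cast hK2
  calc 1 / (2 * C) * (T : ℝ) * Real.log (Real.log ((T : ℝ) / n)) ≤ 1 / (2 * C) * (T : ℝ) * (C * K) := by
        gcongr
    _ = (K * T) / 2 := by field_simp
    _ ≤ X := by linarith
end M9

/-- Pach–Rubin–Tardos crossing lemma for pairwise intersecting closed Jordan curves:
with exactly `T ≥ 3n` touching pairs, the family determines at least
`c₂ · T · (log log (T/n))^{c₁}` intersection points. -/
theorem prt_crossing_lemma :
    ∃ c₁ c₂ : ℝ, 0 < c₁ ∧ 0 < c₂ ∧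
      ∀ (n T : ℕ) (γ : Fin n → Set Plane),
        Function.Injective γ →
        (∀ i, IsJordanCurve (γ i)) →
        GenPos γ →
        (∀ i j : Fin n, i ≠ j → (γ i ∩ γ j).Nonempty) →
        touchingPairs γ = T →
        3 * n ≤ T →
        c₂ * (T : ℝ) * (Real.log (Real.log ((T : ℝ) / (n : ℝ)))) ^ c₁ ≤
          ((interPoints γ).ncard : ℝ) := by
  exact prt_final
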